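/- Let (A, 𝔪_A, k) be a commutative Noetherian local ring, f₁, …, f_c ∈ 𝔪_A an A-regular sequence, and B = A/(f₁, …, f_c) with maximal ideal 𝔪. Let M be a finitely generated B-module that is maximal Cohen–Macaulay over B and admits a finite free resolution over A. Let T be a minimal complete resolution of M over B: a ℤ-indexed acyclic complex ⋯ → T_{i+1} → T_i → T_{i−1} → ⋯ of finite free B-modules with H_n(T) = 0 for all n, d(T_i) ⊆ 𝔪·T_{i−1} for all i, and coker(T₁ → T₀) ≅ M. Then for every natural number n, limsup_{i→∞} rank_B(T_i)/iⁿ = limsup_{i→∞} rank_B(T_{−i})/iⁿ as elements of [0, ∞]; that is, the two ends of the complete resolution grow quasi-polynomially with the same degree and the same leading term. -/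

import Mathlib

open IsLocalRing Filter

/-- `β : ℕ → ℕ` is the sequence of ranks of a free resolution
`⋯ → R^{β 1} → R^{β 0} → M → 0` of `M` over `R`. -/
def IsFreeResolutionBetti (R : Type) [CommRing R] (M : Type) [AddCommGroup M]
    [Module R M] (β : ℕ → ℕ) : Prop :=
  ∃ (d : ∀ i : ℕ, (Fin (β (i + 1)) → R) →ₗ[R] (Fin (β i) → R))
    (ε : (Fin (β 0) → R) →ₗ[R] M),
      Function.Surjective ε ∧
      LinearMap.ker ε = LinearMap.range (d 0) ∧
      (∀ i, LinearMap.ker (d i) = LinearMap.range (d (i + 1)))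

section

open Filter Topology

/-- If `v (n + q) - v n = o(n ^ m)`, then `v n = o(n ^ (m + 1))`. -/
theorem tendsto_div_pow_succ_of_sub {v : ℕ → ℝ} {q : ℕ} (hq : 0 < q) (m : ℕ)
    (h : Tendsto (fun n : ℕ => (v (n + q) - v n) / (n : ℝ) ^ m) atTop (𝓝 0)) :
    Tendsto (fun n : ℕ => v n / (n : ℝ) ^ (m + 1)) atTop (𝓝 0) := by
  rw [Metric.tendsto_atTop] at h ⊢
  intro ε hε
  obtain ⟨N, hN⟩ := h (ε / 2) (by positivity)
  set N₀ := max N 1 with hN₀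
  obtain ⟨C, hC⟩ : ∃ C : ℝ, ∀ n < N₀ + q, |v n| ≤ C := by
    refine ⟨∑ i ∈ Finset.range (N₀ + q), |v i|, fun n hn => ?_⟩
    exact Finset.single_le_sum (f := fun i => |v i|) (fun i _ => abs_nonneg _)
      (Finset.mem_range.2 hn)
  have hC0 : 0 ≤ C := (abs_nonneg _).trans (hC 0 (by omega))
  have key : ∀ n, |v n| ≤ C + ε / 2 * (n : ℝ) ^ (m + 1) := by
    intro n
    induction n using Nat.strong_induction_on with
    | _ n ih =>
      rcases lt_or_ge n (N₀ + q) with hn | hn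
      · exact (hC n hn).trans (le_add_of_nonneg_right (by positivity))
      · obtain ⟨l, rfl⟩ := Nat.exists_eq_add_of_le' (show q ≤ n by omega)
        have hl : N₀ ≤ l := by omega
        have h1 := ih l (by omega)
        have hl1 : 1 ≤ l := le_trans (le_max_right _ _) hl
        have hlpos : (0 : ℝ) < (l : ℝ) ^ m := by
          have : (0 : ℝ) < l := by exact_mod_cast hl1
          positivity
        have h2 := hN l ((le_max_left _ _).trans hl)
        rw [Real.dist_eq, sub_zero, abs_div, abs_of_pos hlpos, div_lt_iff₀ hlpos] at h2
        have h3 : |v (l + q)| ≤ |v l| + |v (l + q) - v l| := by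
          have := abs_add_le (v l) (v (l + q) - v l)
          simpa using this
        have h4 : (l : ℝ) ^ (m + 1) + (l : ℝ) ^ m ≤ ((l + q : ℕ) : ℝ) ^ (m + 1) := by
          have hle : (l : ℝ) ≤ ((l + q : ℕ) : ℝ) := by exact_mod_cast Nat.le_add_right l q
          have hp : (l : ℝ) ^ m ≤ ((l + q : ℕ) : ℝ) ^ m := by gcongr
          have hl2 : (l : ℝ) + 1 ≤ ((l + q : ℕ) : ℝ) := by exact_mod_cast Nat.add_le_add_left hq l
          calc (l : ℝ) ^ (m + 1) + (l : ℝ) ^ m = (l : ℝ) ^ m * (l + 1) := by ring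
            _ ≤ ((l + q : ℕ) : ℝ) ^ m * ((l + q : ℕ) : ℝ) := by gcongr
            _ = _ := by ring
        nlinarith
  obtain ⟨K, hK⟩ := exists_nat_gt (C / (ε / 2))
  refine ⟨max K 1, fun n hn => ?_⟩
  have hn1 : 1 ≤ n := (le_max_right _ _).trans hn
  have hn1' : (1 : ℝ) ≤ n := by exact_mod_cast hn1
  have hnK : (K : ℝ) ≤ n := by exact_mod_cast (le_max_left _ _).trans hn
  have hpos : (0 : ℝ) < (n : ℝ) ^ (m + 1) := by positivity
  rw [Real.dist_eq, sub_zero, abs_div, abs_of_pos hpos, div_lt_iff₀ hpos]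
  have h5 : (n : ℝ) ≤ (n : ℝ) ^ (m + 1) := le_self_pow₀ hn1' (by omega)
  have h6 : C < ε / 2 * n := by
    rw [div_lt_iff₀ (by positivity)] at hK
    nlinarith
  have := key n
  nlinarith

theorem tendsto_add_pow_div_pow (r m : ℕ) :
    Tendsto (fun n : ℕ => ((n + r : ℕ) : ℝ) ^ m / (n : ℝ) ^ m) atTop (𝓝 1) := by
  have h : Tendsto (fun n : ℕ => (1 + (r : ℝ) / n) ^ m) atTop (𝓝 ((1 + 0) ^ m)) :=
    (tendsto_const_nhds.add (tendsto_const_div_atTop_nhds_zero_nat _)).pow m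
  rw [add_zero, one_pow] at h
  refine h.congr' ?_
  filter_upwards [eventually_ge_atTop 1] with n hn
  have : (n : ℝ) ≠ 0 := by positivity
  rw [← div_pow]
  congr 1
  push_cast
  field_simp

theorem tendsto_add_pow_sub_div_pow (Q m : ℕ) :
    Tendsto (fun n : ℕ => (((n + Q : ℕ) : ℝ) ^ (m + 1) - (n : ℝ) ^ (m + 1)) / (n : ℝ) ^ m)
      atTop (𝓝 (Q * (m + 1))) := by
  have h : Tendsto (fun n : ℕ => ∑ i ∈ Finset.range (m + 1),
      (Q : ℝ) * (((n + Q : ℕ) : ℝ) ^ i / (n : ℝ) ^ i)) atTop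
      (𝓝 (∑ i ∈ Finset.range (m + 1), (Q : ℝ) * 1)) :=
    tendsto_finsetSum _ fun i _ => (tendsto_add_pow_div_pow Q i).const_mul _
  have e : ∑ i ∈ Finset.range (m + 1), (Q : ℝ) * 1 = Q * (m + 1) := by
    simp; ring
  rw [e] at h
  refine h.congr' ?_
  filter_upwards [eventually_ge_atTop 1] with n hn
  have hn0 : (n : ℝ) ≠ 0 := by positivity
  rw [← (Commute.all _ _).geom_sum₂_mul, Finset.sum_mul, Finset.sum_div]
  refine Finset.sum_congr rfl fun i hi => ?_
  have hi' : i ≤ m := by simpa [Nat.lt_succ_iff] using hi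
  have : (n : ℝ) ^ m = (n : ℝ) ^ i * (n : ℝ) ^ (m - i) := by rw [← pow_add]; congr 1; omega
  rw [this]
  have e2 : m + 1 - 1 - i = m - i := by omega
  rw [e2]
  push_cast
  field_simp
  ring

theorem apply_add_int_mul_of_periodic {g : ℤ → ℝ} {p : ℕ} (hg : ∀ n, g (n + p) = g n)
    (j n : ℤ) : g (n + j * p) = g n :=
  (Function.Periodic.int_mul (c := (p : ℤ)) hg j) n

theorem exists_abs_le_of_periodic {g : ℤ → ℝ} {p : ℕ} (hp : 0 < p)
    (hg : ∀ n, g (n + p) = g n) : ∃ K, ∀ n, |g n| ≤ K := by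
  refine ⟨∑ i ∈ Finset.range p, |g i|, fun n => ?_⟩
  have e : g n = g ((n % p).toNat : ℕ) := by
    rw [Int.toNat_of_nonneg (Int.emod_nonneg _ (by omega))]
    conv_lhs => rw [← Int.emod_add_mul_ediv n p, mul_comm, apply_add_int_mul_of_periodic hg]
  rw [e]
  refine Finset.single_le_sum (f := fun i : ℕ => |g i|) (fun i _ => abs_nonneg _) ?_
  have := Int.emod_lt_of_pos n (show (0 : ℤ) < p by omega)
  have := Int.emod_nonneg n (show (p : ℤ) ≠ 0 by omega)
  rw [Finset.mem_range]; omega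

theorem tendsto_shift_div_pow_sub_periodic {h : ℕ → ℝ} {g : ℤ → ℝ} {p m : ℕ} (hp : 0 < p)
    (σ s : ℤ) (hg : ∀ n, g (n + p) = g n)
    (hh : Tendsto (fun n : ℕ => h n / (n : ℝ) ^ m - g (s + σ * n)) atTop (𝓝 0)) (r : ℕ) :
    Tendsto (fun n : ℕ => h (n + r) / (n : ℝ) ^ m - g (s + σ * n + σ * r)) atTop (𝓝 0) := by
  have ha := hh.comp (tendsto_add_atTop_nat r)
  have hb : Tendsto (fun n : ℕ => (h (n + r) / ((n + r : ℕ) : ℝ) ^ m -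
      g (s + σ * ((n + r : ℕ) : ℤ))) * (((n + r : ℕ) : ℝ) ^ m / (n : ℝ) ^ m)) atTop (𝓝 (0 * 1)) :=
    ha.mul (tendsto_add_pow_div_pow r m)
  obtain ⟨K, hK⟩ := exists_abs_le_of_periodic hp hg
  have hc : Tendsto (fun n : ℕ => g (s + σ * n + σ * r) *
      (((n + r : ℕ) : ℝ) ^ m / (n : ℝ) ^ m - 1)) atTop (𝓝 0) := by
    refine bdd_le_mul_tendsto_zero' K (Eventually.of_forall fun n => hK _) ?_
    simpa using (tendsto_add_pow_div_pow r m).sub_const 1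
  have hs := hb.add hc
  rw [zero_mul, add_zero] at hs
  refine hs.congr' ?_
  filter_upwards [eventually_ge_atTop 1] with n hn
  have hn0 : (n : ℝ) ≠ 0 := by positivity
  have hn1 : ((n + r : ℕ) : ℝ) ≠ 0 := by positivity
  have e : s + σ * ((n + r : ℕ) : ℤ) = s + σ * n + σ * r := by push_cast; ring
  rw [e]
  field_simp
  ring

/-- A sequence whose `q`-step difference is `g n * n ^ m + o(n ^ m)` with `g` periodic
is asymptotic to an explicit periodic multiple of `n ^ (m + 1)`. -/
theorem tendsto_div_pow_succ_of_periodic {u h : ℕ → ℝ} {g : ℤ → ℝ} {p q m : ℕ}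
    (hp : 0 < p) (hq : 0 < q) (σ : ℤ) (s : ℤ)
    (hg : ∀ n, g (n + p) = g n)
    (hu : ∀ᶠ n in atTop, u (n + q) - u n = h n)
    (hh : Tendsto (fun n : ℕ => h n / (n : ℝ) ^ m - g (s + σ * n)) atTop (𝓝 0)) :
    Tendsto (fun n : ℕ => u n / (n : ℝ) ^ (m + 1) -
      (∑ i ∈ Finset.range p, g (s + σ * n + σ * (q * i))) / (p * q * (m + 1))) atTop (𝓝 0) := by
  have hg' := apply_add_int_mul_of_periodic hg
  set G : ℕ → ℝ := fun n => ∑ i ∈ Finset.range p, g (s + σ * n + σ * (q * i)) with hG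
  set Q := p * q with hQ
  have hGper : ∀ n, G (n + Q) = G n := by
    intro n
    refine Finset.sum_congr rfl fun i _ => ?_
    rw [← hg' (σ * q) (s + σ * n + σ * (q * i))]
    congr 1
    push_cast [hQ]
    ring
  have hQpos : 0 < Q := Nat.mul_pos hp hq
  have hGbd : ∃ K, ∀ n, |G n| ≤ K := by
    refine ⟨∑ i ∈ Finset.range Q, |G i|, fun n => ?_⟩
    have : G n = G (n % Q) := by
      conv_lhs => rw [← Nat.mod_add_div n Q]
      generalize n / Q = t
      induction t with
      | zero => simp
      | succ t ih => rw [← ih, ← hGper (n % Q + Q * t), Nat.mul_succ, Nat.add_assoc]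
    rw [this]
    exact Finset.single_le_sum (f := fun i => |G i|) (fun i _ => abs_nonneg _)
      (Finset.mem_range.2 (Nat.mod_lt _ hQpos))
  obtain ⟨K, hK⟩ := hGbd
  set D : ℝ := p * q * (m + 1) with hD
  have hDpos : 0 < D := by positivity
  set v : ℕ → ℝ := fun n => u n - G n / D * (n : ℝ) ^ (m + 1) with hv
  have hstep : ∀ᶠ n in atTop, ∀ i, u (n + q * i) - u n = ∑ j ∈ Finset.range i, h (n + q * j) := by
    obtain ⟨N, hN⟩ := eventually_atTop.1 hu
    refine eventually_atTop.2 ⟨N, fun n hn i => ?_⟩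
    induction i with
    | zero => simp
    | succ i ih =>
      rw [Finset.sum_range_succ, ← ih, ← hN (n + q * i) (by omega)]
      rw [show n + q * (i + 1) = n + q * i + q by ring]
      ring
  have h1 := tendsto_shift_div_pow_sub_periodic hp σ s hg hh
  have h2 : Tendsto (fun n : ℕ => (v (n + Q) - v n) / (n : ℝ) ^ m) atTop (𝓝 0) := by
    have ha : Tendsto (fun n : ℕ => ∑ i ∈ Finset.range p,
        (h (n + q * i) / (n : ℝ) ^ m - g (s + σ * n + σ * (q * i)))) atTop
        (𝓝 (∑ i ∈ Finset.range p, 0)) :=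
      tendsto_finsetSum _ fun i _ => by simpa using h1 (q * i)
    have hb : Tendsto (fun n : ℕ => G n * ((((n + Q : ℕ) : ℝ) ^ (m + 1) - (n : ℝ) ^ (m + 1)) /
        (n : ℝ) ^ m / D - 1)) atTop (𝓝 0) := by
      refine bdd_le_mul_tendsto_zero' K (Eventually.of_forall fun n => hK _) ?_
      have := ((tendsto_add_pow_sub_div_pow Q m).div_const D).sub_const 1
      have e : (Q : ℝ) * (m + 1) / D - 1 = 0 := by
        rw [hQ, hD]; push_cast; rw [div_self, sub_self]; positivity
      rwa [e] at this
    have hs := ha.sub hb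
    rw [Finset.sum_const_zero, sub_zero] at hs
    refine hs.congr' ?_
    filter_upwards [eventually_ge_atTop 1, hstep] with n hn hst
    have hn0 : (n : ℝ) ≠ 0 := by positivity
    have e1 := hst p
    rw [mul_comm q p, ← hQ] at e1
    have e2 : v (n + Q) - v n = ∑ j ∈ Finset.range p, h (n + q * j) -
        G n / D * (((n + Q : ℕ) : ℝ) ^ (m + 1) - (n : ℝ) ^ (m + 1)) := by
      simp only [hv]
      rw [hGper n, ← e1]
      ring
    rw [e2, Finset.sum_sub_distrib, ← Finset.sum_div]
    change _ / _ - G n - _ = _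
    field_simp
    ring
  have h3 := tendsto_div_pow_succ_of_sub hQpos m h2
  refine h3.congr' ?_
  filter_upwards [eventually_ge_atTop 1] with n hn
  have hn0 : (n : ℝ) ≠ 0 := by positivity
  simp only [hv]
  change _ = _ - G n / D
  field_simp

/-- Both ends of `a : ℤ → ℕ` are asymptotic to the same nonzero periodic multiple of `n ^ m`,
up to a reflection of the periodic factor. -/
def SymmetricGrowth (m : ℕ) (a : ℤ → ℕ) : Prop :=
  ∃ (p : ℕ) (s : ℤ) (L : ℤ → ℝ), 0 < p ∧ (∀ n, L (n + p) = L n) ∧ (∀ n, 0 ≤ L n) ∧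
    (∃ n, 0 < L n) ∧
    Tendsto (fun n : ℕ => (a n : ℝ) / (n : ℝ) ^ m - L n) atTop (𝓝 0) ∧
    Tendsto (fun n : ℕ => (a (-n) : ℝ) / (n : ℝ) ^ m - L (s - n)) atTop (𝓝 0)

theorem SymmetricGrowth.of_periodic {a : ℤ → ℕ} {q : ℕ} (hq : 0 < q)
    (ha : ∀ n, a (n + q) = a n) (h0 : ∃ n, a n ≠ 0) : SymmetricGrowth 0 a := by
  refine ⟨q, 0, fun n => a n, hq, fun n => by simp [ha], fun n => by positivity, ?_, ?_, ?_⟩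
  · obtain ⟨n, hn⟩ := h0
    exact ⟨n, by positivity⟩
  · simp
  · simp

theorem SymmetricGrowth.step {a a' : ℤ → ℕ} {m q : ℕ} (hq : 0 < q) (h : SymmetricGrowth m a')
    (hpos : ∀ᶠ n : ℤ in atTop, a' n + a (n - q) = a n)
    (hneg : ∀ᶠ n : ℤ in atBot, a' n + a (n + 1) = a (n + 1 - q)) :
    SymmetricGrowth (m + 1) a := by
  obtain ⟨p, s, L, hp, hper, hnn, ⟨n₀, hn₀⟩, h1, h2⟩ := h
  have hper' := apply_add_int_mul_of_periodic hper
  set G : ℤ → ℝ := fun n => (∑ i ∈ Finset.range p, L (n + q * i)) / (p * q * (m + 1)) with hG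
  have hGq : ∀ n, G (n + q) = G n := by
    intro n
    simp only [hG]
    congr 1
    have e := Finset.sum_range_succ' (fun i : ℕ => L (n + q * i)) p
    rw [Finset.sum_range_succ] at e
    have e2 : L (n + q * (p : ℕ)) = L (n + q * ((0 : ℕ) : ℤ)) := by
      rw [hper' q n]; simp
    rw [e2] at e
    rw [add_right_cancel e]
    refine Finset.sum_congr rfl fun i _ => ?_
    congr 1; push_cast; ring
  have hGq' := apply_add_int_mul_of_periodic hGq
  have hD : (0 : ℝ) < p * q * (m + 1) := by positivity
  refine ⟨q, s - 1, G, hq, hGq, fun n => ?_, ⟨n₀, ?_⟩, ?_, ?_⟩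
  · exact div_nonneg (Finset.sum_nonneg fun i _ => hnn _) hD.le
  · refine div_pos (Finset.sum_pos' (fun i _ => hnn _) ⟨0, Finset.mem_range.2 hp, ?_⟩) hD
    simpa using hn₀
  · have hshift := tendsto_shift_div_pow_sub_periodic (h := fun n => (a' n : ℝ)) hp 1 0 hper
      (by simpa using h1) q
    have hu : ∀ᶠ n : ℕ in atTop, (a ((n + q : ℕ) : ℤ) : ℝ) - a n = a' ((n + q : ℕ) : ℤ) := by
      have := (tendsto_natCast_atTop_atTop (R := ℤ)).comp (tendsto_add_atTop_nat q)
      filter_upwards [this.eventually hpos] with n hn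
      have e : (((n + q : ℕ) : ℤ) - q) = n := by push_cast; ring
      simp only [Function.comp] at hn
      rw [e] at hn
      rw [← hn]; push_cast; ring
    have := tendsto_div_pow_succ_of_periodic (u := fun n => (a n : ℝ))
      (h := fun n => (a' ((n + q : ℕ) : ℤ) : ℝ)) hp hq 1 q hper hu
      (by refine hshift.congr fun n => ?_; congr 2; ring)
    refine this.congr fun n => ?_
    congr 1
    rw [← hGq]
    simp only [hG]
    congr 1
    refine Finset.sum_congr rfl fun i _ => ?_
    congr 1; ring
  · have hshift := tendsto_shift_div_pow_sub_periodic (h := fun n => (a' (-n) : ℝ)) hp (-1) s hper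
      (by refine h2.congr fun n => ?_; congr 2; ring) 1
    have hu : ∀ᶠ n : ℕ in atTop, (a (-((n + q : ℕ) : ℤ)) : ℝ) - a (-n) =
        a' (-((n + 1 : ℕ) : ℤ)) := by
      have := (tendsto_natCast_atTop_atTop (R := ℤ)).comp (tendsto_add_atTop_nat 1)
      filter_upwards [(tendsto_neg_atTop_atBot.comp this).eventually hneg] with n hn
      simp only [Function.comp] at hn
      have e1 : (-((n + 1 : ℕ) : ℤ) + 1) = -n := by push_cast; ring
      have e2 : (-(n : ℤ) - q) = -((n + q : ℕ) : ℤ) := by push_cast; ring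
      rw [e1, e2] at hn
      rw [← hn]; push_cast; ring
    have := tendsto_div_pow_succ_of_periodic (u := fun n => (a (-n) : ℝ))
      (h := fun n => (a' (-((n + 1 : ℕ) : ℤ)) : ℝ)) hp hq (-1) (s - 1) hper hu
      (by refine hshift.congr fun n => ?_; congr 2; push_cast; ring)
    refine this.congr fun n => ?_
    congr 1
    have e : s - 1 - (n : ℤ) = (s - 1 - n + (-p : ℤ) * q + q) + (p - 1 : ℤ) * q := by ring
    rw [e, hGq', hGq, ← hGq' 1]
    simp only [hG]
    congr 1
    rw [← Finset.sum_range_reflect]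
    refine Finset.sum_congr rfl fun i hi => ?_
    have hi := Finset.mem_range.1 hi
    congr 1
    rw [Nat.cast_sub (by omega), Nat.cast_sub (by omega)]
    push_cast
    ring

theorem limsup_ofReal_eq_iSup_of_periodic {u : ℕ → ℝ} {g : ℤ → ℝ} {p : ℕ} (hp : 0 < p)
    (hg : ∀ n, g (n + p) = g n) (σ s : ℤ) (hσ : σ = 1 ∨ σ = -1)
    (hu : Tendsto (fun n : ℕ => u n - g (s + σ * n)) atTop (𝓝 0)) :
    limsup (fun n => ENNReal.ofReal (u n)) atTop = ⨆ n, ENNReal.ofReal (g n) := by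
  apply le_antisymm
  · refine ENNReal.le_of_forall_pos_le_add fun ε hε _ => ?_
    refine limsup_le_of_le (by isBoundedDefault) ?_
    have := (tendsto_order.1 hu).2 ε (by exact_mod_cast hε)
    filter_upwards [this] with n hn
    calc ENNReal.ofReal (u n) ≤ ENNReal.ofReal (g (s + σ * n) + ε) :=
          ENNReal.ofReal_le_ofReal (by linarith)
      _ ≤ ENNReal.ofReal (g (s + σ * n)) + ENNReal.ofReal ε := ENNReal.ofReal_add_le
      _ ≤ _ := by
        rw [ENNReal.ofReal_coe_nnreal]
        gcongr
        exact le_iSup (fun n => ENNReal.ofReal (g n)) _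
  · refine iSup_le fun r => ?_
    refine ENNReal.le_of_forall_pos_le_add fun ε hε _ => ?_
    rw [← tsub_le_iff_right]
    refine le_limsup_of_frequently_le ?_ (by isBoundedDefault)
    have h1 := (tendsto_order.1 hu).1 (-ε) (by simpa using hε)
    have h2 : ∃ᶠ n : ℕ in atTop, g (s + σ * n) = g r := by
      rw [frequently_atTop]
      intro N
      refine ⟨((σ * (r - s)) + p * (N + (σ * (r - s)).natAbs)).toNat, ?_, ?_⟩
      · have : (1 : ℤ) * (N + (σ * (r - s)).natAbs) ≤ p * (N + (σ * (r - s)).natAbs) :=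
          mul_le_mul_of_nonneg_right (by omega) (by positivity)
        generalize (p : ℤ) * (N + (σ * (r - s)).natAbs) = y at this ⊢
        generalize σ * (r - s) = z at this ⊢
        omega
      · rw [Int.toNat_of_nonneg, ← apply_add_int_mul_of_periodic hg
          (σ * (N + (σ * (r - s)).natAbs)) r]
        · congr 1
          have : σ * σ = 1 := by rcases hσ with rfl | rfl <;> rfl
          linear_combination (r - s) * this
        · have : (1 : ℤ) * (N + (σ * (r - s)).natAbs) ≤ p * (N + (σ * (r - s)).natAbs) :=
            mul_le_mul_of_nonneg_right (by omega) (by positivity)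
          omega
    refine (h2.and_eventually h1).mono fun n ⟨hn, hn'⟩ => ?_
    rw [tsub_le_iff_right, ← hn, ← ENNReal.ofReal_coe_nnreal (p := ε)]
    refine le_trans (ENNReal.ofReal_le_ofReal ?_) ENNReal.ofReal_add_le
    linarith

theorem limsup_ofReal_div_pow_eq_top {u : ℕ → ℝ} {g : ℤ → ℝ} {p m n : ℕ} (hp : 0 < p)
    (hg : ∀ n, g (n + p) = g n) (hpos : ∃ n, 0 < g n) (σ s : ℤ) (hσ : σ = 1 ∨ σ = -1)
    (hu : Tendsto (fun n : ℕ => u n / (n : ℝ) ^ m - g (s + σ * n)) atTop (𝓝 0)) (hn : n < m) :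
    limsup (fun i : ℕ => ENNReal.ofReal (u i / (i : ℝ) ^ n)) atTop = ⊤ := by
  have key := limsup_ofReal_eq_iSup_of_periodic hp hg σ s hσ hu
  obtain ⟨r, hr⟩ := hpos
  have hlt : ENNReal.ofReal (g r / 2) < limsup (fun i : ℕ => ENNReal.ofReal (u i / (i : ℝ) ^ m))
      atTop := by
    rw [key]
    refine lt_of_lt_of_le ?_ (le_iSup (fun n => ENNReal.ofReal (g n)) r)
    exact (ENNReal.ofReal_lt_ofReal_iff hr).2 (by linarith)
  have hfr := frequently_lt_of_lt_limsup (by isBoundedDefault) hlt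
  refine ENNReal.eq_top_of_forall_nnreal_le fun K => ?_
  refine le_limsup_of_frequently_le ?_ (by isBoundedDefault)
  obtain ⟨N, hN⟩ := exists_nat_gt (K / (g r / 2))
  refine (hfr.and_eventually (eventually_ge_atTop (max N 1))).mono fun i ⟨h1, h2⟩ => ?_
  have hi1 : (1 : ℝ) ≤ i := by exact_mod_cast (le_max_right _ _).trans h2
  have hiN : (N : ℝ) ≤ i := by exact_mod_cast (le_max_left _ _).trans h2
  rw [ENNReal.ofReal_lt_ofReal_iff_of_nonneg (by linarith)] at h1
  rw [← ENNReal.ofReal_coe_nnreal (p := K)]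
  refine ENNReal.ofReal_le_ofReal ?_
  have e : u i / (i : ℝ) ^ n = u i / (i : ℝ) ^ m * (i : ℝ) ^ (m - n) := by
    have : (i : ℝ) ^ m = (i : ℝ) ^ n * (i : ℝ) ^ (m - n) := by rw [← pow_add]; congr 1; omega
    rw [this]
    have : (i : ℝ) ≠ 0 := by positivity
    field_simp
  have h3 : (i : ℝ) ≤ (i : ℝ) ^ (m - n) := le_self_pow₀ hi1 (by omega)
  rw [div_lt_iff₀ (by positivity)] at hN
  rw [e]
  nlinarith

theorem tendsto_div_pow_zero_of_periodic {u : ℕ → ℝ} {g : ℤ → ℝ} {p m n : ℕ} (hp : 0 < p)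
    (hg : ∀ n, g (n + p) = g n) (σ s : ℤ)
    (hu : Tendsto (fun n : ℕ => u n / (n : ℝ) ^ m - g (s + σ * n)) atTop (𝓝 0)) (hn : m < n) :
    Tendsto (fun i : ℕ => u i / (i : ℝ) ^ n) atTop (𝓝 0) := by
  obtain ⟨K, hK⟩ := exists_abs_le_of_periodic hp hg
  have h0 : Tendsto (fun i : ℕ => ((i : ℝ) ^ (n - m))⁻¹) atTop (𝓝 0) :=
    tendsto_inv_atTop_zero.comp ((tendsto_pow_atTop (by omega)).comp tendsto_natCast_atTop_atTop)
  have h1 := hu.mul h0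
  have h2 : Tendsto (fun i : ℕ => g (s + σ * i) * ((i : ℝ) ^ (n - m))⁻¹) atTop (𝓝 0) :=
    bdd_le_mul_tendsto_zero' K (Eventually.of_forall fun n => hK _) h0
  have h3 := h1.add h2
  rw [zero_mul, add_zero] at h3
  refine h3.congr' ?_
  filter_upwards [eventually_ge_atTop 1] with i hi
  have : (i : ℝ) ^ n = (i : ℝ) ^ m * (i : ℝ) ^ (n - m) := by rw [← pow_add]; congr 1; omega
  rw [this]
  have : (i : ℝ) ≠ 0 := by positivity
  field_simp
  ring

theorem SymmetricGrowth.limsup_eq {a : ℤ → ℕ} {m : ℕ} (h : SymmetricGrowth m a) (n : ℕ) :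
    limsup (fun i : ℕ => (a (i : ℤ) : ENNReal) / (i : ENNReal) ^ n) atTop
      = limsup (fun i : ℕ => (a (-(i : ℤ)) : ENNReal) / (i : ENNReal) ^ n) atTop := by
  obtain ⟨p, s, L, hp, hper, -, hpos, h1, h2⟩ := h
  have conv : ∀ b : ℕ → ℕ, limsup (fun i : ℕ => (b i : ENNReal) / (i : ENNReal) ^ n) atTop =
      limsup (fun i : ℕ => ENNReal.ofReal ((b i : ℝ) / (i : ℝ) ^ n)) atTop := by
    intro b
    refine limsup_congr ?_
    filter_upwards [eventually_ge_atTop 1] with i hi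
    have : (0 : ℝ) < i := by positivity
    rw [ENNReal.ofReal_div_of_pos (by positivity), ENNReal.ofReal_pow (by positivity)]
    simp
  rw [conv (fun i => a i), conv (fun i => a (-i))]
  have h1' : Tendsto (fun i : ℕ => (a i : ℝ) / (i : ℝ) ^ m - L (0 + 1 * i)) atTop (𝓝 0) := by
    simpa using h1
  have h2' : Tendsto (fun i : ℕ => (a (-i) : ℝ) / (i : ℝ) ^ m - L (s + (-1) * i)) atTop (𝓝 0) := by
    refine h2.congr fun i => ?_
    congr 2; ring
  rcases lt_trichotomy n m with hn | rfl | hn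
  · rw [limsup_ofReal_div_pow_eq_top hp hper hpos _ _ (Or.inl rfl) h1' hn,
      limsup_ofReal_div_pow_eq_top hp hper hpos _ _ (Or.inr rfl) h2' hn]
  · rw [limsup_ofReal_eq_iSup_of_periodic hp hper _ _ (Or.inl rfl) h1',
      limsup_ofReal_eq_iSup_of_periodic hp hper _ _ (Or.inr rfl) h2']
  · have t1 := ENNReal.tendsto_ofReal (tendsto_div_pow_zero_of_periodic hp hper _ _ h1' hn)
    have t2 := ENNReal.tendsto_ofReal (tendsto_div_pow_zero_of_periodic hp hper _ _ h2' hn)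
    rw [t1.limsup_eq, t2.limsup_eq]

end

section

open MvPolynomial

/-- A vector space with commuting operators `X₁, …, X_c` of degree `-2` and orthogonal projections
onto finite-dimensional pieces indexed by `ℤ`. -/
structure GradedOp (k : Type) [Field k] (c : ℕ) where
  V : Type
  [acg : AddCommGroup V]
  [mod : Module k V]
  ρ : MvPolynomial (Fin c) k →ₐ[k] Module.End k V
  P : ℤ → Module.End k V
  P_P : ∀ m n v, P m (P n v) = if m = n then P n v else 0
  X_P : ∀ i n v, ρ (X i) (P n v) = P (n - 2) (ρ (X i) v)
  fin : ∀ n, Module.Finite k (LinearMap.range (P n))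

namespace GradedOp

attribute [instance] GradedOp.acg GradedOp.mod GradedOp.fin

variable {k : Type} [Field k] {c : ℕ} (G G' G'' : GradedOp k c)

noncomputable instance : Module (MvPolynomial (Fin c) k) G.V :=
  Module.compHom G.V (G.ρ : MvPolynomial (Fin c) k →+* Module.End k G.V)

lemma smul_def (s : MvPolynomial (Fin c) k) (v : G.V) : s • v = G.ρ s v := rfl

instance : IsScalarTower k (MvPolynomial (Fin c) k) G.V where
  smul_assoc a s v := by simp [smul_def]

lemma C_smul (a : k) (v : G.V) : (C a : MvPolynomial (Fin c) k) • v = a • v := by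
  rw [← algebraMap_smul (MvPolynomial (Fin c) k) a v, MvPolynomial.algebraMap_eq]

lemma X_smul_P (i : Fin c) (n : ℤ) (v : G.V) :
    (X i : MvPolynomial (Fin c) k) • G.P n v = G.P (n - 2) ((X i : MvPolynomial (Fin c) k) • v) :=
  G.X_P i n v

lemma P_self (n : ℤ) (v : G.V) : G.P n (G.P n v) = G.P n v := by simp [G.P_P]

variable {G} in
lemma P_of_ne {m n : ℤ} {v : G.V} (h : G.P n v = v) (hmn : m ≠ n) : G.P m v = 0 := by
  rw [← h, G.P_P, if_neg hmn]

lemma mem_range_P {n : ℤ} {v : G.V} : v ∈ LinearMap.range (G.P n) ↔ G.P n v = v :=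
  ⟨by rintro ⟨w, rfl⟩; exact G.P_self n w, fun h => ⟨v, h⟩⟩

/-- A `k`-subspace stable under the operators is a submodule over the polynomial ring. -/
def submoduleOfStable (W : Submodule k G.V)
    (h : ∀ i, ∀ v ∈ W, (X i : MvPolynomial (Fin c) k) • v ∈ W) :
    Submodule (MvPolynomial (Fin c) k) G.V where
  toAddSubmonoid := W.toAddSubmonoid
  smul_mem' s := by
    induction s using MvPolynomial.induction_on with
    | C a => intro v hv; rw [C_smul]; exact W.smul_mem a hv
    | add p q hp hq => intro v hv; rw [add_smul]; exact W.add_mem (hp hv) (hq hv)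
    | mul_X p i hp => intro v hv; rw [mul_smul]; exact hp (h i v hv)

/-- The submodule generated by the pieces of degree at most `N`. -/
def low (N : ℤ) : Submodule (MvPolynomial (Fin c) k) G.V :=
  G.submoduleOfStable (Submodule.span k {v | ∃ n ≤ N, G.P n v = v}) <| by
    intro i v hv
    induction hv using Submodule.span_induction with
    | mem v hv =>
      obtain ⟨n, hn, hv⟩ := hv
      refine Submodule.subset_span ⟨n - 2, by omega, ?_⟩
      rw [← X_smul_P, hv]
    | zero => simp
    | add v w _ _ hv hw => rw [smul_add]; exact add_mem hv hw
    | smul a v _ hv => rw [smul_comm]; exact Submodule.smul_mem _ _ hv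

lemma mem_low_iff {N : ℤ} {v : G.V} :
    v ∈ G.low N ↔ v ∈ Submodule.span k {v | ∃ n ≤ N, G.P n v = v} := Iff.rfl

variable {G} in
lemma mem_low_of_P {n N : ℤ} (h : n ≤ N) {v : G.V} (hv : G.P n v = v) : v ∈ G.low N :=
  Submodule.subset_span (s := {v | ∃ n ≤ N, G.P n v = v}) ⟨n, h, hv⟩

lemma P_mem_low {n N : ℤ} (h : n ≤ N) (v : G.V) : G.P n v ∈ G.low N :=
  mem_low_of_P h (G.P_self n v)

variable {G} in
lemma exists_sum_P_of_mem_low {N : ℤ} {v : G.V} (hv : v ∈ G.low N) :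
    ∃ s : Finset ℤ, (∀ n ∈ s, n ≤ N) ∧ v = ∑ n ∈ s, G.P n v := by
  rw [mem_low_iff] at hv
  have key : ∀ (s : Finset ℤ) (v : G.V), v = ∑ n ∈ s, G.P n v → ∀ m ∉ s, G.P m v = 0 := by
    intro s v h m hm
    rw [h, map_sum]
    refine Finset.sum_eq_zero fun n hn => ?_
    rw [G.P_P, if_neg]
    rintro rfl
    exact hm hn
  induction hv using Submodule.span_induction with
  | mem v hv =>
    obtain ⟨n, hn, hv⟩ := hv
    exact ⟨{n}, by simpa using hn, by simp [hv]⟩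
  | zero => exact ⟨∅, by simp, by simp⟩
  | add v w _ _ hv hw =>
    obtain ⟨s, hs, hv⟩ := hv
    obtain ⟨t, ht, hw⟩ := hw
    refine ⟨s ∪ t, fun n hn => (Finset.mem_union.1 hn).elim (hs n) (ht n), ?_⟩
    simp only [map_add, Finset.sum_add_distrib]
    congr 1
    · conv_lhs => rw [hv]
      exact Finset.sum_subset Finset.subset_union_left fun m _ hm => key s v hv m hm
    · conv_lhs => rw [hw]
      exact Finset.sum_subset Finset.subset_union_right fun m _ hm => key t w hw m hm
  | smul a v _ hv =>
    obtain ⟨s, hs, hv⟩ := hv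
    refine ⟨s, hs, ?_⟩
    simp only [map_smul, ← Finset.smul_sum]
    rw [← hv]

lemma low_mono {N N' : ℤ} (h : N ≤ N') : G.low N ≤ G.low N' :=
  fun _ hv => Submodule.span_mono (s := {v | ∃ n ≤ N, G.P n v = v})
    (t := {v | ∃ n ≤ N', G.P n v = v}) (fun _ ⟨n, hn, hv⟩ => ⟨n, hn.trans h, hv⟩) hv

/-- The graded dual structure: transposed operators, with degrees negated. -/
noncomputable def dual : GradedOp k c where
  V := Module.Dual k G.V
  ρ := AlgHom.ofLinearMap
    { toFun := fun s => (G.ρ s).dualMap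
      map_add' := fun s t => by ext; simp
      map_smul' := fun a s => by ext; simp }
    (by ext; simp)
    (by
      intro s t
      ext φ v
      rw [mul_comm]
      simp)
  P n := (G.P (-n)).dualMap
  P_P m n φ := by
    ext v
    simp only [LinearMap.dualMap_apply, G.P_P]
    by_cases h : m = n
    · simp [h]
    · simp [h, Ne.symm h]
  X_P i n φ := by
    ext v
    simp only [AlgHom.ofLinearMap_apply, LinearMap.coe_mk, AddHom.coe_mk, LinearMap.dualMap_apply]
    rw [G.X_P]
    congr 3
    ring
  fin n := by
    rw [LinearMap.range_dualMap_eq_dualAnnihilator_ker]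
    rw [Submodule.finite_dualAnnihilator_iff]
    exact Module.Finite.equiv (G.P (-n)).quotKerEquivRange.symm

lemma dual_smul_apply (s : MvPolynomial (Fin c) k) (φ : G.dual.V) (v : G.V) :
    (show Module.Dual k G.V from s • φ) v = (show Module.Dual k G.V from φ) (s • v) := rfl

lemma dual_P_apply (n : ℤ) (φ : G.dual.V) (v : G.V) :
    (show Module.Dual k G.V from G.dual.P n φ) v =
      (show Module.Dual k G.V from φ) (G.P (-n) v) := rfl

end GradedOp

end

section

open MvPolynomial
namespace GradedOp

variable {k : Type} [Field k] {c : ℕ} {G G' G'' : GradedOp k c}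

/-- A linear map commuting with the operators and shifting degrees by `δ`. -/
structure IsHom (δ : ℤ) (α : G.V →ₗ[k] G'.V) : Prop where
  map_X : ∀ i v, α ((X i : MvPolynomial (Fin c) k) • v) = (X i : MvPolynomial (Fin c) k) • α v
  map_P : ∀ n v, α (G.P n v) = G'.P (n + δ) (α v)

lemma IsHom.map_smul' {δ : ℤ} {α : G.V →ₗ[k] G'.V} (h : IsHom δ α)
    (s : MvPolynomial (Fin c) k) (v : G.V) : α (s • v) = s • α v := by
  induction s using MvPolynomial.induction_on generalizing v with
  | C a => rw [C_smul, C_smul, map_smul]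
  | add p q hp hq => rw [add_smul, add_smul, map_add, hp, hq]
  | mul_X p i hp => rw [mul_smul, mul_smul, hp, h.map_X]

/-- A homomorphism as a linear map over the polynomial ring. -/
def IsHom.toLinear {δ : ℤ} {α : G.V →ₗ[k] G'.V} (h : IsHom δ α) :
    G.V →ₗ[MvPolynomial (Fin c) k] G'.V where
  toFun := α
  map_add' := α.map_add
  map_smul' := h.map_smul'

lemma IsHom.toLinear_apply {δ : ℤ} {α : G.V →ₗ[k] G'.V} (h : IsHom δ α) (v : G.V) :
    h.toLinear v = α v := rfl

lemma IsHom.map_mem_low {δ : ℤ} {α : G.V →ₗ[k] G'.V} (h : IsHom δ α) {N : ℤ} {v : G.V}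
    (hv : v ∈ G.low N) : α v ∈ G'.low (N + δ) := by
  obtain ⟨s, hs, hv⟩ := exists_sum_P_of_mem_low hv
  rw [hv, map_sum]
  refine sum_mem fun n hn => ?_
  rw [h.map_P]
  exact P_mem_low _ (by have := hs n hn; omega) _

/-- The dual of a linear map, between dual graded structures. -/
def dualMap (α : G.V →ₗ[k] G'.V) : G'.dual.V →ₗ[k] G.dual.V := LinearMap.dualMap α

lemma dualMap_apply (α : G.V →ₗ[k] G'.V) (φ : G'.dual.V) (v : G.V) :
    (show Module.Dual k G.V from dualMap α φ) v = (show Module.Dual k G'.V from φ) (α v) := rfl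

lemma IsHom.dual {δ : ℤ} {α : G.V →ₗ[k] G'.V} (h : IsHom δ α) : IsHom δ (dualMap α) where
  map_X i φ := by
    refine LinearMap.ext (f := show Module.Dual k G.V from _) (g := show Module.Dual k G.V from _)
      fun v => ?_
    rw [dual_smul_apply, dualMap_apply, dualMap_apply, dual_smul_apply, h.map_X]
  map_P n φ := by
    refine LinearMap.ext (f := show Module.Dual k G.V from _) (g := show Module.Dual k G.V from _)
      fun v => ?_
    rw [dual_P_apply, dualMap_apply, dualMap_apply, dual_P_apply, h.map_P]
    congr 3
    ring

lemma exact_dualMap {α : G.V →ₗ[k] G'.V} {β : G'.V →ₗ[k] G''.V} (h : Function.Exact α β) :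
    Function.Exact (dualMap β) (dualMap α) := by
  rw [LinearMap.exact_iff] at h ⊢
  change LinearMap.ker (LinearMap.dualMap α) = LinearMap.range (LinearMap.dualMap β)
  rw [LinearMap.ker_dualMap_eq_dualAnnihilator_range,
    LinearMap.range_dualMap_eq_dualAnnihilator_ker, h]

/-- A long exact triangle with maps `z : G → G`, `i : G → G'`, `p : G' → G`, `z : G → G`. -/
structure Tri (G G' : GradedOp k c) (z : MvPolynomial (Fin c) k) (δ ε : ℤ) where
  i : G.V →ₗ[k] G'.V
  p : G'.V →ₗ[k] G.V
  hom_i : IsHom δ i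
  hom_p : IsHom ε p
  exact_z_i : Function.Exact (G.ρ z) i
  exact_i_p : Function.Exact i p
  exact_p_z : Function.Exact p (G.ρ z)

/-- The dual triangle. -/
def Tri.dual {z : MvPolynomial (Fin c) k} {δ ε : ℤ} (t : Tri G G' z δ ε) :
    Tri G.dual G'.dual z ε δ where
  i := dualMap t.p
  p := dualMap t.i
  hom_i := t.hom_p.dual
  hom_p := t.hom_i.dual
  exact_z_i := exact_dualMap t.exact_p_z
  exact_i_p := exact_dualMap t.exact_i_p
  exact_p_z := exact_dualMap t.exact_z_i

variable (G) in
/-- All truncations `G.low N` are finitely generated. -/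
def Noeth : Prop := ∀ N, (G.low N).FG

lemma noeth_of_exact {δ ε : ℤ} {α : G.V →ₗ[k] G'.V} {β : G'.V →ₗ[k] G''.V}
    (hα : IsHom δ α) (hβ : IsHom ε β) (hex : Function.Exact α β) (h : G.Noeth) (h'' : G''.Noeth) :
    G'.Noeth := by
  intro N
  refine Submodule.fg_of_fg_map_of_fg_inf_ker hβ.toLinear ?_ ?_
  · have := isNoetherian_of_fg_of_noetherian _ (h'' (N + ε))
    refine Submodule.FG.of_le (h'' (N + ε)) ?_
    rintro _ ⟨v, hv, rfl⟩
    exact hβ.map_mem_low hv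
  · have : G'.low N ⊓ LinearMap.ker hβ.toLinear = (G.low (N - δ)).map hα.toLinear := by
      ext w
      simp only [Submodule.mem_inf, LinearMap.mem_ker, Submodule.mem_map, IsHom.toLinear_apply]
      constructor
      · rintro ⟨hw, hw'⟩
        obtain ⟨v, hv⟩ := (hex w).1 hw'
        obtain ⟨s, hs, h⟩ := exists_sum_P_of_mem_low hw
        refine ⟨∑ n ∈ s, G.P (n - δ) v,
          sum_mem fun n hn => P_mem_low _ (by have := hs n hn; omega) _, ?_⟩
        rw [map_sum, h]
        refine Finset.sum_congr rfl fun n _ => ?_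
        rw [hα.map_P, hv, sub_add_cancel]
      · rintro ⟨v, hv, rfl⟩
        refine ⟨?_, hex.apply_apply_eq_zero v⟩
        simpa using hα.map_mem_low hv
    rw [this]
    exact (h _).map _

lemma Tri.noeth {z : MvPolynomial (Fin c) k} {δ ε : ℤ} (t : Tri G G' z δ ε) (h : G.Noeth) :
    G'.Noeth :=
  noeth_of_exact t.hom_i t.hom_p t.exact_i_p h h

/-- The span of homogeneous elements is stable under the projections. -/
lemma P_mem_span_of_homogeneous {s : Set G.V} (hs : ∀ v ∈ s, ∃ n, G.P n v = v)
    {v : G.V} (hv : v ∈ Submodule.span (MvPolynomial (Fin c) k) s) (n : ℤ) :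
    G.P n v ∈ Submodule.span (MvPolynomial (Fin c) k) s := by
  induction hv using Submodule.span_induction generalizing n with
  | mem v hv =>
    obtain ⟨m, hm⟩ := hs v hv
    by_cases h : n = m
    · rw [h, hm]; exact Submodule.subset_span hv
    · rw [P_of_ne hm h]; exact zero_mem _
  | zero => simp
  | add v w _ _ hv hw => rw [map_add]; exact add_mem (hv n) (hw n)
  | smul a v _ hv =>
    induction a using MvPolynomial.induction_on generalizing n v with
    | C a => rw [C_smul, map_smul, ← C_smul]; exact Submodule.smul_mem _ _ (hv n)
    | add p q hp hq =>
      rw [add_smul, map_add]; exact add_mem (hp v ‹_› hv n) (hq v ‹_› hv n)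
    | mul_X p i hp =>
      rw [mul_smul]
      refine hp _ (Submodule.smul_mem _ _ ‹_›) (fun m => ?_) n
      have := G.X_smul_P i (m + 2) v
      rw [add_sub_cancel_right] at this
      rw [← this]
      exact Submodule.smul_mem _ _ (hv _)

lemma noeth_of_ker {δ : ℤ} {α : G.V →ₗ[k] G'.V} (hα : IsHom δ α) (j : Fin c)
    (hker : ∀ v, α v = 0 → ∃ w, v = (X j : MvPolynomial (Fin c) k) • w) (h : G'.Noeth) :
    G.Noeth := by
  classical
  intro N
  have : IsNoetherian (MvPolynomial (Fin c) k) (G'.low (N + δ)) :=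
    isNoetherian_of_fg_of_noetherian _ (h (N + δ))
  have hfg : ((G.low N).map hα.toLinear).FG := by
    refine Submodule.FG.of_le (h (N + δ)) ?_
    rintro _ ⟨v, hv, rfl⟩
    exact hα.map_mem_low hv
  set H : Set G.V := {v | ∃ n ≤ N, G.P n v = v} with hH
  have hlow : G.low N = Submodule.span (MvPolynomial (Fin c) k) H := by
    refine le_antisymm (fun v hv => ?_) (Submodule.span_le.2 fun v ⟨n, hn, hv⟩ => mem_low_of_P hn hv)
    exact Submodule.span_le_restrictScalars k _ H hv
  rw [hlow, Submodule.map_span, Submodule.fg_span_iff_fg_span_finset_subset] at hfg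
  obtain ⟨t, htH, ht⟩ := hfg
  obtain ⟨t', ht'H, rfl⟩ := Finset.subset_set_image_iff.1 htH
  have hbasis : ∀ n, ∃ b : Finset G.V, Submodule.span k (b : Set G.V) = LinearMap.range (G.P n) :=
    fun n => (Submodule.fg_top _).1 (G.fin n).1
  choose b hb using hbasis
  have hbP : ∀ n, ∀ v ∈ b n, G.P n v = v := fun n v hv =>
    (G.mem_range_P).1 (hb n ▸ Submodule.subset_span hv)
  set W : Finset G.V := t' ∪ (b N ∪ b (N - 1)) with hW
  have hWH : (W : Set G.V) ⊆ H := by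
    intro v hv
    simp only [hW, Finset.coe_union, Set.mem_union, Finset.mem_coe] at hv
    rcases hv with hv | hv | hv
    · exact ht'H hv
    · exact ⟨N, le_rfl, hbP _ _ hv⟩
    · exact ⟨N - 1, by omega, hbP _ _ hv⟩
  have hbW : ∀ n, b n ⊆ W → ∀ v, G.P n v = v →
      v ∈ Submodule.span (MvPolynomial (Fin c) k) (W : Set G.V) := fun n hn v hv => by
    have : v ∈ Submodule.span k (b n : Set G.V) := by rw [hb]; exact ⟨v, hv⟩
    exact Submodule.span_mono (Finset.coe_subset.2 hn) (Submodule.span_le_restrictScalars k _ _ this)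
  have key : ∀ m : ℕ, ∀ v, G.P (N - m) v = v →
      v ∈ Submodule.span (MvPolynomial (Fin c) k) (W : Set G.V) := by
    intro m
    induction m using Nat.strong_induction_on with
    | _ m ih =>
      intro v hv
      rcases m with _ | _ | m
      · exact hbW N (by intro x; simp +contextual [hW]) v (by simpa using hv)
      · exact hbW (N - 1) (by intro x; simp +contextual [hW]) v (by simpa using hv)
      have h1 : α v ∈ Submodule.span (MvPolynomial (Fin c) k) (hα.toLinear '' H) := by
        rw [← Submodule.map_span, ← hlow]
        exact ⟨v, mem_low_of_P (by omega) hv, rfl⟩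
      rw [ht, Finset.coe_image, ← Submodule.map_span] at h1
      obtain ⟨u, hu, huv⟩ := h1
      rw [hα.toLinear_apply] at huv
      set n : ℤ := N - ((m + 1 + 1 : ℕ) : ℤ) with hn
      have hu' : G.P n u ∈ Submodule.span (MvPolynomial (Fin c) k) (W : Set G.V) :=
        P_mem_span_of_homogeneous (fun v hv => by obtain ⟨n, -, h⟩ := hWH hv; exact ⟨n, h⟩)
          (Submodule.span_mono (by simp [hW]) hu) n
      obtain ⟨w, hw⟩ := hker (v - G.P n u) (by
        rw [map_sub, hα.map_P, huv, ← hα.map_P, hv, sub_self])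
      have hw' : v - G.P n u = (X j : MvPolynomial (Fin c) k) • G.P (N - (m : ℕ)) w := by
        have : N - ((m : ℕ) : ℤ) - 2 = n := by rw [hn]; push_cast; ring
        rw [X_smul_P, ← hw, this, map_sub, P_self, hv]
      rw [← sub_add_cancel v (G.P n u), hw']
      exact add_mem (Submodule.smul_mem _ _ (ih m (by omega) _ (G.P_self _ _))) hu'
  refine ⟨W, le_antisymm ?_ ?_⟩
  · rw [hlow]; exact Submodule.span_mono hWH
  · rw [hlow]
    refine Submodule.span_le.2 fun v ⟨n, hn, hv⟩ => ?_
    obtain ⟨m, rfl⟩ : ∃ m : ℕ, n = N - m := ⟨(N - n).toNat, by omega⟩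
    exact key m v hv

lemma Tri.noeth_of_X {j : Fin c} {δ ε : ℤ} (t : Tri G G' (X j) δ ε) (h : G'.Noeth) : G.Noeth :=
  noeth_of_ker t.hom_i j (fun v hv => by
    obtain ⟨w, hw⟩ := (t.exact_z_i v).1 hv
    exact ⟨w, hw.symm⟩) h

variable (G) in
/-- Polynomials acting nilpotently in all sufficiently low degrees. -/
noncomputable def nilIdeal : Ideal (MvPolynomial (Fin c) k) :=
  ⨆ N : ℕ, (G.low (-N)).annihilator.radical

lemma mem_nilIdeal {s : MvPolynomial (Fin c) k} :
    s ∈ G.nilIdeal ↔ ∃ (N : ℤ) (m : ℕ), ∀ n ≤ N, ∀ v, G.P n v = v → s ^ m • v = 0 := by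
  rw [nilIdeal, Submodule.mem_iSup_of_directed]
  · constructor
    · rintro ⟨N, m, h⟩
      refine ⟨-N, m, fun n hn v hv => ?_⟩
      exact Submodule.mem_annihilator.1 h v (mem_low_of_P hn hv)
    · rintro ⟨N, m, h⟩
      refine ⟨N.natAbs, m, Submodule.mem_annihilator.2 fun v hv => ?_⟩
      obtain ⟨s, hs, hv⟩ := exists_sum_P_of_mem_low hv
      rw [hv, Finset.smul_sum]
      exact Finset.sum_eq_zero fun n hn => h n (by have := hs n hn; omega) _ (G.P_self _ _)
  · refine (Monotone.directed_le fun a b hab => Ideal.radical_mono (Submodule.annihilator_mono ?_))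
    exact G.low_mono (by omega)

lemma Tri.nilIdeal_le {z : MvPolynomial (Fin c) k} {δ ε : ℤ} (t : Tri G G' z δ ε) :
    G.nilIdeal ≤ G'.nilIdeal := by
  intro s hs
  obtain ⟨N, m, h⟩ := mem_nilIdeal.1 hs
  refine mem_nilIdeal.2 ⟨min (N - ε) (N + δ), m + m, fun n hn w hw => ?_⟩
  have h1 : t.p (s ^ m • w) = 0 := by
    rw [t.hom_p.map_smul']
    refine h (n + ε) (by omega) _ ?_
    rw [← t.hom_p.map_P, hw]
  obtain ⟨v, hv⟩ := (t.exact_i_p _).1 h1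
  obtain ⟨I, hI, hsum⟩ := exists_sum_P_of_mem_low
    ((G'.low n).smul_mem (s ^ m) (mem_low_of_P le_rfl hw))
  rw [pow_add, mul_smul, hsum, Finset.smul_sum]
  refine Finset.sum_eq_zero fun l hl => ?_
  rw [← hv, ← sub_add_cancel l δ, ← t.hom_i.map_P, ← t.hom_i.map_smul',
    h (l - δ) (by have := hI l hl; omega) _ (G.P_self _ _), map_zero]

lemma Tri.mem_nilIdeal {z : MvPolynomial (Fin c) k} {δ ε : ℤ} (t : Tri G G' z δ ε) :
    z ∈ G'.nilIdeal := by
  refine GradedOp.mem_nilIdeal.2 ⟨0, 2, fun n _ w _ => ?_⟩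
  have h1 : t.p (z • w) = 0 := by
    rw [t.hom_p.map_smul']
    exact t.exact_p_z.apply_apply_eq_zero w
  obtain ⟨v, hv⟩ := (t.exact_i_p _).1 h1
  rw [pow_two, mul_smul, ← hv, ← t.hom_i.map_smul']
  exact t.exact_z_i.apply_apply_eq_zero v

end GradedOp

end

section

open MvPolynomial

lemma exists_mem_prime_imp_mem_and_mem {R : Type*} [CommRing R] (Ps : Set (Ideal R))
    (hfin : Ps.Finite) (hprime : ∀ P ∈ Ps, P.IsPrime) (p q : R) :
    ∃ N : ℕ, 0 < N ∧ ∀ P ∈ Ps,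
      (p ^ N * p ^ N - p ^ N * q ^ N) + q ^ N * q ^ N ∈ P → p ∈ P ∧ q ∈ P := by
  classical
  have hM : ∀ P : Ideal R, ∃ M : ℕ, 0 < M ∧
      ((∃ m, 0 < m ∧ p ^ m - q ^ m ∈ P) → p ^ M - q ^ M ∈ P) := fun P => by
    by_cases h : ∃ m, 0 < m ∧ p ^ m - q ^ m ∈ P
    · obtain ⟨m, hm, hm'⟩ := h
      exact ⟨m, hm, fun _ => hm'⟩
    · exact ⟨1, one_pos, fun h' => absurd h' h⟩
  choose M hMpos hM using hM
  refine ⟨∏ P ∈ hfin.toFinset, M P, Finset.prod_pos fun P _ => hMpos P, fun P hP hz => ?_⟩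
  have := hprime P hP
  have hdvd : M P ∣ ∏ P ∈ hfin.toFinset, M P :=
    Finset.dvd_prod_of_mem M (hfin.mem_toFinset.2 hP)
  have hpos : 0 < ∏ P ∈ hfin.toFinset, M P := Finset.prod_pos fun P _ => hMpos P
  generalize (∏ P ∈ hfin.toFinset, M P) = N at *
  have h6 : p ^ (N * 6) - q ^ (N * 6) ∈ P := by
    rw [pow_mul, pow_mul]
    have : (p ^ N) ^ 6 - (q ^ N) ^ 6 = ((p ^ N * p ^ N - p ^ N * q ^ N) + q ^ N * q ^ N) *
      ((p ^ N + q ^ N) * ((p ^ N) ^ 3 - (q ^ N) ^ 3)) := by ring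
    rw [this]
    exact P.mul_mem_right _ hz
  have hN : p ^ N - q ^ N ∈ P := by
    obtain ⟨r, rfl⟩ := hdvd
    rw [pow_mul, pow_mul]
    exact P.mem_of_dvd (sub_dvd_pow_sub_pow _ _ r) (hM P ⟨_, by omega, h6⟩)
  have hq : q ^ N * q ^ N ∈ P := by
    have : q ^ N * q ^ N = ((p ^ N * p ^ N - p ^ N * q ^ N) + q ^ N * q ^ N) -
      (p ^ N - q ^ N) * p ^ N := by ring
    rw [this]
    exact P.sub_mem hz (P.mul_mem_right _ hN)
  have hq' : q ^ N ∈ P := (this.mem_or_mem hq).elim id id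
  have hp' : p ^ N ∈ P := by simpa using P.add_mem hN hq'
  exact ⟨this.mem_of_pow_mem _ hp', this.mem_of_pow_mem _ hq'⟩

lemma exists_pow_smul_eq_zero_of_associatedPrimes {R M : Type*} [CommRing R] [IsNoetherianRing R]
    [AddCommGroup M] [Module R M] [IsNoetherian R M] {z x : R}
    (h : ∀ P ∈ associatedPrimes R M, z ∈ P → x ∈ P) :
    ∃ m : ℕ, ∀ v : M, z • v = 0 → x ^ m • v = 0 := by
  set K : Submodule R M := LinearMap.ker (LinearMap.lsmul R M z) with hK
  have hrad : x ∈ (Module.annihilator R K).radical := by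
    rw [← Ideal.sInf_minimalPrimes, Submodule.mem_sInf]
    intro P hP
    have hP' := Module.associatedPrimes.minimalPrimes_annihilator_subset_associatedPrimes _ _ hP
    refine h P (associatedPrimes.subset_of_injective (f := K.subtype) K.subtype_injective hP') ?_
    refine hP'.annihilator_le (Submodule.mem_annihilator.2 ?_)
    rintro ⟨v, hv⟩ -
    exact Subtype.ext hv
  obtain ⟨m, hm⟩ := hrad
  exact ⟨m, fun v hv => congrArg Subtype.val (Module.mem_annihilator.1 hm ⟨v, hv⟩)⟩

namespace GradedOp

variable {k : Type} [Field k] {c : ℕ} {G G' G'' : GradedOp k c}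

lemma P_smul_monomial (α : Fin c →₀ ℕ) (a : k) (v : G.V) (n : ℤ) :
    G.P n (monomial α a • v) = monomial α a • G.P (n + 2 * α.sum fun _ m => (m : ℤ)) v := by
  classical
  induction α using Finsupp.induction₂ generalizing n with
  | zero => 
    have : (monomial (0 : Fin c →₀ ℕ) a) = C a := rfl
    simp [this, C_smul]
  | add_single i b α hi hb ih => 
    have : ∀ (b : ℕ) (w : G.V) (n : ℤ), G.P n ((X i : MvPolynomial (Fin c) k) ^ b • w) =
        (X i : MvPolynomial (Fin c) k) ^ b • G.P (n + 2 * b) w := by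
      intro b
      induction b with
      | zero => intro w n; simp
      | succ b ih =>
        intro w n
        rw [pow_succ, mul_smul, ih, mul_smul, X_smul_P]
        congr 3
        push_cast
        ring
    rw [monomial_add_single, mul_comm, mul_smul, this, ih, mul_smul,
      Finsupp.sum_add_index' (by simp) (by simp), Finsupp.sum_single_index (by simp)]
    congr 4
    ring

/-- If a finitely generated submodule of `G.low N` is annihilated by powers of all variables,
then it vanishes in sufficiently low degrees. -/
lemma exists_P_eq_zero_of_pow_smul {K : Submodule (MvPolynomial (Fin c) k) G.V} (hK : K.FG)
    {N : ℤ} (hKN : K ≤ G.low N) {m : ℕ}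
    (hm : ∀ j, ∀ v ∈ K, (X j : MvPolynomial (Fin c) k) ^ m • v = 0) :
    ∃ D : ℤ, ∀ v ∈ K, ∀ n < D, G.P n v = 0 := by
  classical
  have hsupp : ∀ v ∈ K, ∃ D : ℤ, ∀ n < D, G.P n v = 0 := by
    intro v hv
    obtain ⟨s, hs, h⟩ := exists_sum_P_of_mem_low (hKN hv)
    obtain ⟨D, hD⟩ := s.finite_toSet.bddBelow
    refine ⟨D, fun n hn => ?_⟩
    rw [h, map_sum]
    refine Finset.sum_eq_zero fun l hl => ?_
    rw [G.P_P, if_neg]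
    rintro rfl
    exact absurd (hD hl) (by omega)
  obtain ⟨g, rfl⟩ := hK
  have hD : ∃ D : ℤ, ∀ v ∈ g, ∀ n < D, G.P n v = 0 := by
    choose! D hD using hsupp
    obtain ⟨E, hE⟩ := (g.image D).finite_toSet.bddBelow
    refine ⟨E, fun v hv n hn => hD v (Submodule.subset_span hv) n (lt_of_lt_of_le hn ?_)⟩
    exact hE (by simpa using ⟨v, hv, rfl⟩)
  obtain ⟨D, hD⟩ := hD
  refine ⟨D - 2 * (c * m), fun v hv n hn => ?_⟩
  obtain ⟨r, -, rfl⟩ := Submodule.mem_span_finset.1 hv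
  rw [map_sum]
  refine Finset.sum_eq_zero fun w hw => ?_
  rw [← support_sum_monomial_coeff (r w), Finset.sum_smul, map_sum]
  refine Finset.sum_eq_zero fun α _ => ?_
  by_cases hα : ∃ j, m ≤ α j
  · obtain ⟨j, hj⟩ := hα
    have : monomial α (coeff α (r w)) = monomial (α - Finsupp.single j m) (coeff α (r w)) *
        (X j : MvPolynomial (Fin c) k) ^ m := by
      rw [← monomial_add_single, tsub_add_cancel_of_le (Finsupp.single_le_iff.2 hj)]
    rw [this, mul_smul, hm j w (Submodule.subset_span hw), smul_zero, map_zero]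
  · push Not at hα
    rw [P_smul_monomial, hD w hw, smul_zero]
    have : (α.sum fun _ m => (m : ℤ)) ≤ c * m := by
      rw [Finsupp.sum_fintype _ _ (by simp)]
      refine (Finset.sum_le_card_nsmul _ _ (m : ℤ) fun j _ => by exact_mod_cast (hα j).le).trans ?_
      simp
    omega

lemma exists_regular_of_associatedPrimes (hG : G.Noeth) {z : MvPolynomial (Fin c) k}
    (hz : ∀ P ∈ associatedPrimes (MvPolynomial (Fin c) k) (G.low 0), z ∈ P →
      ∀ j, (X j : MvPolynomial (Fin c) k) ∈ P) :
    ∃ N, ∀ n ≤ N, ∀ v, G.P n v = v → z • v = 0 → v = 0 := by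
  have hnoeth : IsNoetherian (MvPolynomial (Fin c) k) (G.low 0) :=
    isNoetherian_of_fg_of_noetherian _ (hG 0)
  have hpow := fun j => exists_pow_smul_eq_zero_of_associatedPrimes (M := G.low 0) (z := z)
    (x := (X j : MvPolynomial (Fin c) k)) fun P hP hzP => hz P hP hzP j
  choose m hm using hpow
  set K' : Submodule (MvPolynomial (Fin c) k) (G.low 0) :=
    LinearMap.ker (LinearMap.lsmul _ _ z) with hK'
  obtain ⟨D, hD⟩ := exists_P_eq_zero_of_pow_smul (K := K'.map (G.low 0).subtype) (N := 0)
    (m := ∑ j, m j) ((IsNoetherian.noetherian K').map _)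
    (by rintro _ ⟨v, -, rfl⟩; exact v.2)
    (by
      rintro j _ ⟨v, hv, rfl⟩
      have h2 : (X j : MvPolynomial (Fin c) k) ^ m j • (v : G.V) = 0 :=
        congrArg Subtype.val (hm j v hv)
      obtain ⟨r, hr⟩ := Nat.exists_eq_add_of_le (Finset.single_le_sum (f := m)
        (fun _ _ => Nat.zero_le _) (Finset.mem_univ j))
      rw [hr, add_comm, pow_add, mul_smul]
      simp only [Submodule.subtype_apply, h2, smul_zero])
  refine ⟨min 0 (D - 1), fun n hn v hv hzv => ?_⟩
  rw [← hv]
  refine hD v ⟨⟨v, mem_low_of_P (by omega) hv⟩, ?_, rfl⟩ n (by omega)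
  exact Subtype.ext hzv

/-- Two Noetherian graded structures share a common operator, from any sufficiently rich class `L`,
which is injective in low degrees. -/
lemma exists_regular (L : ℕ → MvPolynomial (Fin c) k → Prop) (hX : ∀ i, L 1 (X i))
    (h0 : ∀ e, L e 0) (hmul : ∀ e e' p q, L e p → L e' q → L (e + e') (p * q))
    (hadd : ∀ e p q, L e p → L e q → L e (p + q)) (hsub : ∀ e p q, L e p → L e q → L e (p - q))
    (hG : G.Noeth) (hG' : G'.Noeth) :
    ∃ e z, 0 < e ∧ L e z ∧ (∃ N, ∀ n ≤ N, ∀ v, G.P n v = v → z • v = 0 → v = 0) ∧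
      ∃ N, ∀ n ≤ N, ∀ v, G'.P n v = v → z • v = 0 → v = 0 := by
  classical
  have hnoeth : IsNoetherian (MvPolynomial (Fin c) k) (G.low 0) :=
    isNoetherian_of_fg_of_noetherian _ (hG 0)
  have hnoeth' : IsNoetherian (MvPolynomial (Fin c) k) (G'.low 0) :=
    isNoetherian_of_fg_of_noetherian _ (hG' 0)
  have hpow : ∀ e p, L e p → ∀ N, 0 < N → L (N * e) (p ^ N) := by
    intro e p h N hN
    induction N, hN using Nat.le_induction with
    | base => simpa using h
    | succ N _ ih => 
      rw [pow_succ, Nat.succ_mul]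
      exact hmul _ _ _ _ ih h
  set Ps := associatedPrimes (MvPolynomial (Fin c) k) (G.low 0) ∪
    associatedPrimes (MvPolynomial (Fin c) k) (G'.low 0) with hPs
  have hfin : Ps.Finite := (associatedPrimes.finite _ _).union (associatedPrimes.finite _ _)
  have hprime : ∀ P ∈ Ps, P.IsPrime := by
    rintro P (h | h)
    · exact h.isPrime
    · exact h.isPrime
  have key : ∀ s : Finset (Fin c), ∃ e z, 0 < e ∧ L e z ∧
      ∀ P ∈ Ps, z ∈ P → ∀ j ∈ s, (X j : MvPolynomial (Fin c) k) ∈ P := by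
    intro s
    induction s using Finset.induction_on with
    | empty => exact ⟨1, 0, one_pos, h0 1, by simp⟩
    | insert j s hj ih =>
      obtain ⟨e, z, he, hz, h⟩ := ih
      obtain ⟨N, hN, hNP⟩ := exists_mem_prime_imp_mem_and_mem Ps hfin hprime z (X j ^ e)
      have hp := hpow _ _ hz N hN
      have hq := hpow _ _ (hpow _ _ (hX j) e he) N hN
      rw [mul_one] at hq
      refine ⟨N * e + N * e, _, by positivity, hadd _ _ _ (hsub _ _ _ (hmul _ _ _ _ hp hp)
        (hmul _ _ _ _ hp hq)) (hmul _ _ _ _ hq hq), fun P hP hzP i hi => ?_⟩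
      obtain ⟨h1, h2⟩ := hNP P hP hzP
      rcases Finset.mem_insert.1 hi with rfl | hi
      · exact (hprime P hP).mem_of_pow_mem _ h2
      · exact h P hP h1 i hi
  obtain ⟨e, z, he, hz, h⟩ := key Finset.univ
  exact ⟨e, z, he, hz,
    exists_regular_of_associatedPrimes hG fun P hP hzP j => h P (Or.inl hP) hzP j (Finset.mem_univ j),
    exists_regular_of_associatedPrimes hG' fun P hP hzP j =>
      h P (Or.inr hP) hzP j (Finset.mem_univ j)⟩

end GradedOp

end

section

open MvPolynomial Filter

lemma finrank_map_add_finrank_ker_inf {K V W : Type*} [Field K] [AddCommGroup V] [Module K V]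
    [AddCommGroup W] [Module K W] (f : V →ₗ[K] W) (U : Submodule K V) [FiniteDimensional K U] :
    Module.finrank K (U.map f) + Module.finrank K (LinearMap.ker f ⊓ U : Submodule K V) =
      Module.finrank K U := by
  have h := LinearMap.finrank_range_add_finrank_ker (f.domRestrict U)
  rw [LinearMap.range_domRestrict] at h
  rw [← h]
  congr 1
  refine LinearEquiv.finrank_eq (LinearEquiv.ofBijective
    (LinearMap.codRestrict (LinearMap.ker (f.domRestrict U))
      (LinearMap.codRestrict U (LinearMap.ker f ⊓ U).subtype fun v => v.2.2) fun v => v.2.1) ⟨?_, ?_⟩)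
  · intro v w h
    exact Subtype.ext (congrArg (fun x => (x.1.1 : V)) h)
  · rintro ⟨⟨v, hv⟩, hv'⟩
    exact ⟨⟨v, hv', hv⟩, rfl⟩

namespace GradedOp

variable {k : Type} [Field k] {c : ℕ} {G G' G'' : GradedOp k c}

variable (G) in
/-- The dimension of the piece of degree `n`. -/
noncomputable def dim (n : ℤ) : ℕ := Module.finrank k (LinearMap.range (G.P n))

lemma dim_eq_zero_iff {n : ℤ} : G.dim n = 0 ↔ ∀ v, G.P n v = 0 := by
  rw [dim, Submodule.finrank_eq_zero, LinearMap.range_eq_bot]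
  exact LinearMap.ext_iff

variable (G) in
/-- The rank of the operator `z` on the piece of degree `n`. -/
noncomputable def rk (z : MvPolynomial (Fin c) k) (n : ℤ) : ℕ :=
  Module.finrank k ((LinearMap.range (G.P n)).map (G.ρ z))

variable (G) in
/-- The polynomial `z` acts with degree `-2 * e`. -/
def HomogSMul (e : ℕ) (z : MvPolynomial (Fin c) k) : Prop :=
  ∀ n v, z • G.P n v = G.P (n - 2 * e) (z • v)

lemma rk_le (z : MvPolynomial (Fin c) k) (n : ℤ) : G.rk z n ≤ G.dim n :=
  Submodule.finrank_map_le _ _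

lemma rk_le_sub {e : ℕ} {z : MvPolynomial (Fin c) k} (hz : G.HomogSMul e z) (n : ℤ) :
    G.rk z n ≤ G.dim (n - 2 * e) := by
  refine Submodule.finrank_mono ?_
  rintro _ ⟨v, hv, rfl⟩
  obtain ⟨v, rfl⟩ := hv
  exact ⟨z • v, (hz n v).symm⟩

lemma rk_eq_dim {z : MvPolynomial (Fin c) k} {n : ℤ}
    (h : ∀ v, G.P n v = v → z • v = 0 → v = 0) : G.rk z n = G.dim n := by
  have := finrank_map_add_finrank_ker_inf (G.ρ z) (LinearMap.range (G.P n))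
  have h0 : (LinearMap.ker (G.ρ z) ⊓ LinearMap.range (G.P n) : Submodule k G.V) = ⊥ := by
    rw [eq_bot_iff]
    rintro v ⟨h1, h2⟩
    exact h v (G.mem_range_P.1 h2) h1
  rw [h0, finrank_bot, add_zero] at this
  exact this

lemma rk_eq_dim_sub {e : ℕ} {z : MvPolynomial (Fin c) k} (hz : G.HomogSMul e z) {n : ℤ}
    (h : ∀ φ, G.dual.P (2 * e - n) φ = φ → z • φ = 0 → φ = 0) : G.rk z n = G.dim (n - 2 * e) := by
  have hle : (LinearMap.range (G.P n)).map (G.ρ z) ≤ LinearMap.range (G.P (n - 2 * e)) := by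
    rintro _ ⟨v, hv, rfl⟩
    obtain ⟨v, rfl⟩ := hv
    exact ⟨z • v, (hz n v).symm⟩
  suffices LinearMap.range (G.P (n - 2 * e)) ≤ (LinearMap.range (G.P n)).map (G.ρ z) by
    rw [rk, dim, le_antisymm hle this]
  intro v hv
  by_contra hv'
  obtain ⟨φ, hφv, hφ⟩ := Submodule.exists_dual_map_eq_bot_of_notMem hv' inferInstance
  set ψ : Module.Dual k G.V := φ ∘ₗ G.P (n - 2 * e) with hψ
  have hψ0 : (show G.dual.V from ψ) = 0 := by
    refine h _ ?_ ?_
    · refine LinearMap.ext (f := show Module.Dual k G.V from _)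
        (g := show Module.Dual k G.V from _) fun w => ?_
      rw [dual_P_apply]
      simp only [hψ, LinearMap.comp_apply, neg_sub, P_self]
    · refine LinearMap.ext (f := show Module.Dual k G.V from _)
        (g := show Module.Dual k G.V from _) fun w => ?_
      rw [dual_smul_apply]
      change φ (G.P (n - 2 * e) (z • w)) = 0
      rw [← hz]
      have : φ (z • G.P n w) ∈ Submodule.map φ ((LinearMap.range (G.P n)).map (G.ρ z)) :=
        ⟨_, ⟨_, ⟨w, rfl⟩, rfl⟩, rfl⟩
      rw [hφ] at this
      exact this
  apply hφv
  have : ψ v = 0 := by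
    have : ψ = 0 := hψ0
    rw [this]; rfl
  rwa [hψ, LinearMap.comp_apply, G.mem_range_P.1 hv] at this

lemma Tri.dim_add_rk {e : ℕ} {z : MvPolynomial (Fin c) k} {δ ε : ℤ} (t : Tri G G' z δ ε)
    (hz : G.HomogSMul e z) (n : ℤ) :
    G'.dim n + G.rk z (n - δ + 2 * e) + G.rk z (n + ε) = G.dim (n - δ) + G.dim (n + ε) := by
  have h1 := finrank_map_add_finrank_ker_inf t.p (LinearMap.range (G'.P n))
  have h2 := finrank_map_add_finrank_ker_inf t.i (LinearMap.range (G.P (n - δ)))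
  have h3 := finrank_map_add_finrank_ker_inf (G.ρ z) (LinearMap.range (G.P (n + ε)))
  have e1 : (LinearMap.range (G'.P n)).map t.p =
      LinearMap.ker (G.ρ z) ⊓ LinearMap.range (G.P (n + ε)) := by
    ext v
    constructor
    · rintro ⟨_, ⟨w, rfl⟩, rfl⟩
      exact ⟨t.exact_p_z.apply_apply_eq_zero _, t.p w, (t.hom_p.map_P n w).symm⟩
    · rintro ⟨h, hv⟩
      obtain ⟨w, rfl⟩ := (t.exact_p_z v).1 h
      exact ⟨_, ⟨w, rfl⟩, by rw [t.hom_p.map_P, G.mem_range_P.1 hv]⟩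
  have e2 : (LinearMap.range (G.P (n - δ))).map t.i =
      LinearMap.ker t.p ⊓ LinearMap.range (G'.P n) := by
    ext v
    constructor
    · rintro ⟨_, ⟨w, rfl⟩, rfl⟩
      refine ⟨t.exact_i_p.apply_apply_eq_zero _, t.i w, ?_⟩
      rw [t.hom_i.map_P, sub_add_cancel]
    · rintro ⟨h, hv⟩
      obtain ⟨w, rfl⟩ := (t.exact_i_p v).1 h
      exact ⟨_, ⟨w, rfl⟩, by rw [t.hom_i.map_P, sub_add_cancel, G'.mem_range_P.1 hv]⟩
  have e3 : (LinearMap.range (G.P (n - δ + 2 * e))).map (G.ρ z) =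
      LinearMap.ker t.i ⊓ LinearMap.range (G.P (n - δ)) := by
    ext v
    constructor
    · rintro ⟨_, ⟨w, rfl⟩, rfl⟩
      refine ⟨t.exact_z_i.apply_apply_eq_zero _, z • w, ?_⟩
      have := hz (n - δ + 2 * e) w
      rw [add_sub_cancel_right] at this
      exact this.symm
    · rintro ⟨h, hv⟩
      obtain ⟨w, rfl⟩ := (t.exact_z_i v).1 h
      refine ⟨_, ⟨w, rfl⟩, ?_⟩
      have := hz (n - δ + 2 * e) w
      rw [add_sub_cancel_right] at this
      exact this.trans (G.mem_range_P.1 hv)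
  rw [e1, ← e2] at h1
  rw [← e3] at h2
  simp only [dim, rk]
  omega

/-- A triangle over an operator which is injective in low degrees and surjective in high degrees
propagates symmetric growth. -/
lemma Tri.symmetricGrowth {e : ℕ} {z : MvPolynomial (Fin c) k} (t : Tri G G' z (2 * e - 1) 0)
    (he : 0 < e) (hz : G.HomogSMul e z)
    (h : ∃ N, ∀ n ≤ N, ∀ v, G.P n v = v → z • v = 0 → v = 0)
    (h' : ∃ N, ∀ n ≤ N, ∀ v, G.dual.P n v = v → z • v = 0 → v = 0)
    (hG' : (∀ n, G'.dim n = 0) ∨ ∃ m, SymmetricGrowth m G'.dim) :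
    (∀ n, G.dim n = 0) ∨ ∃ m, SymmetricGrowth m G.dim := by
  obtain ⟨N, hN⟩ := h
  obtain ⟨N', hN'⟩ := h'
  have key := fun n => t.dim_add_rk hz n
  have hn1 : ∀ n : ℤ, n - (2 * e - 1) + 2 * e = n + 1 := fun n => by ring
  have hn2 : ∀ n : ℤ, n - (2 * e - 1) = n + 1 - 2 * e := fun n => by ring
  simp only [hn1, add_zero] at key
  simp only [hn2] at key
  have hpos : ∀ n ≥ 2 * e - N', G.rk z n = G.dim (n - 2 * e) := fun n hn =>
    rk_eq_dim_sub hz (hN' _ (by omega))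
  have hneg : ∀ n ≤ N, G.rk z n = G.dim n := fun n hn => rk_eq_dim (hN _ hn)
  rcases hG' with h0 | ⟨m, hm⟩
  · by_cases hall : ∀ n, G.dim n = 0
    · exact Or.inl hall
    · push Not at hall
      refine Or.inr ⟨0, SymmetricGrowth.of_periodic (q := 2 * e) (by omega) (fun n => ?_) hall⟩
      have hr : ∀ n, G.rk z n = G.dim n ∧ G.rk z (n + 1) = G.dim (n + 1 - 2 * e) := fun n => by
        have h1 := key n
        have h2 := G.rk_le z n
        have h3 := rk_le_sub hz (n + 1)
        rw [h0 n] at h1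
        omega
      have h1 := (hr (n + 2 * e)).1
      have h2 := (hr (n + 2 * e - 1)).2
      rw [sub_add_cancel, add_sub_cancel_right, h1] at h2
      push_cast
      exact h2
  · refine Or.inr ⟨m + 1, hm.step (q := 2 * e) (by omega) ?_ ?_⟩
    · filter_upwards [eventually_ge_atTop (2 * e - N')] with n hn
      have h1 := key n
      rw [hpos n hn, hpos (n + 1) (by omega)] at h1
      push_cast
      omega
    · filter_upwards [eventually_le_atBot (N - 1)] with n hn
      have h1 := key n
      rw [hneg n (by omega), hneg (n + 1) (by omega)] at h1
      push_cast
      omega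

lemma eventually_P_eq_zero_of_mem_nilIdeal {z : MvPolynomial (Fin c) k}
    (h : ∃ N, ∀ n ≤ N, ∀ v, G.P n v = v → z • v = 0 → v = 0) {e : ℕ} (hz : G.HomogSMul e z)
    (hmem : z ∈ G.nilIdeal) :
    ∃ N, ∀ n ≤ N, ∀ v, G.P n v = 0 := by
  obtain ⟨N, hN⟩ := h
  obtain ⟨N', m, hm⟩ := mem_nilIdeal.1 hmem
  refine ⟨min N N', fun n hn v => ?_⟩
  have key : ∀ m : ℕ, ∀ n ≤ N, ∀ v, G.P n v = v → z ^ m • v = 0 → v = 0 := by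
    intro m
    induction m with
    | zero => intro n _ v _ h; simpa using h
    | succ m ih =>
      intro n hn v hv h
      refine hN n hn v hv (ih (n - 2 * e) (by omega) _ ?_ ?_)
      · rw [← hz, hv]
      · rw [← mul_smul, ← pow_succ, h]
  exact key m n (by omega) _ (G.P_self n v) (hm n (by omega) _ (G.P_self n v))

lemma HomogSMul.dual {e : ℕ} {z : MvPolynomial (Fin c) k} (hz : G.HomogSMul e z) :
    G.dual.HomogSMul e z := by
  intro n φ
  refine LinearMap.ext (f := show Module.Dual k G.V from _) (g := show Module.Dual k G.V from _)
    fun v => ?_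
  rw [dual_smul_apply, dual_P_apply, dual_P_apply, dual_smul_apply, hz]
  congr 3
  ring

lemma P_eq_zero_of_dual {n : ℤ} (h : ∀ φ, G.dual.P n φ = 0) (v : G.V) : G.P (-n) v = 0 := by
  rw [← Module.forall_dual_apply_eq_zero_iff k]
  intro φ
  have := h φ
  exact LinearMap.congr_fun (f := show Module.Dual k G.V from G.dual.P n φ)
    (g := (0 : Module.Dual k G.V)) this v

end GradedOp

end

section

open IsLocalRing

/-- A free module with a `ℤ`-graded basis having finitely many elements in each degree. -/
structure GrFree (A : Type) [CommRing A] where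
  ι : Type
  F : Type
  [acg : AddCommGroup F]
  [mod : Module A F]
  b : Module.Basis ι A F
  deg : ι → ℤ
  finDeg : ∀ n, {a | deg a = n}.Finite

namespace GrFree

attribute [instance] GrFree.acg GrFree.mod

variable {A : Type} [CommRing A] (X Y W : GrFree A)

/-- The projection onto the component of degree `n`. -/
noncomputable def π (n : ℤ) : X.F →ₗ[A] X.F :=
  X.b.constr A fun a => if X.deg a = n then X.b a else 0

lemma π_b (n : ℤ) (a : X.ι) : X.π n (X.b a) = if X.deg a = n then X.b a else 0 := by
  rw [π, X.b.constr_basis]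

lemma repr_π (n : ℤ) (v : X.F) (a : X.ι) :
    X.b.repr (X.π n v) a = if X.deg a = n then X.b.repr v a else 0 := by
  have : (Finsupp.lapply a ∘ₗ X.b.repr.toLinearMap ∘ₗ X.π n : X.F →ₗ[A] A) =
      if X.deg a = n then Finsupp.lapply a ∘ₗ X.b.repr.toLinearMap else 0 := by
    refine X.b.ext fun a' => ?_
    simp only [LinearMap.comp_apply, LinearEquiv.coe_coe, π_b, Finsupp.lapply_apply]
    by_cases h : a' = a
    · subst h
      split_ifs <;> simp
    · split_ifs <;> simp [Finsupp.single_eq_of_ne (Ne.symm h)]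
  have h := LinearMap.congr_fun this v
  simp only [LinearMap.comp_apply, LinearEquiv.coe_coe, Finsupp.lapply_apply] at h
  rw [h]
  split_ifs <;> simp

variable {X} in
lemma ext_repr {v w : X.F} (h : ∀ a, X.b.repr v a = X.b.repr w a) : v = w :=
  X.b.repr.injective (Finsupp.ext h)

lemma π_π (m n : ℤ) (v : X.F) : X.π m (X.π n v) = if m = n then X.π n v else 0 := by
  refine ext_repr fun a => ?_
  split_ifs with h
  · subst h
    simp +contextual [repr_π]
  · simp only [repr_π]
    split_ifs <;> simp
    omega

lemma π_self (n : ℤ) (v : X.F) : X.π n (X.π n v) = X.π n v := by simp [π_π]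

lemma exists_sum_π (v : X.F) : ∃ s : Finset ℤ, v = ∑ n ∈ s, X.π n v := by
  classical
  refine ⟨(X.b.repr v).support.image X.deg, ext_repr fun a => ?_⟩
  simp only [map_sum, Finsupp.finsetSum_apply, repr_π, Finset.sum_ite_eq]
  split_ifs with h
  · rfl
  · by_contra h0
    exact h (Finset.mem_image.2 ⟨a, Finsupp.mem_support_iff.2 h0, rfl⟩)

instance finite_range_π (n : ℤ) : Module.Finite A (LinearMap.range (X.π n)) := by
  have : LinearMap.range (X.π n) = Submodule.span A (X.b '' {a | X.deg a = n}) := by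
    refine le_antisymm ?_ (Submodule.span_le.2 ?_)
    · rintro _ ⟨v, rfl⟩
      rw [← X.b.linearCombination_repr v, Finsupp.linearCombination_apply, Finsupp.sum, map_sum]
      refine sum_mem fun a _ => ?_
      rw [map_smul, π_b]
      refine Submodule.smul_mem _ _ ?_
      split_ifs with h
      · exact Submodule.subset_span ⟨a, h, rfl⟩
      · exact zero_mem _
    · rintro _ ⟨a, ha, rfl⟩
      exact ⟨X.b a, by rw [π_b]; exact if_pos ha⟩
  rw [this]
  exact Module.Finite.iff_fg.2 (Submodule.fg_span ((X.finDeg n).image _))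

/-- The submodule of elements all of whose coordinates lie in `Q`. -/
def sub (Q : Ideal A) : Submodule A X.F where
  carrier := {v | ∀ a, X.b.repr v a ∈ Q}
  add_mem' hv hw a := by simpa using Q.add_mem (hv a) (hw a)
  zero_mem' a := by simp
  smul_mem' r v hv a := by simpa using Q.mul_mem_left r (hv a)

variable {X Y W}

lemma mem_sub {Q : Ideal A} {v : X.F} : v ∈ X.sub Q ↔ ∀ a, X.b.repr v a ∈ Q := Iff.rfl

lemma sub_mono {Q R : Ideal A} (h : Q ≤ R) : X.sub Q ≤ X.sub R := fun _ hv a => h (hv a)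

lemma sub_bot : X.sub ⊥ = ⊥ := by
  rw [eq_bot_iff]
  intro v hv
  exact ext_repr fun a => by simpa using hv a

lemma smul_mem_sub {Q : Ideal A} {q : A} (hq : q ∈ Q) (v : X.F) : q • v ∈ X.sub Q := fun a => by
  simpa using Q.mul_mem_right _ hq

lemma sub_eq_smul_top (Q : Ideal A) : X.sub Q = Q • (⊤ : Submodule A X.F) := by
  refine le_antisymm (fun v hv => ?_) (Submodule.smul_le.2 fun q hq v _ => smul_mem_sub hq v)
  rw [← X.b.linearCombination_repr v, Finsupp.linearCombination_apply]
  exact sum_mem fun a _ => Submodule.smul_mem_smul (hv a) trivial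

lemma map_mem_sub {Q : Ideal A} (φ : X.F →ₗ[A] Y.F) {v : X.F} (hv : v ∈ X.sub Q) :
    φ v ∈ Y.sub Q := by
  rw [sub_eq_smul_top] at hv ⊢
  have := Submodule.mem_map_of_mem (f := φ) hv
  rw [Submodule.map_smul''] at this
  exact Submodule.smul_mono le_rfl le_top this

lemma mem_sub_of_smul_mem {Q : Ideal A} {x : A} (hx : ∀ a, x * a ∈ Q → a ∈ Q) {v : X.F}
    (hv : x • v ∈ X.sub Q) : v ∈ X.sub Q := fun a => hx _ (by simpa using hv a)

lemma exists_of_mem_sub_sup {Q : Ideal A} {x : A} {v : X.F} (hv : v ∈ X.sub (Q ⊔ Ideal.span {x})) :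
    ∃ y, v - x • y ∈ X.sub Q := by
  rw [sub_eq_smul_top, Submodule.sup_smul, Submodule.ideal_span_singleton_smul] at hv
  obtain ⟨w, hw, z, hz, rfl⟩ := Submodule.mem_sup.1 hv
  obtain ⟨y, -, rfl⟩ := Submodule.mem_smul_pointwise_iff_exists _ _ _ |>.1 hz
  exact ⟨y, by rwa [add_sub_cancel_right, sub_eq_smul_top]⟩

lemma exists_of_mem_sub_span {n : ℕ} {g : Fin n → A} {v : X.F}
    (hv : v ∈ X.sub (Ideal.span (Set.range g))) : ∃ w : Fin n → X.F, v = ∑ i, g i • w i := by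
  rw [sub_eq_smul_top] at hv
  induction hv using Submodule.smul_induction_on' with
  | smul r hr v hv =>
    obtain ⟨a, rfl⟩ := (Ideal.mem_span_range_iff_exists_fun).1 hr
    exact ⟨fun i => a i • v, by simp only [Finset.sum_smul, mul_comm (a _), mul_smul]⟩
  | add v hv w hw h h' =>
    obtain ⟨a, rfl⟩ := h
    obtain ⟨b, rfl⟩ := h'
    exact ⟨a + b, by simp [Finset.sum_add_distrib]⟩

/-- A linear map shifting degrees by `δ`. -/
def Homog (δ : ℤ) (φ : X.F →ₗ[A] Y.F) : Prop := ∀ n v, φ (X.π n v) = Y.π (n + δ) (φ v)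

lemma Homog.of_eq {δ δ' : ℤ} {φ : X.F →ₗ[A] Y.F} (h : Homog δ φ) (e : δ = δ') : Homog δ' φ := e ▸ h

lemma Homog.comp {δ ε : ℤ} {φ : X.F →ₗ[A] Y.F} {ψ : Y.F →ₗ[A] W.F} (hψ : Homog ε ψ)
    (hφ : Homog δ φ) : Homog (δ + ε) (ψ ∘ₗ φ) := fun n v => by
  rw [LinearMap.comp_apply, hφ, hψ, LinearMap.comp_apply, add_assoc]

lemma Homog.add {δ : ℤ} {φ ψ : X.F →ₗ[A] Y.F} (hφ : Homog δ φ) (hψ : Homog δ ψ) :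
    Homog δ (φ + ψ) := fun n v => by simp [hφ n v, hψ n v]

lemma Homog.sub {δ : ℤ} {φ ψ : X.F →ₗ[A] Y.F} (hφ : Homog δ φ) (hψ : Homog δ ψ) :
    Homog δ (φ - ψ) := fun n v => by simp [hφ n v, hψ n v]

lemma Homog.zero {δ : ℤ} : Homog δ (0 : X.F →ₗ[A] Y.F) := fun n v => by simp

lemma homog_of_basis {δ : ℤ} {φ : X.F →ₗ[A] Y.F}
    (h : ∀ a, Y.π (X.deg a + δ) (φ (X.b a)) = φ (X.b a)) : Homog δ φ := by
  intro n
  have : φ ∘ₗ X.π n = Y.π (n + δ) ∘ₗ φ := by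
    refine X.b.ext fun a => ?_
    rw [LinearMap.comp_apply, π_b, LinearMap.comp_apply, ← h a, π_π]
    split_ifs with h1 h2 h2
    · rw [h]
    · omega
    · omega
    · simp
  exact fun v => LinearMap.congr_fun this v

/-- A homogeneous map with coordinates in the ideal generated by `g` is a combination of
homogeneous maps. -/
lemma Homog.exists_sum {δ : ℤ} {φ : X.F →ₗ[A] Y.F} (hφ : Homog δ φ) {n : ℕ} {g : Fin n → A}
    (h : ∀ v, φ v ∈ Y.sub (Ideal.span (Set.range g))) :
    ∃ η : Fin n → (X.F →ₗ[A] Y.F), (∀ i, Homog δ (η i)) ∧ ∀ v, φ v = ∑ i, g i • η i v := by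
  choose w hw using fun a => exists_of_mem_sub_span (h (X.b a))
  refine ⟨fun i => X.b.constr A fun a => Y.π (X.deg a + δ) (w a i), fun i => ?_, fun v => ?_⟩
  · refine homog_of_basis fun a => ?_
    rw [X.b.constr_basis, π_self]
  · have : φ = ∑ i, g i • X.b.constr A fun a => Y.π (X.deg a + δ) (w a i) := by
      refine X.b.ext fun a => ?_
      simp only [LinearMap.sum_apply, LinearMap.smul_apply, X.b.constr_basis]
      have := hφ (X.deg a) (X.b a)
      rw [π_b, if_pos rfl, hw a, map_sum] at this
      rw [hw a, this]
      simp
    conv_lhs => rw [this]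
    simp

/-- The direct sum of a graded free module with a shifted copy of itself. -/
noncomputable def double (X : GrFree A) (s : ℤ) : GrFree A where
  ι := X.ι ⊕ X.ι
  F := X.F × X.F
  b := X.b.prod X.b
  deg := Sum.elim X.deg fun a => X.deg a + s
  finDeg n := by
    refine (((X.finDeg n).image Sum.inl).union ((X.finDeg (n - s)).image Sum.inr)).subset ?_
    rintro (a | a) ha
    · exact Or.inl ⟨a, ha, rfl⟩
    · exact Or.inr ⟨a, by simpa [eq_sub_iff_add_eq] using ha, rfl⟩

/-- The element of the double with the given components. -/
def dmk (s : ℤ) (u v : X.F) : (X.double s).F := (u, v)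

lemma exists_dmk {s : ℤ} (w : (X.double s).F) : ∃ u v, w = dmk s u v := ⟨w.1, w.2, rfl⟩

lemma dmk_sub (s : ℤ) (u v u' v' : X.F) : dmk s u v - dmk s u' v' = dmk s (u - u') (v - v') := rfl

lemma dmk_smul (s : ℤ) (a : A) (u v : X.F) : a • dmk s u v = dmk s (a • u) (a • v) := rfl

lemma dmk_zero (s : ℤ) : dmk s (0 : X.F) 0 = 0 := rfl

lemma dmk_sum (s : ℤ) {n : ℕ} (u v : Fin n → X.F) :
    ∑ i, dmk s (u i) (v i) = dmk s (∑ i, u i) (∑ i, v i) :=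
  Prod.ext (Prod.fst_sum ..) (Prod.snd_sum ..)

lemma dmk_inj {s : ℤ} {u v u' v' : X.F} : dmk s u v = dmk s u' v' ↔ u = u' ∧ v = v' :=
  Prod.mk_inj

/-- Linear maps between doubles, given by matrices. -/
noncomputable def matrixMap (s : ℤ) (φ₁₁ φ₁₂ φ₂₁ φ₂₂ : X.F →ₗ[A] X.F) : (X.double s).F →ₗ[A] (X.double s).F :=
  LinearMap.prod (φ₁₁.coprod φ₁₂) (φ₂₁.coprod φ₂₂)

lemma matrixMap_dmk {s : ℤ} (φ₁₁ φ₁₂ φ₂₁ φ₂₂ : X.F →ₗ[A] X.F) (u v : X.F) :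
    matrixMap s φ₁₁ φ₁₂ φ₂₁ φ₂₂ (dmk s u v) = dmk s (φ₁₁ u + φ₁₂ v) (φ₂₁ u + φ₂₂ v) := rfl

/-- Inclusion of the second summand. -/
def dinr (X : GrFree A) (s : ℤ) : X.F →ₗ[A] (X.double s).F := LinearMap.inr A X.F X.F

lemma dinr_apply (s : ℤ) (v : X.F) : X.dinr s v = dmk s 0 v := rfl

/-- Projection to the first summand. -/
def dfst (X : GrFree A) (s : ℤ) : (X.double s).F →ₗ[A] X.F := LinearMap.fst A X.F X.F

lemma dfst_dmk (s : ℤ) (u v : X.F) : X.dfst s (dmk s u v) = u := rfl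

lemma dmk_mem_sub {s : ℤ} {Q : Ideal A} {u v : X.F} :
    dmk s u v ∈ (X.double s).sub Q ↔ u ∈ X.sub Q ∧ v ∈ X.sub Q := by
  constructor
  · intro h
    exact ⟨fun a => h (Sum.inl a), fun a => h (Sum.inr a)⟩
  · rintro ⟨h, h'⟩ (a | a)
    · exact h a
    · exact h' a

lemma π_dmk {s : ℤ} (n : ℤ) (u v : X.F) :
    (X.double s).π n (dmk s u v) = dmk s (X.π n u) (X.π (n - s) v) := by
  refine ext_repr ?_
  rintro (a | a)
  · exact ((X.double s).repr_π n (dmk s u v) (Sum.inl a)).trans (X.repr_π n u a).symm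
  · refine ((X.double s).repr_π n (dmk s u v) (Sum.inr a)).trans ?_
    refine Eq.trans ?_ (X.repr_π (n - s) v a).symm
    have : X.deg a + s = n ↔ X.deg a = n - s := by omega
    exact if_congr this rfl rfl

lemma homog_matrixMap {s δ : ℤ} {φ₁₁ φ₁₂ φ₂₁ φ₂₂ : X.F →ₗ[A] X.F} (h₁₁ : Homog δ φ₁₁)
    (h₁₂ : Homog (δ + s) φ₁₂) (h₂₁ : Homog (δ - s) φ₂₁) (h₂₂ : Homog δ φ₂₂) :
    Homog δ (matrixMap s φ₁₁ φ₁₂ φ₂₁ φ₂₂) := by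
  intro n w
  obtain ⟨u, v, rfl⟩ := exists_dmk w
  rw [π_dmk, matrixMap_dmk, matrixMap_dmk, π_dmk, h₁₁, h₁₂, h₂₁, h₂₂, map_add, map_add]
  congr 4 <;> ring

end GrFree

end

section

open IsLocalRing

/-- A regular sequence in the maximal ideal of a local ring, with regularity spelled out in terms
of the ideals generated by initial segments. -/
structure RegSeq (A : Type) [CommRing A] [IsLocalRing A] (c : ℕ) where
  f : Fin c → A
  mem : ∀ i, f i ∈ maximalIdeal A
  reg : ∀ (i : Fin c) (a : A),
    f i * a ∈ Ideal.span (Set.range fun l : Fin c => if l < i then f l else 0) →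
      a ∈ Ideal.span (Set.range fun l : Fin c => if l < i then f l else 0)

namespace RegSeq

variable {A : Type} [CommRing A] [IsLocalRing A] {c : ℕ} (S : RegSeq A c)

/-- The ideal generated by the first `j` elements. -/
def I (j : ℕ) : Ideal A :=
  Ideal.span (Set.range fun l : Fin c => if (l : ℕ) < j then S.f l else 0)

lemma I_mono {j j' : ℕ} (h : j ≤ j') : S.I j ≤ S.I j' := by
  refine Ideal.span_le.2 ?_
  rintro _ ⟨l, rfl⟩
  dsimp only
  split_ifs with hl
  · exact Ideal.subset_span ⟨l, if_pos (by omega)⟩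
  · exact zero_mem _

lemma f_mem {i : Fin c} {j : ℕ} (h : (i : ℕ) < j) : S.f i ∈ S.I j :=
  Ideal.subset_span ⟨i, if_pos h⟩

lemma I_le (j : ℕ) : S.I j ≤ maximalIdeal A := by
  refine Ideal.span_le.2 ?_
  rintro _ ⟨l, rfl⟩
  dsimp only
  split_ifs with hl
  · exact S.mem l
  · exact zero_mem _

lemma I_zero : S.I 0 = ⊥ := by
  refine le_bot_iff.1 (Ideal.span_le.2 ?_)
  rintro _ ⟨l, rfl⟩
  simp

lemma I_succ (i : Fin c) : S.I (i + 1) = S.I i ⊔ Ideal.span {S.f i} := by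
  refine le_antisymm (Ideal.span_le.2 ?_) (sup_le (S.I_mono (by omega)) (Ideal.span_le.2 ?_))
  · rintro _ ⟨l, rfl⟩
    dsimp only
    split_ifs with hl
    · rcases (Nat.lt_succ_iff_lt_or_eq.1 hl) with h | h
      · exact Ideal.mem_sup_left (S.f_mem h)
      · rw [Fin.ext h]
        exact Ideal.mem_sup_right (Ideal.mem_span_singleton_self _)
    · exact zero_mem _
  · rintro _ rfl
    exact S.f_mem (Nat.lt_succ_self _)

lemma I_succ_of_le {j : ℕ} (h : c ≤ j) : S.I (j + 1) = S.I j := by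
  unfold I
  congr 2
  funext l
  rw [if_pos (by omega), if_pos (by omega)]

lemma I_eq_span : S.I c = Ideal.span (Set.range S.f) := by
  unfold I
  congr 2
  funext l
  rw [if_pos l.2]

variable {S} {X Y : GrFree A}

lemma mem_sub_of_smul {i : Fin c} {v : X.F} (h : S.f i • v ∈ X.sub (S.I i)) :
    v ∈ X.sub (S.I i) :=
  GrFree.mem_sub_of_smul_mem (S.reg i) h

lemma sum_mem_sub {j : ℕ} {w : Fin c → X.F} (h : ∀ i : Fin c, j ≤ i → w i = 0) :
    ∑ i, S.f i • w i ∈ X.sub (S.I j) := by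
  refine sum_mem fun i _ => ?_
  by_cases hi : j ≤ i
  · rw [h i hi, smul_zero]
    exact zero_mem _
  · exact GrFree.smul_mem_sub (S.f_mem (by omega)) _

lemma exists_sum_of_mem_sub {j : ℕ} {v : X.F} (h : v ∈ X.sub (S.I j)) :
    ∃ w : Fin c → X.F, (∀ i : Fin c, j ≤ i → w i = 0) ∧ v = ∑ i, S.f i • w i := by
  obtain ⟨w, rfl⟩ := GrFree.exists_of_mem_sub_span h
  refine ⟨fun i => if (i : ℕ) < j then w i else 0, fun i hi => if_neg (by omega), ?_⟩
  refine Finset.sum_congr rfl fun i _ => ?_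
  dsimp only
  by_cases hi : (i : ℕ) < j
  · rw [if_pos hi, if_pos hi]
  · rw [if_neg hi, if_neg hi, zero_smul, smul_zero]

lemma sum_eq_add_sum_ite (i : Fin c) (w : Fin c → X.F) :
    ∑ l, S.f l • w l = S.f i • w i + ∑ l, S.f l • (if l = i then 0 else w l) := by
  rw [← Finset.add_sum_erase _ _ (Finset.mem_univ i),
    ← Finset.add_sum_erase (a := i) (f := fun l => S.f l • (if l = i then 0 else w l)) _
      (Finset.mem_univ i)]
  rw [if_pos rfl, smul_zero, zero_add]
  congr 1
  refine Finset.sum_congr rfl fun l hl => ?_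
  rw [if_neg (Finset.ne_of_mem_erase hl)]

lemma syz_last {i : Fin c} {w : Fin c → X.F} (h : ∑ l, S.f l • w l = 0)
    (hw : ∀ l : Fin c, (i : ℕ) + 1 ≤ l → w l = 0) : w i ∈ X.sub (S.I i) := by
  refine mem_sub_of_smul ?_
  have : S.f i • w i = - ∑ l, S.f l • (if l = i then 0 else w l) := by
    rw [eq_neg_iff_add_eq_zero, ← sum_eq_add_sum_ite i, h]
  rw [this]
  refine neg_mem (sum_mem_sub fun l hl => ?_)
  split_ifs with h'
  · rfl
  · exact hw l (Nat.lt_of_le_of_ne hl fun h => h' (Fin.ext h.symm))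

lemma syz {j : ℕ} {w : Fin c → X.F} (h : ∑ l, S.f l • w l = 0)
    (hw : ∀ l : Fin c, j ≤ l → w l = 0) (i : Fin c) : w i ∈ X.sub (S.I j) := by
  induction j generalizing w i with
  | zero => rw [hw i (Nat.zero_le _)]; exact zero_mem _
  | succ j ih =>
    by_cases hj : j < c
    · have h₀ : w ⟨j, hj⟩ ∈ X.sub (S.I j) := syz_last (i := ⟨j, hj⟩) h hw
      obtain ⟨y, hy0, hy⟩ := exists_sum_of_mem_sub h₀
      have key := ih (w := fun l => (if l = ⟨j, hj⟩ then 0 else w l) + S.f ⟨j, hj⟩ • y l) ?_ ?_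
      · by_cases hi : i = ⟨j, hj⟩
        · rw [hi]
          exact GrFree.sub_mono (S.I_mono (Nat.le_succ j)) h₀
        · have := GrFree.sub_mono (S.I_mono (Nat.le_succ j)) (key i)
          rw [if_neg hi] at this
          exact (Submodule.add_mem_iff_left _
            (GrFree.smul_mem_sub (S.f_mem (Nat.lt_succ_self j)) _)).1 this
      · simp only [smul_add, Finset.sum_add_distrib, smul_comm _ (S.f ⟨j, hj⟩)]
        rw [← Finset.smul_sum, ← hy, add_comm, ← sum_eq_add_sum_ite ⟨j, hj⟩ w, h]
      · intro l hl
        rw [hy0 l hl, smul_zero, add_zero]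
        split_ifs with h'
        · rfl
        · exact hw l (Nat.lt_of_le_of_ne hl fun h => h' (Fin.ext h.symm))
    · exact GrFree.sub_mono (S.I_mono (Nat.le_succ j)) (ih h (fun l hl => by omega) i)

lemma _root_.GrFree.Homog.exists_sum_lvl {δ : ℤ} {φ : X.F →ₗ[A] Y.F} (hφ : GrFree.Homog δ φ) {j : ℕ}
    (h : ∀ v, φ v ∈ Y.sub (S.I j)) :
    ∃ η : Fin c → (X.F →ₗ[A] Y.F), (∀ i, GrFree.Homog δ (η i)) ∧ (∀ i : Fin c, j ≤ i → η i = 0) ∧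
      ∀ v, φ v = ∑ i, S.f i • η i v := by
  obtain ⟨η, h1, h2⟩ := hφ.exists_sum h
  refine ⟨fun i => if (i : ℕ) < j then η i else 0, fun i => ?_, fun i hi => if_neg (by omega),
    fun v => ?_⟩
  · dsimp only
    split_ifs
    · exact h1 i
    · exact GrFree.Homog.zero
  · rw [h2]
    refine Finset.sum_congr rfl fun i _ => ?_
    dsimp only
    by_cases hi : (i : ℕ) < j
    · rw [if_pos hi, if_pos hi]
    · rw [if_neg hi, if_neg hi, zero_smul, LinearMap.zero_apply, smul_zero]

end RegSeq

/-- A degree `-1` endomorphism `d` of a graded free module, with `d² = ∑ fᵢ χᵢ` where `χᵢ = 0` for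
`i ≥ j`. -/
structure Crv {A : Type} [CommRing A] [IsLocalRing A] {c : ℕ} (X : GrFree A) (S : RegSeq A c)
    (j : ℕ) where
  d : X.F →ₗ[A] X.F
  χ : Fin c → (X.F →ₗ[A] X.F)
  d_deg : GrFree.Homog (-1) d
  χ_deg : ∀ i, GrFree.Homog (-2) (χ i)
  dd : ∀ v, d (d v) = ∑ i, S.f i • χ i v
  lvl : ∀ i : Fin c, j ≤ i → χ i = 0

namespace Crv

variable {A : Type} [CommRing A] [IsLocalRing A] {c j : ℕ} {X : GrFree A} {S : RegSeq A c}
  (T : Crv X S j)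

lemma dd_mem (v : X.F) : T.d (T.d v) ∈ X.sub (S.I j) := by
  rw [T.dd]
  exact RegSeq.sum_mem_sub fun i hi => by rw [T.lvl i hi, LinearMap.zero_apply]

lemma sum_comm_d (v : X.F) : ∑ i, S.f i • (T.d (T.χ i v) - T.χ i (T.d v)) = 0 := by
  have h := congrArg T.d (T.dd v)
  rw [T.dd (T.d v)] at h
  simp only [map_sum, map_smul] at h
  simp only [smul_sub, Finset.sum_sub_distrib, ← h, sub_self]

lemma comm_d (i : Fin c) (v : X.F) : T.d (T.χ i v) - T.χ i (T.d v) ∈ X.sub (S.I j) :=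
  RegSeq.syz (w := fun i => T.d (T.χ i v) - T.χ i (T.d v)) (T.sum_comm_d v)
    (fun l hl => by simp [T.lvl l hl]) i

lemma comm_d_last (i : Fin c) (hj : j = i + 1) (v : X.F) :
    T.d (T.χ i v) - T.χ i (T.d v) ∈ X.sub (S.I i) :=
  RegSeq.syz_last (w := fun i => T.d (T.χ i v) - T.χ i (T.d v)) (T.sum_comm_d v)
    (fun l hl => by simp [T.lvl l (hj ▸ hl)])

lemma comm_χ (l i : Fin c) (v : X.F) (hv : T.d v ∈ X.sub (maximalIdeal A)) :
    ∃ w, T.χ l (T.χ i v) - T.χ i (T.χ l v) - T.d w ∈ X.sub (maximalIdeal A) := by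
  have hom : GrFree.Homog (-3) (T.d ∘ₗ T.χ i - T.χ i ∘ₗ T.d) :=
    GrFree.Homog.sub ((T.d_deg.comp (T.χ_deg i)).of_eq (by norm_num))
      (((T.χ_deg i).comp T.d_deg).of_eq (by norm_num))
  obtain ⟨h, -, h0, hh⟩ := hom.exists_sum_lvl (S := S) (j := j) fun v => T.comm_d i v
  simp only [LinearMap.sub_apply, LinearMap.comp_apply] at hh
  have key := RegSeq.syz (S := S) (j := j) (X := X)
    (w := fun l => T.χ l (T.χ i v) - T.χ i (T.χ l v) - (T.d (h l v) + h l (T.d v))) ?_ ?_ l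
  · refine ⟨h l v, ?_⟩
    have h1 := GrFree.sub_mono (S.I_le j) key
    have h2 := GrFree.map_mem_sub (h l) hv
    have := add_mem h1 h2
    convert this using 1
    abel
  · have h1 := T.dd (T.χ i v)
    have h2 := congrArg (T.χ i) (T.dd v)
    have h3 := congrArg T.d (hh v)
    have h4 := hh (T.d v)
    simp only [map_sum, map_smul, map_sub] at h2 h3
    simp only [smul_sub, smul_add, Finset.sum_sub_distrib, Finset.sum_add_distrib, ← h1, ← h2,
      ← h3, ← h4]
    abel
  · intro l hl
    simp [T.lvl l hl, h0 l hl]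

end Crv

end

section

open IsLocalRing

/-- The representation of a polynomial ring given by commuting operators. -/
lemma exists_algHom_of_commute {k V : Type} [Field k] [AddCommGroup V] [Module k V] {c : ℕ}
    (x : Fin c → Module.End k V) (h : ∀ i l, x i * x l = x l * x i) :
    ∃ ρ : MvPolynomial (Fin c) k →ₐ[k] Module.End k V, ∀ i, ρ (MvPolynomial.X i) = x i := by
  have hc : IsMulCommutative (Algebra.adjoin k (Set.range x)) := by
    refine Algebra.isMulCommutative_adjoin k ?_
    rintro _ ⟨i, rfl⟩ _ ⟨l, rfl⟩
    exact h i l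
  let _ : CommRing (Algebra.adjoin k (Set.range x)) :=
    { (inferInstance : Ring (Algebra.adjoin k (Set.range x))) with
      mul_comm := hc.is_comm.comm }
  refine ⟨(Algebra.adjoin k (Set.range x)).val.comp (MvPolynomial.aeval fun i =>
    (⟨x i, Algebra.subset_adjoin ⟨i, rfl⟩⟩ : Algebra.adjoin k (Set.range x))), fun i => ?_⟩
  simp

namespace Crv

variable {A : Type} [CommRing A] [IsLocalRing A] {c j j₁ : ℕ} {X Y : GrFree A}
  {S : RegSeq A c} (T : Crv X S j) (T' : Crv Y S j₁)

/-- Cycles modulo the maximal ideal. -/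
def Z : Submodule A X.F := (X.sub (maximalIdeal A)).comap T.d

/-- Boundaries modulo the maximal ideal. -/
def Bd : Submodule A X.F := LinearMap.range T.d ⊔ X.sub (maximalIdeal A)

variable {T T'} in
lemma mem_Z {u : X.F} : u ∈ T.Z ↔ T.d u ∈ X.sub (maximalIdeal A) := Iff.rfl

variable {T} in
lemma mem_Bd {u : X.F} : u ∈ T.Bd ↔ ∃ w, u - T.d w ∈ X.sub (maximalIdeal A) := by
  constructor
  · intro h
    obtain ⟨_, ⟨w, rfl⟩, y, hy, rfl⟩ := Submodule.mem_sup.1 h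
    exact ⟨w, by simpa using hy⟩
  · rintro ⟨w, hw⟩
    have := Submodule.add_mem_sup (LinearMap.mem_range_self T.d w) hw
    rwa [add_sub_cancel] at this

/-- The homology modulo the maximal ideal. -/
def E : Type := T.Z ⧸ T.Bd.comap T.Z.subtype

noncomputable instance : AddCommGroup T.E :=
  inferInstanceAs (AddCommGroup (T.Z ⧸ T.Bd.comap T.Z.subtype))

noncomputable instance : Module A T.E :=
  inferInstanceAs (Module A (T.Z ⧸ T.Bd.comap T.Z.subtype))

/-- The class of a cycle. -/
noncomputable def cl : T.Z →ₗ[A] T.E := (T.Bd.comap T.Z.subtype).mkQ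

lemma cl_surjective : Function.Surjective T.cl := Submodule.mkQ_surjective _

variable {T} in
lemma cl_eq_zero {u : T.Z} : T.cl u = 0 ↔ (u : X.F) ∈ T.Bd :=
  (Submodule.Quotient.mk_eq_zero _).trans Iff.rfl

lemma isTorsion : Module.IsTorsionBySet A T.E (maximalIdeal A : Set A) := by
  intro v a
  obtain ⟨u, rfl⟩ := T.cl_surjective v
  rw [← map_smul, cl_eq_zero]
  exact Submodule.mem_sup_right (GrFree.smul_mem_sub a.2 (u : X.F))

noncomputable instance : Module (ResidueField A) T.E := T.isTorsion.module

instance : IsScalarTower A (ResidueField A) T.E := .of_algebraMap_smul fun _ _ => rfl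

/-- The linear map induced on homology. -/
noncomputable def indMapAux (φ : X.F →ₗ[A] Y.F) (hZ : ∀ u ∈ T.Z, φ u ∈ T'.Z)
    (hB : ∀ u, φ (T.d u) ∈ T'.Bd) : T.E →ₗ[A] T'.E :=
  Submodule.mapQ (T.Bd.comap T.Z.subtype) (T'.Bd.comap T'.Z.subtype) (φ.restrict hZ) (by
    rintro ⟨u, hu⟩ (hu' : u ∈ T.Bd)
    obtain ⟨w, hw⟩ := mem_Bd.1 hu'
    change φ u ∈ T'.Bd
    have := add_mem (hB w) (Submodule.mem_sup_right (GrFree.map_mem_sub φ hw) : _ ∈ T'.Bd)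
    rwa [← map_add, add_sub_cancel] at this)

/-- The map induced on homology, over the residue field. -/
noncomputable def indMap (φ : X.F →ₗ[A] Y.F) (hZ : ∀ u ∈ T.Z, φ u ∈ T'.Z)
    (hB : ∀ u, φ (T.d u) ∈ T'.Bd) : T.E →ₗ[ResidueField A] T'.E :=
  (indMapAux T T' φ hZ hB).extendScalarsOfSurjective residue_surjective

lemma cl_eq_cl {u v : T.Z} : T.cl u = T.cl v ↔ (u : X.F) - v ∈ T.Bd := by
  rw [← sub_eq_zero, ← map_sub, cl_eq_zero]
  rfl

lemma χ_mem_Z (i : Fin c) {u : X.F} (hu : u ∈ T.Z) : T.χ i u ∈ T.Z := by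
  have := add_mem (GrFree.sub_mono (S.I_le j) (T.comm_d i u)) (GrFree.map_mem_sub (T.χ i) hu)
  rwa [sub_add_cancel] at this

lemma χ_d_mem (i : Fin c) (u : X.F) : T.χ i (T.d u) ∈ T.Bd := by
  refine mem_Bd.2 ⟨T.χ i u, ?_⟩
  rw [← neg_mem_iff, neg_sub]
  exact GrFree.sub_mono (S.I_le j) (T.comm_d i u)

lemma π_mem_Z (n : ℤ) {u : X.F} (hu : u ∈ T.Z) : X.π n u ∈ T.Z := by
  rw [mem_Z, T.d_deg]
  exact GrFree.map_mem_sub _ hu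

lemma π_d_mem (n : ℤ) (u : X.F) : X.π n (T.d u) ∈ T.Bd := by
  refine mem_Bd.2 ⟨X.π (n + 1) u, ?_⟩
  rw [T.d_deg, add_neg_cancel_right, sub_self]
  exact zero_mem _

/-- The operator induced by `χ i` on homology. -/
noncomputable def op (i : Fin c) : Module.End (ResidueField A) T.E :=
  indMap T T (T.χ i) (fun _ => T.χ_mem_Z i) (T.χ_d_mem i)

/-- The projection to the degree `n` part of homology. -/
noncomputable def proj (n : ℤ) : Module.End (ResidueField A) T.E :=
  indMap T T (X.π n) (fun _ => T.π_mem_Z n) (T.π_d_mem n)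

lemma op_cl (i : Fin c) (u : T.Z) : T.op i (T.cl u) = T.cl ⟨T.χ i u, T.χ_mem_Z i u.2⟩ := rfl

lemma proj_cl (n : ℤ) (u : T.Z) : T.proj n (T.cl u) = T.cl ⟨X.π n u, T.π_mem_Z n u.2⟩ := rfl

lemma op_comm (i l : Fin c) : T.op i * T.op l = T.op l * T.op i := by
  refine LinearMap.ext fun v => ?_
  obtain ⟨u, rfl⟩ := T.cl_surjective v
  rw [Module.End.mul_apply, Module.End.mul_apply, op_cl, op_cl, op_cl, op_cl, cl_eq_cl, mem_Bd]
  exact T.comm_χ i l u u.2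

/-- The homology as a graded module over the polynomial ring. -/
noncomputable def gm [IsNoetherianRing A] : GradedOp (ResidueField A) c where
  V := T.E
  ρ := (exists_algHom_of_commute T.op T.op_comm).choose
  P := T.proj
  P_P m n v := by
    obtain ⟨u, rfl⟩ := T.cl_surjective v
    rw [proj_cl, proj_cl]
    split_ifs with h
    · congr 2
      dsimp only
      rw [X.π_π, if_pos h]
    · rw [cl_eq_zero]
      dsimp only
      rw [X.π_π, if_neg h]
      exact zero_mem _
  X_P i n v := by
    rw [(exists_algHom_of_commute T.op T.op_comm).choose_spec i]
    obtain ⟨u, rfl⟩ := T.cl_surjective v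
    rw [proj_cl, op_cl, op_cl, proj_cl]
    congr 2
    exact T.χ_deg i n u
  fin n := by
    have hfin : Module.Finite A ↥(T.Z ⊓ LinearMap.range (X.π n)) :=
      Module.Finite.of_injective (Submodule.inclusion (inf_le_right : T.Z ⊓ LinearMap.range (X.π n) ≤
        LinearMap.range (X.π n))) (Submodule.inclusion_injective _)
    let ψ : ↥(T.Z ⊓ LinearMap.range (X.π n)) →ₗ[A] LinearMap.range (T.proj n) :=
      LinearMap.codRestrict ((LinearMap.range (T.proj n)).restrictScalars A)
        (T.cl ∘ₗ Submodule.inclusion inf_le_left) (by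
          rintro ⟨u, hu, w, rfl⟩
          refine ⟨T.cl ⟨X.π n w, hu⟩, ?_⟩
          rw [proj_cl]
          simp only [X.π_self]
          rfl)
    have : Module.Finite A (LinearMap.range (T.proj n)) := by
      refine Module.Finite.of_surjective ψ ?_
      rintro ⟨_, v, rfl⟩
      obtain ⟨u, rfl⟩ := T.cl_surjective v
      exact ⟨⟨X.π n u, T.π_mem_Z n u.2, u, rfl⟩, rfl⟩
    exact Module.Finite.of_restrictScalars_finite A _ _

variable [IsNoetherianRing A]

/-- The class of a cycle, as an element of the graded module. -/
noncomputable def gcl (u : X.F) (hu : u ∈ T.Z) : T.gm.V := T.cl ⟨u, hu⟩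

lemma exists_gcl (v : T.gm.V) : ∃ u hu, v = T.gcl u hu := by
  obtain ⟨u, rfl⟩ := T.cl_surjective v
  exact ⟨u, u.2, rfl⟩

variable {T} in
lemma gcl_eq_zero {u : X.F} {hu : u ∈ T.Z} : T.gcl u hu = 0 ↔ u ∈ T.Bd := cl_eq_zero

variable {T} in
lemma gcl_eq_gcl {u v : X.F} {hu : u ∈ T.Z} {hv : v ∈ T.Z} :
    T.gcl u hu = T.gcl v hv ↔ u - v ∈ T.Bd := T.cl_eq_cl

lemma P_gcl (n : ℤ) (u : X.F) (hu : u ∈ T.Z) :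
    T.gm.P n (T.gcl u hu) = T.gcl (X.π n u) (T.π_mem_Z n hu) := rfl

lemma X_smul_gcl (i : Fin c) (u : X.F) (hu : u ∈ T.Z) :
    (MvPolynomial.X i : MvPolynomial (Fin c) (ResidueField A)) • T.gcl u hu =
      T.gcl (T.χ i u) (T.χ_mem_Z i hu) := by
  have : T.gm.ρ (MvPolynomial.X i) = T.op i :=
    (exists_algHom_of_commute T.op T.op_comm).choose_spec i
  rw [GradedOp.smul_def, this]
  rfl

/-- The map of graded modules induced by a map of curved complexes. -/
noncomputable def gmap (φ : X.F →ₗ[A] Y.F) (hZ : ∀ u ∈ T.Z, φ u ∈ T'.Z)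
    (hB : ∀ u, φ (T.d u) ∈ T'.Bd) : T.gm.V →ₗ[ResidueField A] T'.gm.V :=
  indMap T T' φ hZ hB

end Crv

end

section

open IsLocalRing

namespace Crv

variable {A : Type} [CommRing A] [IsLocalRing A] [IsNoetherianRing A] {c j j' : ℕ} {X : GrFree A}
  {S : RegSeq A c} (T : Crv X S j)

/-- The polynomial `z` acts on homology as the endomorphism `x`. -/
def Rep (z : MvPolynomial (Fin c) (ResidueField A)) (x : X.F →ₗ[A] X.F) : Prop :=
  ∀ u hu, ∃ h, z • T.gcl u hu = T.gcl (x u) h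

/-- The polynomial `z` is represented by an endomorphism of degree `-2 * e` commuting with the
differential modulo the ideal of the regular sequence. -/
def Lift (e : ℕ) (z : MvPolynomial (Fin c) (ResidueField A)) : Prop :=
  ∃ x : X.F →ₗ[A] X.F, GrFree.Homog (-(2 * e : ℤ)) x ∧
    (∀ v, x (T.d v) - T.d (x v) ∈ X.sub (S.I j)) ∧ T.Rep z x

variable {T}

lemma lift_X (i : Fin c) : T.Lift 1 (MvPolynomial.X i) := by
  refine ⟨T.χ i, (T.χ_deg i).of_eq (by norm_num), fun v => ?_, fun u hu => ⟨_, T.X_smul_gcl i u hu⟩⟩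
  rw [← neg_mem_iff, neg_sub]
  exact T.comm_d i v

lemma lift_zero (e : ℕ) : T.Lift e 0 := by
  refine ⟨0, GrFree.Homog.zero, fun v => by simp, fun u hu => ⟨by simp, ?_⟩⟩
  rw [zero_smul, eq_comm, gcl_eq_zero]
  exact zero_mem _

lemma Lift.mul (e e' : ℕ) (p q : MvPolynomial (Fin c) (ResidueField A)) (hp : T.Lift e p)
    (hq : T.Lift e' q) : T.Lift (e + e') (p * q) := by
  obtain ⟨x, hx, hxd, hxp⟩ := hp
  obtain ⟨y, hy, hyd, hyq⟩ := hq
  refine ⟨x ∘ₗ y, (hx.comp hy).of_eq (by push_cast; ring), fun v => ?_, fun u hu => ?_⟩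
  · have := add_mem (hxd (y v)) (GrFree.map_mem_sub x (hyd v))
    rw [map_sub] at this
    convert this using 1
    simp
  · obtain ⟨h, h'⟩ := hyq u hu
    obtain ⟨h1, h1'⟩ := hxp (y u) h
    exact ⟨h1, by rw [mul_smul, h', h1']; rfl⟩

lemma Lift.add (e : ℕ) (p q : MvPolynomial (Fin c) (ResidueField A)) (hp : T.Lift e p)
    (hq : T.Lift e q) : T.Lift e (p + q) := by
  obtain ⟨x, hx, hxd, hxp⟩ := hp
  obtain ⟨y, hy, hyd, hyq⟩ := hq
  refine ⟨x + y, hx.add hy, fun v => ?_, fun u hu => ?_⟩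
  · convert add_mem (hxd v) (hyd v) using 1
    simp
    abel
  · obtain ⟨h, h'⟩ := hyq u hu
    obtain ⟨h1, h1'⟩ := hxp u hu
    exact ⟨add_mem h1 h, by rw [add_smul, h', h1']; rfl⟩

lemma Lift.sub (e : ℕ) (p q : MvPolynomial (Fin c) (ResidueField A)) (hp : T.Lift e p)
    (hq : T.Lift e q) : T.Lift e (p - q) := by
  obtain ⟨x, hx, hxd, hxp⟩ := hp
  obtain ⟨y, hy, hyd, hyq⟩ := hq
  refine ⟨x - y, hx.sub hy, fun v => ?_, fun u hu => ?_⟩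
  · convert sub_mem (hxd v) (hyd v) using 1
    simp
    abel
  · obtain ⟨h, h'⟩ := hyq u hu
    obtain ⟨h1, h1'⟩ := hxp u hu
    exact ⟨sub_mem h1 h, by rw [sub_smul, h', h1']; rfl⟩

lemma Lift.homogSMul {e : ℕ} {z : MvPolynomial (Fin c) (ResidueField A)} (h : T.Lift e z) :
    T.gm.HomogSMul e z := by
  obtain ⟨x, hx, -, hz⟩ := h
  intro n v
  obtain ⟨u, hu, rfl⟩ := T.exists_gcl v
  obtain ⟨h1, h1'⟩ := hz u hu
  obtain ⟨h2, h2'⟩ := hz _ (T.π_mem_Z n hu)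
  rw [P_gcl, h2', h1', P_gcl]
  congr 1
  exact hx n u

variable (T) in
/-- The data needed to form a curved mapping cone. -/
structure ConeData (e j' : ℕ) where
  x : X.F →ₗ[A] X.F
  g : A
  χ' : Fin c → (X.F →ₗ[A] X.F)
  x_deg : GrFree.Homog (-(2 * e : ℤ)) x
  g_deg : g = 0 ∨ e = 1
  g_mem : g ∈ maximalIdeal A
  χ'_deg : ∀ i, GrFree.Homog (-2) (χ' i)
  lvl : ∀ i : Fin c, j' ≤ i → χ' i = 0
  dd : ∀ v, T.d (T.d v) - g • x v = ∑ i, S.f i • χ' i v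
  comm : ∀ v, x (T.d v) - T.d (x v) ∈ X.sub (S.I j')
  χ'_or : ∀ i, χ' i = T.χ i ∨ (χ' i = 0 ∧ T.χ i = x)

namespace ConeData

variable {e : ℕ} (K : T.ConeData e j')

lemma exists_h : ∃ h : Fin c → (X.F →ₗ[A] X.F), (∀ i, GrFree.Homog (-(2 * e : ℤ) - 1) (h i)) ∧
    (∀ i : Fin c, j' ≤ i → h i = 0) ∧
      ∀ v, K.x (T.d v) - T.d (K.x v) = ∑ i, S.f i • h i v := by
  have hom : GrFree.Homog (-(2 * e : ℤ) - 1) (K.x ∘ₗ T.d - T.d ∘ₗ K.x) :=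
    GrFree.Homog.sub ((K.x_deg.comp T.d_deg).of_eq (by ring))
      ((T.d_deg.comp K.x_deg).of_eq (by ring))
  exact hom.exists_sum_lvl (S := S) (j := j') fun v => K.comm v

/-- The homotopies expressing that `x` commutes with the differential. -/
noncomputable def h : Fin c → (X.F →ₗ[A] X.F) := K.exists_h.choose

lemma h_deg (i : Fin c) : GrFree.Homog (-(2 * e : ℤ) - 1) (K.h i) := K.exists_h.choose_spec.1 i

lemma h_lvl (i : Fin c) (hi : j' ≤ i) : K.h i = 0 := K.exists_h.choose_spec.2.1 i hi

lemma h_sum (v : X.F) : K.x (T.d v) - T.d (K.x v) = ∑ i, S.f i • K.h i v :=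
  K.exists_h.choose_spec.2.2 v

/-- The curved mapping cone. -/
noncomputable def cone : Crv (X.double (2 * e - 1)) S j' where
  d := GrFree.matrixMap _ T.d (-K.g • LinearMap.id) K.x (-T.d)
  χ i := GrFree.matrixMap _ (K.χ' i) 0 (K.h i) (K.χ' i)
  d_deg := by
    refine GrFree.homog_matrixMap T.d_deg ?_ (K.x_deg.of_eq (by ring)) fun n v => ?_
    · rcases K.g_deg with h | h
      · rw [h]
        simpa using GrFree.Homog.zero
      · subst h
        intro n v
        simp
    · simp [T.d_deg n v]
  χ_deg i := GrFree.homog_matrixMap (K.χ'_deg i) GrFree.Homog.zero ((K.h_deg i).of_eq (by ring))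
    (K.χ'_deg i)
  dd w := by
    obtain ⟨u, v, rfl⟩ := GrFree.exists_dmk w
    simp only [GrFree.matrixMap_dmk, GrFree.dmk_smul, GrFree.dmk_sum]
    congr 1
    · simp only [LinearMap.zero_apply, add_zero, ← K.dd]
      simp only [map_add, map_smul, LinearMap.smul_apply, LinearMap.id_apply, LinearMap.neg_apply,
        neg_smul, map_neg]
      abel
    · simp only [smul_add, Finset.sum_add_distrib, ← K.dd, ← K.h_sum]
      simp only [map_add, map_smul, LinearMap.smul_apply, LinearMap.id_apply, LinearMap.neg_apply,
        neg_smul, map_neg]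
      abel
  lvl i hi := by
    rw [K.lvl i hi, K.h_lvl i hi]
    refine LinearMap.ext fun w => ?_
    obtain ⟨u, v, rfl⟩ := GrFree.exists_dmk w
    simp [GrFree.matrixMap_dmk, GrFree.dmk_zero]

lemma cone_d (u v : X.F) : K.cone.d (GrFree.dmk _ u v) =
    GrFree.dmk _ (T.d u - K.g • v) (K.x u - T.d v) := by
  refine (GrFree.matrixMap_dmk ..).trans ?_
  simp [sub_eq_add_neg]

lemma cone_χ (i : Fin c) (u v : X.F) : K.cone.χ i (GrFree.dmk _ u v) =
    GrFree.dmk _ (K.χ' i u) (K.h i u + K.χ' i v) := by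
  refine (GrFree.matrixMap_dmk ..).trans ?_
  simp

lemma g_smul_mem (v : X.F) : K.g • v ∈ X.sub (maximalIdeal A) := GrFree.smul_mem_sub K.g_mem v

lemma dmk_mem_Z {u v : X.F} : GrFree.dmk _ u v ∈ K.cone.Z ↔
    u ∈ T.Z ∧ K.x u - T.d v ∈ X.sub (maximalIdeal A) := by
  rw [mem_Z, mem_Z, cone_d, GrFree.dmk_mem_sub, Submodule.sub_mem_iff_left _ (K.g_smul_mem v)]

lemma dmk_mem_Bd {u v : X.F} : GrFree.dmk _ u v ∈ K.cone.Bd ↔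
    ∃ u' v', u - T.d u' ∈ X.sub (maximalIdeal A) ∧
      v - (K.x u' - T.d v') ∈ X.sub (maximalIdeal A) := by
  rw [mem_Bd]
  constructor
  · rintro ⟨w, hw⟩
    obtain ⟨u', v', rfl⟩ := GrFree.exists_dmk w
    rw [cone_d, GrFree.dmk_sub, GrFree.dmk_mem_sub] at hw
    refine ⟨u', v', ?_, hw.2⟩
    have := sub_mem hw.1 (K.g_smul_mem v')
    convert this using 1
    abel
  · rintro ⟨u', v', h1, h2⟩
    refine ⟨GrFree.dmk _ u' v', ?_⟩
    rw [cone_d, GrFree.dmk_sub, GrFree.dmk_mem_sub]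
    refine ⟨?_, h2⟩
    have := add_mem h1 (K.g_smul_mem v')
    convert this using 1
    abel

/-- The inclusion into the cone, on homology. -/
noncomputable def iMap : T.gm.V →ₗ[ResidueField A] K.cone.gm.V :=
  gmap T K.cone (X.dinr _)
    (fun u hu => by
      rw [GrFree.dinr_apply, dmk_mem_Z, map_zero, zero_sub, neg_mem_iff]
      exact ⟨zero_mem _, hu⟩)
    (fun u => by
      rw [GrFree.dinr_apply, dmk_mem_Bd]
      exact ⟨0, -u, by simp, by simp⟩)

/-- The projection from the cone, on homology. -/
noncomputable def pMap : K.cone.gm.V →ₗ[ResidueField A] T.gm.V :=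
  gmap K.cone T (X.dfst _)
    (fun w hw => by
      obtain ⟨u, v, rfl⟩ := GrFree.exists_dmk w
      exact (K.dmk_mem_Z.1 hw).1)
    (fun w => by
      obtain ⟨u, v, rfl⟩ := GrFree.exists_dmk w
      rw [cone_d, GrFree.dfst_dmk]
      refine mem_Bd.2 ⟨u, ?_⟩
      rw [sub_sub_cancel_left, neg_mem_iff]
      exact K.g_smul_mem v)

lemma iMap_gcl (u : X.F) (hu : u ∈ T.Z) (h : GrFree.dmk _ 0 u ∈ K.cone.Z) :
    K.iMap (T.gcl u hu) = K.cone.gcl (GrFree.dmk _ 0 u) h := rfl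

lemma pMap_gcl (u v : X.F) (hu : u ∈ T.Z) (h : GrFree.dmk _ u v ∈ K.cone.Z) :
    K.pMap (K.cone.gcl (GrFree.dmk _ u v) h) = T.gcl u hu := rfl

lemma dmk_zero_mem_Z {u : X.F} (hu : u ∈ T.Z) : GrFree.dmk _ 0 u ∈ K.cone.Z := by
  rw [dmk_mem_Z, map_zero, zero_sub, neg_mem_iff]
  exact ⟨zero_mem _, hu⟩

lemma dmk_zero_x_mem_Bd {u : X.F} (hu : u ∈ T.Z) : GrFree.dmk _ 0 (K.x u) ∈ K.cone.Bd := by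
  rw [dmk_mem_Bd]
  refine ⟨u, 0, ?_, by simp⟩
  rw [zero_sub, neg_mem_iff]
  exact hu

/-- The exact triangle of a cone. -/
noncomputable def tri {z : MvPolynomial (Fin c) (ResidueField A)} (hz : T.Rep z K.x) :
    GradedOp.Tri T.gm K.cone.gm z (2 * e - 1) 0 where
  i := K.iMap
  p := K.pMap
  hom_i := by
    constructor
    · intro l a
      obtain ⟨u, hu, rfl⟩ := T.exists_gcl a
      rw [X_smul_gcl, iMap_gcl _ _ _ (K.dmk_zero_mem_Z (T.χ_mem_Z l hu)),
        iMap_gcl _ _ _ (K.dmk_zero_mem_Z hu), X_smul_gcl, gcl_eq_gcl, cone_χ, GrFree.dmk_sub]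
      simp only [map_zero, sub_zero, zero_add]
      rcases K.χ'_or l with h | ⟨h, h'⟩
      · rw [h, sub_self, GrFree.dmk_zero]
        exact zero_mem _
      · rw [h, h', LinearMap.zero_apply, sub_zero]
        exact K.dmk_zero_x_mem_Bd hu
    · intro n a
      obtain ⟨u, hu, rfl⟩ := T.exists_gcl a
      rw [P_gcl, iMap_gcl _ _ _ (K.dmk_zero_mem_Z (T.π_mem_Z n hu)),
        iMap_gcl _ _ _ (K.dmk_zero_mem_Z hu), P_gcl]
      congr 1
      rw [GrFree.π_dmk, map_zero, add_sub_cancel_right]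
  hom_p := by
    constructor
    · intro l a
      obtain ⟨w, hw, rfl⟩ := K.cone.exists_gcl a
      obtain ⟨u, v, rfl⟩ := GrFree.exists_dmk w
      obtain ⟨hu, hv⟩ := K.dmk_mem_Z.1 hw
      rw [pMap_gcl _ _ _ hu, X_smul_gcl, X_smul_gcl]
      have : K.cone.gcl _ (K.cone.χ_mem_Z l hw) =
        K.cone.gcl (GrFree.dmk _ (K.χ' l u) (K.h l u + K.χ' l v))
          (K.cone_χ l u v ▸ K.cone.χ_mem_Z l hw) := by
        congr 1
        exact K.cone_χ l u v
      rw [this, pMap_gcl _ _ _ (K.dmk_mem_Z.1 (K.cone_χ l u v ▸ K.cone.χ_mem_Z l hw)).1,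
        gcl_eq_gcl]
      rcases K.χ'_or l with h | ⟨h, h'⟩
      · rw [h, sub_self]
        exact zero_mem _
      · rw [h, h', LinearMap.zero_apply, zero_sub, neg_mem_iff]
        exact mem_Bd.2 ⟨v, hv⟩
    · intro n a
      obtain ⟨w, hw, rfl⟩ := K.cone.exists_gcl a
      obtain ⟨u, v, rfl⟩ := GrFree.exists_dmk w
      obtain ⟨hu, hv⟩ := K.dmk_mem_Z.1 hw
      rw [pMap_gcl _ _ _ hu, P_gcl, P_gcl, add_zero]
      have : K.cone.gcl _ (K.cone.π_mem_Z n hw) =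
        K.cone.gcl (GrFree.dmk _ (X.π n u) (X.π (n - (2 * e - 1)) v))
          (GrFree.π_dmk n u v ▸ K.cone.π_mem_Z n hw) := by
        congr 1
        exact GrFree.π_dmk n u v
      rw [this, pMap_gcl]
  exact_z_i := by
    intro a
    obtain ⟨v, hv, rfl⟩ := T.exists_gcl a
    rw [iMap_gcl _ _ _ (K.dmk_zero_mem_Z hv), gcl_eq_zero]
    constructor
    · intro h
      obtain ⟨u', v', h1, h2⟩ := K.dmk_mem_Bd.1 h
      rw [zero_sub, neg_mem_iff] at h1
      obtain ⟨h3, h4⟩ := hz u' h1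
      refine ⟨T.gcl u' h1, ?_⟩
      rw [← GradedOp.smul_def, h4, eq_comm, gcl_eq_gcl, mem_Bd]
      refine ⟨-v', ?_⟩
      convert h2 using 1
      rw [map_neg]
      abel
    · rintro ⟨b, hb⟩
      obtain ⟨u, hu, rfl⟩ := T.exists_gcl b
      obtain ⟨h3, h4⟩ := hz u hu
      rw [← GradedOp.smul_def, h4, gcl_eq_gcl] at hb
      obtain ⟨w, hw⟩ := mem_Bd.1 hb
      refine K.dmk_mem_Bd.2 ⟨u, w, ?_, ?_⟩
      · rw [zero_sub, neg_mem_iff]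
        exact hu
      · rw [← neg_mem_iff]
        convert hw using 1
        abel
  exact_i_p := by
    intro a
    obtain ⟨w, hw, rfl⟩ := K.cone.exists_gcl a
    obtain ⟨u, v, rfl⟩ := GrFree.exists_dmk w
    obtain ⟨hu, hv⟩ := K.dmk_mem_Z.1 hw
    rw [pMap_gcl _ _ _ hu, gcl_eq_zero]
    constructor
    · intro h
      obtain ⟨w, hw⟩ := mem_Bd.1 h
      have h1 : v - K.x w ∈ T.Z := by
        have := sub_mem (add_mem (GrFree.sub_mono (S.I_le j') (K.comm w))
          (GrFree.map_mem_sub K.x hw)) hv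
        rw [mem_Z]
        convert this using 1
        simp only [map_sub]
        abel
      refine ⟨T.gcl _ h1, ?_⟩
      rw [iMap_gcl _ _ _ (K.dmk_zero_mem_Z h1), eq_comm, gcl_eq_gcl, GrFree.dmk_sub, dmk_mem_Bd]
      exact ⟨w, 0, by simpa using hw, by simp⟩
    · rintro ⟨b, hb⟩
      obtain ⟨y, hy, rfl⟩ := T.exists_gcl b
      rw [iMap_gcl _ _ _ (K.dmk_zero_mem_Z hy), eq_comm, gcl_eq_gcl, GrFree.dmk_sub,
        dmk_mem_Bd] at hb
      obtain ⟨u', v', h1, h2⟩ := hb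
      exact mem_Bd.2 ⟨u', by simpa using h1⟩
  exact_p_z := by
    intro a
    obtain ⟨u, hu, rfl⟩ := T.exists_gcl a
    obtain ⟨h3, h4⟩ := hz u hu
    rw [← GradedOp.smul_def, h4, gcl_eq_zero]
    constructor
    · intro h
      obtain ⟨v, hv⟩ := mem_Bd.1 h
      exact ⟨K.cone.gcl (GrFree.dmk _ u v) (K.dmk_mem_Z.2 ⟨hu, hv⟩), rfl⟩
    · rintro ⟨b, hb⟩
      obtain ⟨w, hw, rfl⟩ := K.cone.exists_gcl b
      obtain ⟨u', v', rfl⟩ := GrFree.exists_dmk w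
      obtain ⟨hu', hv'⟩ := K.dmk_mem_Z.1 hw
      rw [pMap_gcl _ _ _ hu', eq_comm, gcl_eq_gcl] at hb
      obtain ⟨y, hy⟩ := mem_Bd.1 hb
      refine mem_Bd.2 ⟨v' + K.x y, ?_⟩
      have := add_mem (add_mem (GrFree.map_mem_sub K.x hy) hv')
        (GrFree.sub_mono (S.I_le j') (K.comm y))
      convert this using 1
      simp only [map_sub, map_add]
      abel

end ConeData

end Crv

end

section

open IsLocalRing

namespace Crv

variable {A : Type} [CommRing A] [IsLocalRing A] {c j j' : ℕ} {X : GrFree A} {S : RegSeq A c}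

/-- Acyclicity in degree `n` modulo the ideal `Q`. -/
def AcycAt (T : Crv X S j) (n : ℤ) (Q : Ideal A) : Prop :=
  ∀ u, X.π n u = u → T.d u ∈ X.sub Q → ∃ w, u - T.d w ∈ X.sub Q

/-- Acyclicity modulo the ideal `Q`. -/
def Acyc (T : Crv X S j) (Q : Ideal A) : Prop := ∀ u, T.d u ∈ X.sub Q → ∃ w, u - T.d w ∈ X.sub Q

variable {T : Crv X S j}

lemma acyc_iff {Q : Ideal A} : T.Acyc Q ↔ ∀ n, T.AcycAt n Q := by
  refine ⟨fun h n u _ hu => h u hu, fun h u hu => ?_⟩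
  have (n : ℤ) : ∃ w, X.π n u - T.d w ∈ X.sub Q := by
    refine h n _ (X.π_self n u) ?_
    rw [T.d_deg]
    exact GrFree.map_mem_sub _ hu
  choose w hw using this
  obtain ⟨s, hs⟩ := X.exists_sum_π u
  refine ⟨∑ n ∈ s, w n, ?_⟩
  have : u - T.d (∑ n ∈ s, w n) = ∑ n ∈ s, (X.π n u - T.d (w n)) := by
    rw [Finset.sum_sub_distrib, ← hs, map_sum]
  rw [this]
  exact sum_mem fun n _ => hw n

namespace ConeData

/-- The data for the cone of an endomorphism commuting with the differential up to homotopy. -/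
def ofComm (T : Crv X S j) {e : ℕ} (x : X.F →ₗ[A] X.F) (hx : GrFree.Homog (-(2 * e : ℤ)) x)
    (hc : ∀ v, x (T.d v) - T.d (x v) ∈ X.sub (S.I j)) : T.ConeData e j where
  x := x
  g := 0
  χ' := T.χ
  x_deg := hx
  g_deg := Or.inl rfl
  g_mem := zero_mem _
  χ'_deg := T.χ_deg
  lvl := T.lvl
  dd v := by rw [zero_smul, sub_zero, T.dd]
  comm := hc
  χ'_or _ := Or.inl rfl

/-- The data for the cone lowering the level by one. -/
def reduce (i : Fin c) (T : Crv X S (i + 1)) : T.ConeData 1 i where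
  x := T.χ i
  g := S.f i
  χ' l := if l = i then 0 else T.χ l
  x_deg := (T.χ_deg i).of_eq (by norm_num)
  g_deg := Or.inr rfl
  g_mem := S.mem i
  χ'_deg l := by
    split_ifs
    · exact GrFree.Homog.zero
    · exact T.χ_deg l
  lvl l hl := by
    split_ifs with h
    · rfl
    · exact T.lvl l (Nat.lt_of_le_of_ne hl fun h' => h (Fin.ext h'.symm))
  dd v := by
    rw [T.dd, RegSeq.sum_eq_add_sum_ite i, add_sub_cancel_left]
    refine Finset.sum_congr rfl fun l _ => ?_
    by_cases h : l = i
    · rw [if_pos h, if_pos h, LinearMap.zero_apply]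
    · rw [if_neg h, if_neg h]
  comm v := by
    rw [← neg_mem_iff, neg_sub]
    exact T.comm_d_last i rfl v
  χ'_or l := by
    by_cases h : l = i
    · exact Or.inr ⟨if_pos h, by rw [h]⟩
    · exact Or.inl (if_neg h)

variable [IsNoetherianRing A]

lemma acyc_ofComm {e : ℕ} {x : X.F →ₗ[A] X.F} (hx : GrFree.Homog (-(2 * e : ℤ)) x)
    (hc : ∀ v, x (T.d v) - T.d (x v) ∈ X.sub (S.I j)) (hT : T.Acyc (S.I j)) :
    (ofComm T x hx hc).cone.Acyc (S.I j) := by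
  intro w hw
  obtain ⟨u, v, rfl⟩ := GrFree.exists_dmk w
  rw [cone_d, GrFree.dmk_mem_sub] at hw
  simp only [ofComm, zero_smul, sub_zero] at hw
  obtain ⟨h1, h2⟩ := hw
  obtain ⟨w, hw⟩ := hT u h1
  obtain ⟨y, hy⟩ := hT (v - x w) (by
    have := sub_mem (add_mem (hc w) (GrFree.map_mem_sub x hw)) h2
    convert this using 1
    simp only [map_sub]
    abel)
  refine ⟨GrFree.dmk _ w (-y), ?_⟩
  rw [cone_d, GrFree.dmk_sub, GrFree.dmk_mem_sub]
  simp only [ofComm, zero_smul, sub_zero]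
  refine ⟨hw, ?_⟩
  convert hy using 1
  rw [map_neg]
  abel

lemma acyc_reduce {i : Fin c} {T : Crv X S (i + 1)} (hT : T.Acyc (S.I (i + 1))) :
    (reduce i T).cone.Acyc (S.I i) := by
  intro w hw
  obtain ⟨u, v, rfl⟩ := GrFree.exists_dmk w
  rw [cone_d, GrFree.dmk_mem_sub] at hw
  simp only [reduce] at hw
  obtain ⟨h1, h2⟩ := hw
  obtain ⟨w, hw⟩ := hT u (by
    have := add_mem (GrFree.sub_mono (S.I_mono (Nat.le_succ i)) h1)
      (GrFree.smul_mem_sub (S.f_mem (Nat.lt_succ_self i)) v)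
    rwa [sub_add_cancel] at this)
  rw [S.I_succ i] at hw
  obtain ⟨y, hy⟩ := GrFree.exists_of_mem_sub_sup hw
  refine ⟨GrFree.dmk _ w (-y), ?_⟩
  rw [cone_d, GrFree.dmk_sub, GrFree.dmk_mem_sub]
  simp only [reduce]
  refine ⟨?_, RegSeq.mem_sub_of_smul ?_⟩
  · convert hy using 1
    rw [smul_neg]
    abel
  · have h3 : T.d (T.d w) - S.f i • T.χ i w ∈ X.sub (S.I i) := by
      have := (reduce i T).dd w
      simp only [reduce] at this
      rw [this]
      exact RegSeq.sum_mem_sub fun l hl => by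
        have := (reduce i T).lvl l hl
        simp only [reduce] at this
        rw [this, LinearMap.zero_apply]
    have := add_mem (sub_mem (GrFree.map_mem_sub T.d hy) h1) h3
    convert this using 1
    simp only [map_sub, map_neg, map_smul, smul_sub, smul_neg]
    abel

lemma rep_reduce (i : Fin c) (T : Crv X S (i + 1)) :
    T.Rep (MvPolynomial.X i) (reduce i T).x := fun u hu => ⟨_, T.X_smul_gcl i u hu⟩

end ConeData

end Crv

end

section

open IsLocalRing

lemma exists_notMem_mul_mem {A : Type} [CommRing A] [IsLocalRing A] [IsNoetherianRing A]
    {J : Ideal A} (h : ∀ x ∈ maximalIdeal A, ∃ a ∉ J, x * a ∈ J) :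
    ∃ s ∉ J, ∀ x ∈ maximalIdeal A, x * s ∈ J := by
  have hsub : (maximalIdeal A : Set A) ⊆ ⋃ p ∈ associatedPrimes A (A ⧸ J), (p : Set A) := by
    rw [biUnion_associatedPrimes_eq_zero_divisors]
    intro x hx
    obtain ⟨a, ha, hxa⟩ := h x hx
    refine ⟨Ideal.Quotient.mk J a, fun h0 => ha (Ideal.Quotient.eq_zero_iff_mem.1 h0), ?_⟩
    exact Ideal.Quotient.eq_zero_iff_mem.2 hxa
  obtain ⟨p, hp, hle⟩ := (Ideal.subset_union_prime_finite (associatedPrimes.finite A (A ⧸ J))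
    (f := id) 0 0 fun _ h _ _ => h.isPrime).1 hsub
  rw [AssociatedPrimes.mem_iff, isAssociatedPrime_iff] at hp
  obtain ⟨hprime, y, rfl⟩ := hp
  obtain ⟨s, rfl⟩ := Ideal.Quotient.mk_surjective y
  refine ⟨s, fun hs => hprime.ne_top ?_, fun x hx => ?_⟩
  · rw [Ideal.eq_top_iff_one, Submodule.mem_colon_singleton, Ideal.Quotient.eq_zero_iff_mem.2 hs]
    simp
  · have := hle hx
    rw [id, Submodule.mem_colon_singleton, Submodule.mem_bot] at this
    exact Ideal.Quotient.eq_zero_iff_mem.1 this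

namespace Crv

variable {A : Type} [CommRing A] [IsLocalRing A] [IsNoetherianRing A] {c j : ℕ} {X : GrFree A}
  {S : RegSeq A c} {T : Crv X S j}

/-- Acyclicity modulo the maximal ideal in one degree implies acyclicity modulo smaller ideals in
the same degree. -/
lemma AcycAt.of_maximalIdeal {n : ℤ} (h : T.AcycAt n (maximalIdeal A)) (Q : Ideal A)
    (hIQ : S.I j ≤ Q) (hQ : Q ≤ maximalIdeal A) : T.AcycAt n Q := by
  induction Q using WellFoundedGT.induction with
  | ind Q ih =>
  rcases hQ.eq_or_lt with rfl | hlt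
  · exact h
  obtain ⟨x, hx, hxQ⟩ := SetLike.exists_of_lt hlt
  have hdec : ∀ u, X.π n u = u → T.d u ∈ X.sub Q → ∃ w y, X.π n y = y ∧
      u - T.d w - x • y ∈ X.sub Q ∧ x • T.d y ∈ X.sub Q := by
    intro u hu hdu
    obtain ⟨w, hw⟩ := ih (Q ⊔ Ideal.span {x})
      (lt_of_le_of_ne le_sup_left fun h => hxQ (h ▸ Ideal.mem_sup_right
        (Ideal.mem_span_singleton_self x))) (hIQ.trans le_sup_left)
      (sup_le hQ ((Ideal.span_singleton_le_iff_mem _).2 hx)) u hu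
      (GrFree.sub_mono le_sup_left hdu)
    obtain ⟨y, hy⟩ := GrFree.exists_of_mem_sub_sup hw
    have hy' : u - T.d (X.π (n + 1) w) - x • X.π n y ∈ X.sub Q := by
      have := GrFree.map_mem_sub (X.π n) hy
      rw [map_sub, map_sub, hu, map_smul] at this
      rwa [T.d_deg, add_neg_cancel_right]
    refine ⟨_, _, X.π_self n y, hy', ?_⟩
    have h1 := sub_mem (sub_mem hdu (GrFree.sub_mono hIQ (T.dd_mem (X.π (n + 1) w))))
      (GrFree.map_mem_sub T.d hy')
    convert h1 using 1
    simp only [map_sub, map_smul]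
    abel
  by_cases hcol : ∀ a, x * a ∈ Q → a ∈ Q
  · let Z : Submodule A X.F := LinearMap.range (X.π n) ⊓ (X.sub Q).comap T.d
    have hZ : ∀ u, u ∈ Z ↔ X.π n u = u ∧ T.d u ∈ X.sub Q := fun u => by
      refine and_congr_left' ⟨?_, fun h => ⟨u, h⟩⟩
      rintro ⟨v, rfl⟩
      exact X.π_self n v
    have hfg : Z.FG := by
      have hn : IsNoetherian A (LinearMap.range (X.π n)) := inferInstance
      exact (isNoetherian_submodule.1 hn) _ inf_le_left
    have hle : Z ≤ (LinearMap.range T.d ⊔ X.sub Q) ⊔ maximalIdeal A • Z := by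
      intro u hu
      obtain ⟨hu1, hu2⟩ := (hZ u).1 hu
      obtain ⟨w, y, hy, hy', hdy⟩ := hdec u hu1 hu2
      have h1 : T.d w + (u - T.d w - x • y) ∈ LinearMap.range T.d ⊔ X.sub Q :=
        Submodule.add_mem_sup ⟨w, rfl⟩ hy'
      have h2 : x • y ∈ maximalIdeal A • Z := Submodule.smul_mem_smul hx
        ((hZ y).2 ⟨hy, GrFree.mem_sub_of_smul_mem hcol hdy⟩)
      convert Submodule.add_mem_sup h1 h2 using 1
      abel
    have hfin := Submodule.le_of_le_smul_of_le_jacobson_bot hfg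
      (IsLocalRing.maximalIdeal_le_jacobson ⊥) hle
    intro u hu hdu
    obtain ⟨_, ⟨w, rfl⟩, q, hq, hwq⟩ := Submodule.mem_sup.1 (hfin ((hZ u).2 ⟨hu, hdu⟩))
    exact ⟨w, by rwa [← hwq, add_sub_cancel_left]⟩
  · push Not at hcol
    obtain ⟨a, ha, haQ⟩ := hcol
    let R : Ideal A := Q.colon {x}
    have hR : ∀ b, b ∈ R ↔ x * b ∈ Q := fun b => by
      rw [Submodule.mem_colon_singleton, smul_eq_mul, mul_comm]
    have hQR : Q ≤ R := fun b hb => (hR b).2 (Q.mul_mem_left x hb)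
    have hmem : ∀ v, v ∈ X.sub R ↔ x • v ∈ X.sub Q := fun v => by
      refine forall_congr' fun b => ?_
      rw [hR, map_smul]
      rfl
    intro u hu hdu
    obtain ⟨w, y, hy, hy', hdy⟩ := hdec u hu hdu
    obtain ⟨w', hw'⟩ := ih R (lt_of_le_of_ne hQR fun h => haQ (h ▸ (hR a).2 ha)) (hIQ.trans hQR)
      (IsLocalRing.le_maximalIdeal fun h => hxQ (by
        have := (hR 1).1 (h ▸ trivial)
        rwa [mul_one] at this)) y hy ((hmem _).2 hdy)
    refine ⟨w + x • w', ?_⟩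
    have := add_mem hy' ((hmem _).1 hw')
    convert this using 1
    simp only [smul_sub, map_add, map_smul]
    abel

/-- Acyclicity modulo an ideal passes to the ideal enlarged by a regular element. -/
lemma Acyc.sup_span {J : Ideal A} (hIJ : S.I j ≤ J) (hJ : T.Acyc J) {x : A}
    (hx : ∀ a, x * a ∈ J → a ∈ J) : T.Acyc (J ⊔ Ideal.span {x}) := by
  intro u hu
  have hxm : x ∈ J ⊔ Ideal.span {x} := Ideal.mem_sup_right (Ideal.mem_span_singleton_self x)
  obtain ⟨y, hy⟩ := GrFree.exists_of_mem_sub_sup hu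
  obtain ⟨w, hw⟩ := hJ y (GrFree.mem_sub_of_smul_mem hx (by
    have := sub_mem (GrFree.sub_mono hIJ (T.dd_mem u)) (GrFree.map_mem_sub T.d hy)
    convert this using 1
    simp))
  obtain ⟨w', hw'⟩ := hJ (u - x • w) (by
    have := add_mem hy (Submodule.smul_mem _ x hw)
    convert this using 1
    simp only [map_sub, map_smul, smul_sub]
    abel)
  refine ⟨w', ?_⟩
  have := add_mem (GrFree.sub_mono (le_sup_left : J ≤ J ⊔ Ideal.span {x}) hw')
    (GrFree.smul_mem_sub hxm w)
  convert this using 1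
  abel

lemma Acyc.maximalIdeal (hT : T.Acyc (S.I j)) {N : ℤ}
    (hN : ∀ n, N ≤ n → T.AcycAt n (maximalIdeal A)) : T.Acyc (maximalIdeal A) := by
  obtain ⟨J, ⟨hIJ, hJm, hJ⟩, hmax⟩ := (wellFounded_gt (α := Ideal A)).has_min
    {Q | S.I j ≤ Q ∧ Q ≤ IsLocalRing.maximalIdeal A ∧ T.Acyc Q} ⟨_, le_rfl, S.I_le j, hT⟩
  by_cases hne : J = IsLocalRing.maximalIdeal A
  · rwa [hne] at hJ
  obtain ⟨s, hsJ, hs⟩ := exists_notMem_mul_mem (J := J) (by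
    intro x hx
    by_contra hcon
    have hreg : ∀ a, x * a ∈ J → a ∈ J := fun a ha => by
      by_contra haJ
      exact hcon ⟨a, haJ, ha⟩
    refine hmax _ ⟨hIJ.trans le_sup_left,
      sup_le hJm ((Ideal.span_singleton_le_iff_mem _).2 hx), hJ.sup_span hIJ hreg⟩ ?_
    refine lt_of_le_of_ne le_sup_left fun h => ?_
    have hxJ : x ∈ J := h ▸ Ideal.mem_sup_right (Ideal.mem_span_singleton_self x)
    have h1 := hreg 1 (by rwa [mul_one])
    exact (IsLocalRing.maximalIdeal.isMaximal A).ne_top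
      ((Ideal.eq_top_iff_one _).2 (hJm h1)))
  have hsm : s ∈ IsLocalRing.maximalIdeal A := by
    by_contra h
    rw [IsLocalRing.notMem_maximalIdeal] at h
    refine hne (le_antisymm hJm fun x hx => ?_)
    exact (Ideal.mul_unit_mem_iff_mem J h).1 (hs x hx)
  have hsmul : ∀ v : X.F, v ∈ X.sub (IsLocalRing.maximalIdeal A) ↔ s • v ∈ X.sub J := by
    refine fun v => forall_congr' fun a => ?_
    rw [map_smul, Finsupp.smul_apply, smul_eq_mul]
    refine ⟨fun h => mul_comm s _ ▸ hs _ h, fun h => ?_⟩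
    by_contra hu
    rw [IsLocalRing.notMem_maximalIdeal] at hu
    exact hsJ ((Ideal.mul_unit_mem_iff_mem J hu).1 h)
  have hstep : ∀ n, T.AcycAt (n + 1) (IsLocalRing.maximalIdeal A) →
      T.AcycAt n (IsLocalRing.maximalIdeal A) := by
    intro n hn u hu hdu
    have hR := hn.of_maximalIdeal (J ⊔ Ideal.span {s}) (hIJ.trans le_sup_left)
      (sup_le hJm ((Ideal.span_singleton_le_iff_mem _).2 hsm))
    obtain ⟨w, hw⟩ := hJ (s • u) (by rw [map_smul]; exact (hsmul _).1 hdu)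
    have hw1 : s • u - T.d (X.π (n + 1) w) ∈ X.sub J := by
      have := GrFree.map_mem_sub (X.π n) hw
      rw [map_sub, map_smul, hu] at this
      rwa [T.d_deg, add_neg_cancel_right]
    obtain ⟨w', hw'⟩ := hR (X.π (n + 1) w) (X.π_self _ _) (by
      have h1 := GrFree.sub_mono (le_sup_left : J ≤ J ⊔ Ideal.span {s}) hw1
      have h2 : s • u ∈ X.sub (J ⊔ Ideal.span {s}) :=
        GrFree.smul_mem_sub (Ideal.mem_sup_right (Ideal.mem_span_singleton_self s)) u
      have := sub_mem h2 h1
      rwa [sub_sub_cancel] at this)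
    obtain ⟨y, hy⟩ := GrFree.exists_of_mem_sub_sup hw'
    refine ⟨y, (hsmul _).2 ?_⟩
    have := add_mem (add_mem hw1 (GrFree.map_mem_sub T.d hy))
      (GrFree.sub_mono hIJ (T.dd_mem w'))
    convert this using 1
    simp only [map_sub, map_smul, smul_sub]
    abel
  refine acyc_iff.2 fun n => ?_
  by_cases hn : N ≤ n
  · exact hN n hn
  · have hle : n ≤ N := by omega
    clear hn
    induction n, hle using Int.leInductionDown with
    | base => exact hN N le_rfl
    | pred n hle ih => exact hstep _ (by rwa [sub_add_cancel])

end Crv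

end

section

open CategoryTheory

/-- The `A`-module `M` has projective dimension less than `n`. -/
def PDLT (A M : Type) [CommRing A] [AddCommGroup M] [Module A M] (n : ℕ) : Prop :=
  HasProjectiveDimensionLT (ModuleCat.of A M) n

/-- The `A`-module `M` has finite projective dimension. -/
def FinPD (A M : Type) [CommRing A] [AddCommGroup M] [Module A M] : Prop := ∃ n, PDLT A M n

namespace PDLT

variable {A M N P : Type} [CommRing A] [AddCommGroup M] [Module A M] [AddCommGroup N] [Module A N]
  [AddCommGroup P] [Module A P] {n : ℕ}

lemma mono {m : ℕ} (h : PDLT A M n) (hnm : n ≤ m) : PDLT A M m := by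
  have : HasProjectiveDimensionLT (ModuleCat.of A M) n := h
  exact hasProjectiveDimensionLT_of_ge _ n m hnm

lemma of_equiv (h : PDLT A M n) (e : M ≃ₗ[A] N) : PDLT A N n := by
  have : HasProjectiveDimensionLT (ModuleCat.of A M) n := h
  exact hasProjectiveDimensionLT_of_iso e.toModuleIso n

lemma one_iff : PDLT A M 1 ↔ Module.Projective A M := by
  rw [PDLT, ← projective_iff_hasProjectiveDimensionLT_one, ← IsProjective.iff_projective]

lemma of_projective [Module.Projective A M] : PDLT A M (n + 1) :=
  (one_iff.2 inferInstance).mono (Nat.le_add_left 1 n)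

variable {f : M →ₗ[A] N} {g : N →ₗ[A] P}

/-- The short exact sequence in the category of modules. -/
lemma shortExact (hf : Function.Injective f) (hg : Function.Surjective g)
    (hfg : Function.Exact f g) :
    (ShortComplex.mk (ModuleCat.ofHom f) (ModuleCat.ofHom g) (by
    ext x
    exact hfg.apply_apply_eq_zero x)).ShortExact :=
  ModuleCat.shortComplex_shortExact _ hfg hf hg

lemma left (hf : Function.Injective f) (hg : Function.Surjective g)
    (hfg : Function.Exact f g) (hN : PDLT A N n) (hP : PDLT A P (n + 1)) : PDLT A M n :=
  (shortExact hf hg hfg).hasProjectiveDimensionLT_X₁ n hN hP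

lemma middle (hf : Function.Injective f) (hg : Function.Surjective g)
    (hfg : Function.Exact f g) (hM : PDLT A M n) (hP : PDLT A P n) : PDLT A N n :=
  (shortExact hf hg hfg).hasProjectiveDimensionLT_X₂ n hM hP

lemma right (hf : Function.Injective f) (hg : Function.Surjective g)
    (hfg : Function.Exact f g) (hM : PDLT A M n) (hN : PDLT A N (n + 1)) : PDLT A P (n + 1) :=
  (shortExact hf hg hfg).hasProjectiveDimensionLT_X₃ n hM hN

end PDLT

namespace FinPD

variable {A M N P : Type} [CommRing A] [AddCommGroup M] [Module A M] [AddCommGroup N] [Module A N]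
  [AddCommGroup P] [Module A P] {f : M →ₗ[A] N} {g : N →ₗ[A] P}

lemma middle (hf : Function.Injective f) (hg : Function.Surjective g) (hfg : Function.Exact f g)
    (hM : FinPD A M) (hP : FinPD A P) : FinPD A N := by
  obtain ⟨m, hm⟩ := hM
  obtain ⟨p, hp⟩ := hP
  exact ⟨max m p, .middle hf hg hfg (hm.mono (le_max_left _ _)) (hp.mono (le_max_right _ _))⟩

lemma right (hf : Function.Injective f) (hg : Function.Surjective g) (hfg : Function.Exact f g)
    (hM : FinPD A M) (hN : FinPD A N) : FinPD A P := by
  obtain ⟨m, hm⟩ := hM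
  obtain ⟨p, hp⟩ := hN
  exact ⟨max m p + 1, .right hf hg hfg (hm.mono (le_max_left _ _))
    (hp.mono ((le_max_right _ _).trans (Nat.le_succ _)))⟩

end FinPD

namespace GrFree

variable {A : Type} [CommRing A] (X : GrFree A)

/-- The vectors whose component of degree `n` vanishes modulo `Q`. -/
noncomputable def grd (Q : Ideal A) (n : ℤ) : Submodule A X.F := (X.sub Q).comap (X.π n)

lemma mem_grd {Q : Ideal A} {n : ℤ} {v : X.F} : v ∈ X.grd Q n ↔ X.π n v ∈ X.sub Q := Iff.rfl

lemma projective_grd_bot (n : ℤ) : Module.Projective A (X.F ⧸ X.grd ⊥ n) := by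
  have : Module.Projective A X.F := .of_basis X.b
  have hle : X.grd ⊥ n ≤ LinearMap.ker (X.π n) := fun v hv => by
    rwa [mem_grd, sub_bot, Submodule.mem_bot] at hv
  refine .of_split ((X.grd ⊥ n).liftQ (X.π n) hle) (X.grd ⊥ n).mkQ ?_
  · refine Submodule.linearMap_qext _ (LinearMap.ext fun v => ?_)
    simp only [LinearMap.comp_apply, Submodule.mkQ_apply, Submodule.liftQ_apply, LinearMap.id_apply]
    rw [Submodule.Quotient.eq, mem_grd, map_sub, π_self, sub_self]
    exact zero_mem _

lemma finPD_grd [IsLocalRing A] {c : ℕ} (S : RegSeq A c) (j : ℕ) (n : ℤ) :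
    FinPD A (X.F ⧸ X.grd (S.I j) n) := by
  induction j with
  | zero =>
    rw [S.I_zero]
    exact ⟨1, PDLT.one_iff.2 (X.projective_grd_bot n)⟩
  | succ j ih =>
    by_cases hj : j < c
    · have hI : S.I (j + 1) = S.I j ⊔ Ideal.span {S.f ⟨j, hj⟩} := S.I_succ ⟨j, hj⟩
      let f : X.F ⧸ X.grd (S.I j) n →ₗ[A] X.F ⧸ X.grd (S.I j) n :=
        LinearMap.lsmul A _ (S.f ⟨j, hj⟩)
      have hle : X.grd (S.I j) n ≤ X.grd (S.I (j + 1)) n := fun v hv =>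
        sub_mono (S.I_mono (Nat.le_succ j)) hv
      refine FinPD.right (f := f) (g := Submodule.factor hle) ?_ (Submodule.factor_surjective hle)
        ?_ ih ih
      · rw [injective_iff_map_eq_zero]
        intro v hv
        obtain ⟨v, rfl⟩ := Submodule.Quotient.mk_surjective _ v
        rw [LinearMap.lsmul_apply, ← Submodule.Quotient.mk_smul, Submodule.Quotient.mk_eq_zero,
          mem_grd, map_smul] at hv
        rw [Submodule.Quotient.mk_eq_zero]
        exact RegSeq.mem_sub_of_smul (i := ⟨j, hj⟩) hv
      · intro v
        obtain ⟨v, rfl⟩ := Submodule.Quotient.mk_surjective _ v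
        rw [← Submodule.mkQ_apply, Submodule.factor_mk, Submodule.mkQ_apply,
          Submodule.Quotient.mk_eq_zero]
        constructor
        · intro hv
          rw [mem_grd, hI] at hv
          obtain ⟨y, hy⟩ := exists_of_mem_sub_sup hv
          refine ⟨Submodule.Quotient.mk y, ?_⟩
          rw [LinearMap.lsmul_apply, ← Submodule.Quotient.mk_smul, Submodule.mkQ_apply, eq_comm,
            Submodule.Quotient.eq, mem_grd]
          have := map_mem_sub (X.π n) hy
          rwa [map_sub, π_self, ← map_sub] at this
        · rintro ⟨y, hy⟩
          obtain ⟨y, rfl⟩ := Submodule.Quotient.mk_surjective _ y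
          rw [LinearMap.lsmul_apply, ← Submodule.Quotient.mk_smul, Submodule.mkQ_apply, eq_comm,
            Submodule.Quotient.eq, mem_grd] at hy
          have := add_mem (sub_mono (S.I_mono (Nat.le_succ j)) hy)
            (smul_mem_sub (S.f_mem (i := ⟨j, hj⟩) (Nat.lt_succ_self j)) (X.π n y))
          rwa [map_sub, map_smul, sub_add_cancel] at this
    · rwa [S.I_succ_of_le (not_lt.1 hj)]

end GrFree

end

section

open IsLocalRing

namespace Crv

variable {A : Type} [CommRing A] [IsLocalRing A] {c j : ℕ} {X : GrFree A} {S : RegSeq A c}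

/-- The submodule whose quotient is the cokernel of the differential with values in degree `n`,
modulo the ideal of the level. -/
noncomputable def cok (T : Crv X S j) (n : ℤ) : Submodule A X.F :=
  (LinearMap.range T.d ⊔ X.sub (S.I j)).comap (X.π n)

lemma mem_cok {T : Crv X S j} {n : ℤ} {u : X.F} :
    u ∈ T.cok n ↔ ∃ w, X.π n u - T.d (X.π (n + 1) w) ∈ X.sub (S.I j) := by
  rw [cok, Submodule.mem_comap, Submodule.mem_sup]
  constructor
  · rintro ⟨_, ⟨w, rfl⟩, q, hq, h⟩
    refine ⟨w, ?_⟩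
    have h1 : X.π n (T.d w + q) = X.π n u := by rw [h, X.π_self]
    rw [T.d_deg, add_neg_cancel_right, ← h1, map_add, add_sub_cancel_left]
    exact GrFree.map_mem_sub _ hq
  · rintro ⟨w, hw⟩
    exact ⟨_, ⟨_, rfl⟩, _, hw, add_sub_cancel _ _⟩

lemma mem_cok_of_d {T : Crv X S j} {n : ℤ} {u w : X.F} (h : X.π n u - T.d w ∈ X.sub (S.I j)) :
    u ∈ T.cok n := by
  refine mem_cok.2 ⟨w, ?_⟩
  have := GrFree.map_mem_sub (X.π n) h
  rwa [map_sub, X.π_self, ← add_neg_cancel_right n 1, ← T.d_deg, add_neg_cancel_right] at this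

variable [IsNoetherianRing A]

/-- A homology-free cone has no nonzero boundaries in the second summand. -/
lemma mem_sub_of_reduce {i : Fin c} {T : Crv X S (i + 1)} (hT : T.Acyc (S.I (i + 1))) {v u' v' : X.F}
    (h : GrFree.dmk _ 0 v - (ConeData.reduce i T).cone.d (GrFree.dmk _ u' v') ∈
      GrFree.sub _ (S.I i)) : v ∈ X.sub (S.I i) := by
  have h0 := h
  rw [ConeData.cone_d, GrFree.dmk_sub, GrFree.dmk_mem_sub] at h
  simp only [ConeData.reduce] at h
  obtain ⟨h1, -⟩ := h
  obtain ⟨w, hw⟩ := hT u' (by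
    have := sub_mem (GrFree.smul_mem_sub (S.f_mem (Nat.lt_succ_self i)) v')
      (GrFree.sub_mono (S.I_mono (Nat.le_succ i)) h1)
    convert this using 1
    abel)
  rw [S.I_succ i] at hw
  obtain ⟨y, hy⟩ := GrFree.exists_of_mem_sub_sup hw
  let p := GrFree.dmk (2 * (1 : ℕ) - 1 : ℤ) u' v' -
    (ConeData.reduce i T).cone.d (GrFree.dmk _ w (-y))
  obtain ⟨r, t, hrt⟩ := GrFree.exists_dmk p
  have hr : r ∈ X.sub (S.I i) := by
    have : p = GrFree.dmk _ r t := hrt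
    simp only [p] at this
    rw [ConeData.cone_d, GrFree.dmk_sub, GrFree.dmk_inj] at this
    rw [← this.1]
    simp only [ConeData.reduce]
    convert hy using 1
    rw [smul_neg]
    abel
  have hp : GrFree.dmk _ 0 v - (ConeData.reduce i T).cone.d p ∈ GrFree.sub _ (S.I i) := by
    have := add_mem h0 ((ConeData.reduce i T).cone.dd_mem (GrFree.dmk _ w (-y)))
    convert this using 1
    simp only [p]
    rw [map_sub]
    abel
  rw [hrt, ConeData.cone_d, GrFree.dmk_sub, GrFree.dmk_mem_sub] at hp
  simp only [ConeData.reduce] at hp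
  obtain ⟨h2, h3⟩ := hp
  have ht : t ∈ X.sub (S.I i) := RegSeq.mem_sub_of_smul (by
    have := add_mem h2 (GrFree.map_mem_sub T.d hr)
    convert this using 1
    abel)
  have := add_mem h3 (sub_mem (GrFree.map_mem_sub (T.χ i) hr) (GrFree.map_mem_sub T.d ht))
  convert this using 1
  abel

lemma finPD_cok_reduce {i : Fin c} {T : Crv X S (i + 1)} (hT : T.Acyc (S.I (i + 1))) {n : ℤ}
    (h : FinPD A (X.F ⧸ T.cok n)) :
    FinPD A ((X.double (2 * (1 : ℕ) - 1)).F ⧸ (ConeData.reduce i T).cone.cok n) := by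
  set s : ℤ := 2 * (1 : ℕ) - 1 with hs
  set L := (ConeData.reduce i T).cone with hL
  have hα : X.grd (S.I i) (n - s) ≤ (L.cok n).comap (X.dinr s) := fun v hv => by
    rw [GrFree.mem_grd] at hv
    rw [Submodule.mem_comap, GrFree.dinr_apply]
    refine mem_cok_of_d (w := 0) ?_
    rw [map_zero, sub_zero, GrFree.π_dmk, GrFree.dmk_mem_sub, map_zero]
    exact ⟨zero_mem _, hv⟩
  have hβ : L.cok n ≤ (T.cok n).comap (X.dfst s) := fun p hp => by
    obtain ⟨u, v, rfl⟩ := GrFree.exists_dmk p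
    obtain ⟨q, hq⟩ := mem_cok.1 hp
    obtain ⟨u', v', rfl⟩ := GrFree.exists_dmk q
    rw [GrFree.π_dmk, GrFree.π_dmk, hL, ConeData.cone_d, GrFree.dmk_sub, GrFree.dmk_mem_sub] at hq
    simp only [ConeData.reduce] at hq
    rw [Submodule.mem_comap, GrFree.dfst_dmk]
    refine mem_cok_of_d (w := X.π (n + 1) u') ?_
    have := sub_mem (GrFree.sub_mono (S.I_mono (Nat.le_succ i)) hq.1)
      (GrFree.smul_mem_sub (S.f_mem (Nat.lt_succ_self i)) (X.π (n + 1 - s) v'))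
    convert this using 1
    abel
  refine FinPD.middle (f := Submodule.mapQ _ _ (X.dinr s) hα)
    (g := Submodule.mapQ _ _ (X.dfst s) hβ) ?_ ?_ ?_ (X.finPD_grd S i (n - s)) h
  · rw [injective_iff_map_eq_zero]
    intro v hv
    obtain ⟨v, rfl⟩ := Submodule.Quotient.mk_surjective _ v
    rw [Submodule.mapQ_apply, Submodule.Quotient.mk_eq_zero, GrFree.dinr_apply, mem_cok] at hv
    obtain ⟨q, hq⟩ := hv
    obtain ⟨u', v', hq'⟩ := GrFree.exists_dmk (GrFree.π _ (n + 1) q)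
    rw [GrFree.π_dmk, map_zero, hq'] at hq
    rw [Submodule.Quotient.mk_eq_zero, GrFree.mem_grd]
    exact mem_sub_of_reduce hT hq
  · intro u
    obtain ⟨u, rfl⟩ := Submodule.Quotient.mk_surjective _ u
    exact ⟨Submodule.Quotient.mk (GrFree.dmk s u 0), rfl⟩
  · intro p
    obtain ⟨p, rfl⟩ := Submodule.Quotient.mk_surjective _ p
    obtain ⟨u, v, rfl⟩ := GrFree.exists_dmk p
    rw [Submodule.mapQ_apply, Submodule.Quotient.mk_eq_zero, GrFree.dfst_dmk]
    constructor
    · intro hu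
      obtain ⟨w, hw⟩ := mem_cok.1 hu
      rw [S.I_succ i] at hw
      obtain ⟨y, hy⟩ := GrFree.exists_of_mem_sub_sup hw
      let v₁ := v - T.χ i (X.π (n + 1) w) - T.d y
      refine ⟨Submodule.Quotient.mk v₁, ?_⟩
      rw [Submodule.mapQ_apply, GrFree.dinr_apply, eq_comm, Submodule.Quotient.eq, GrFree.dmk_sub]
      have hmem : GrFree.dmk s (X.π n u) v - GrFree.dmk s 0 v₁ -
          L.d (GrFree.dmk s (X.π (n + 1) w) (-y)) ∈ GrFree.sub _ (S.I i) := by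
        rw [hL, ConeData.cone_d, GrFree.dmk_sub, GrFree.dmk_sub, GrFree.dmk_mem_sub]
        simp only [ConeData.reduce, v₁]
        constructor
        · convert hy using 1
          rw [smul_neg]
          abel
        · convert zero_mem (X.sub (S.I i)) using 1
          rw [map_neg]
          abel
      have h1 := GrFree.map_mem_sub (GrFree.π _ n) hmem
      refine mem_cok.2 ⟨GrFree.dmk s (X.π (n + 1) w) (-y), ?_⟩
      rw [L.d_deg, add_neg_cancel_right]
      convert h1 using 1
      rw [map_sub, map_sub, ← GrFree.dmk_sub, map_sub, GrFree.π_dmk, GrFree.π_dmk, GrFree.π_dmk,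
        X.π_self]
    · rintro ⟨v₁, hv₁⟩
      obtain ⟨v₁, rfl⟩ := Submodule.Quotient.mk_surjective _ v₁
      rw [Submodule.mapQ_apply, GrFree.dinr_apply, eq_comm, Submodule.Quotient.eq,
        GrFree.dmk_sub] at hv₁
      have := hβ hv₁
      rwa [Submodule.mem_comap, GrFree.dfst_dmk, sub_zero] at this

lemma exists_acycAt_of_finPD {T : Crv X S 0} (hT : T.Acyc (S.I 0)) {n : ℤ}
    (h : FinPD A (X.F ⧸ T.cok n)) : ∃ N, ∀ m, N ≤ m → T.AcycAt m (maximalIdeal A) := by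
  rw [S.I_zero] at hT
  have hd (n : ℤ) : T.cok (n + 1) ≤ (X.grd ⊥ n).comap T.d := fun u hu => by
    obtain ⟨w, hw⟩ := mem_cok.1 hu
    have h1 := T.dd_mem (X.π (n + 1 + 1) w)
    rw [S.I_zero, GrFree.sub_bot, Submodule.mem_bot] at hw h1
    rw [Submodule.mem_comap, GrFree.mem_grd, ← add_neg_cancel_right n 1, ← T.d_deg,
      sub_eq_zero.1 hw, h1]
    exact zero_mem _
  have hle (n : ℤ) : X.grd ⊥ n ≤ T.cok n := fun u hu => by
    refine mem_cok_of_d (w := 0) ?_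
    rwa [map_zero, sub_zero, S.I_zero]
  let f (n : ℤ) : X.F ⧸ T.cok (n + 1) →ₗ[A] X.F ⧸ X.grd ⊥ n := Submodule.mapQ _ _ T.d (hd n)
  have hf (n : ℤ) : Function.Injective (f n) := by
    rw [injective_iff_map_eq_zero]
    intro u hu
    obtain ⟨u, rfl⟩ := Submodule.Quotient.mk_surjective _ u
    rw [Submodule.mapQ_apply, Submodule.Quotient.mk_eq_zero, GrFree.mem_grd,
      ← add_neg_cancel_right n 1, ← T.d_deg] at hu
    obtain ⟨w, hw⟩ := hT _ hu
    rw [Submodule.Quotient.mk_eq_zero]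
    exact mem_cok_of_d (by rwa [S.I_zero])
  have hg (n : ℤ) := Submodule.factor_surjective (hle n)
  have hfg (n : ℤ) : Function.Exact (f n) (Submodule.factor (hle n)) := by
    intro u
    obtain ⟨u, rfl⟩ := Submodule.Quotient.mk_surjective _ u
    rw [← Submodule.mkQ_apply, Submodule.factor_mk, Submodule.mkQ_apply,
      Submodule.Quotient.mk_eq_zero]
    constructor
    · intro hu
      obtain ⟨w, hw⟩ := mem_cok.1 hu
      refine ⟨Submodule.Quotient.mk w, ?_⟩
      rw [Submodule.mapQ_apply, Submodule.mkQ_apply, eq_comm, Submodule.Quotient.eq,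
        GrFree.mem_grd, map_sub]
      rwa [T.d_deg, add_neg_cancel_right, S.I_zero] at hw
    · rintro ⟨w, hw⟩
      obtain ⟨w, rfl⟩ := Submodule.Quotient.mk_surjective _ w
      rw [Submodule.mapQ_apply, Submodule.mkQ_apply, eq_comm, Submodule.Quotient.eq,
        GrFree.mem_grd, map_sub] at hw
      refine mem_cok.2 ⟨w, ?_⟩
      rwa [T.d_deg, add_neg_cancel_right, S.I_zero]
  have hproj (n : ℤ) : PDLT A (X.F ⧸ X.grd ⊥ n) 1 := PDLT.one_iff.2 (X.projective_grd_bot n)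
  have hdown (p : ℕ) : ∀ n, PDLT A (X.F ⧸ T.cok n) (p + 1) → ∃ N, PDLT A (X.F ⧸ T.cok N) 1 := by
    induction p with
    | zero => exact fun n hn => ⟨n, hn⟩
    | succ p ih =>
      exact fun n hn => ih (n + 1)
        (.left (hf n) (hg n) (hfg n) ((hproj n).mono (Nat.le_add_left _ _)) hn)
  obtain ⟨p, hp⟩ := h
  obtain ⟨N, hN⟩ := hdown p n (hp.mono (Nat.le_succ p))
  have hup (m : ℤ) (hm : N ≤ m) : PDLT A (X.F ⧸ T.cok m) 1 := by
    induction m, hm using Int.leInduction with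
    | base => exact hN
    | succ m _ ih =>
      exact .left (hf m) (hg m) (hfg m) (hproj m) (ih.mono (Nat.le_succ _))
  refine ⟨N + 1, fun m hm u hu hdu => ?_⟩
  obtain ⟨m, rfl⟩ : ∃ m', m = m' + 1 := ⟨m - 1, (sub_add_cancel _ _).symm⟩
  have := PDLT.one_iff.1 (hup m (by omega))
  obtain ⟨r, hr⟩ := ((hfg m).split_tfae (hf m) (hg m)).out 0 1 |>.1
    (Module.projective_lifting_property _ LinearMap.id (hg m))
  have h1 : (Submodule.Quotient.mk u : X.F ⧸ T.cok (m + 1)) ∈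
      (maximalIdeal A • (⊤ : Submodule A X.F)).map (T.cok (m + 1)).mkQ := by
    have h2 : r (f m (Submodule.Quotient.mk u)) = Submodule.Quotient.mk u :=
      LinearMap.congr_fun hr _
    rw [GrFree.sub_eq_smul_top] at hdu
    have h3 := Submodule.mem_map_of_mem (f := r ∘ₗ (X.grd ⊥ m).mkQ) hdu
    rw [Submodule.map_smul''] at h3 ⊢
    rw [← h2, Submodule.map_top, Submodule.range_mkQ]
    exact Submodule.smul_mono le_rfl le_top h3
  obtain ⟨q, hq, hqu⟩ := h1
  rw [Submodule.mkQ_apply, eq_comm, Submodule.Quotient.eq, mem_cok] at hqu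
  obtain ⟨w, hw⟩ := hqu
  refine ⟨X.π (m + 1 + 1) w, ?_⟩
  rw [SetLike.mem_coe, ← GrFree.sub_eq_smul_top] at hq
  have := add_mem (GrFree.sub_mono (S.I_le 0) hw) (GrFree.map_mem_sub (X.π (m + 1)) hq)
  convert this using 1
  rw [map_sub, hu]
  abel

end Crv

end

section

open IsLocalRing

namespace GradedOp

variable {k : Type} [Field k] {c : ℕ} {G : GradedOp k c}

lemma noeth_of_forall_eq_zero (h : ∀ v : G.V, v = 0) : G.Noeth := fun N => by
  have : G.low N = ⊥ := by
    rw [eq_bot_iff]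
    exact fun v _ => (Submodule.mem_bot _).2 (h v)
  rw [this]
  exact Submodule.fg_bot

lemma dual_eq_zero (h : ∀ v : G.V, v = 0) (φ : G.dual.V) : φ = 0 :=
  LinearMap.ext (f := show Module.Dual k G.V from φ) (g := (0 : Module.Dual k G.V)) fun v => by
    rw [h v, map_zero, map_zero]

end GradedOp

namespace Crv

variable {A : Type} [CommRing A] [IsLocalRing A] [IsNoetherianRing A] {c j : ℕ} {X : GrFree A}
  {S : RegSeq A c}

lemma gm_eq_zero {T : Crv X S j} (h : T.Acyc (maximalIdeal A)) (v : T.gm.V) : v = 0 := by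
  obtain ⟨u, hu, rfl⟩ := T.exists_gcl v
  exact gcl_eq_zero.2 (mem_Bd.2 (h u (mem_Z.1 hu)))

lemma AcycAt.of_P_eq_zero {T : Crv X S j} {n : ℤ} (h : ∀ v, T.gm.P n v = 0) :
    T.AcycAt n (maximalIdeal A) := by
  intro u hu hdu
  have hu' : u ∈ T.Z := mem_Z.2 hdu
  have := h (T.gcl u hu')
  rw [P_gcl, gcl_eq_zero, hu] at this
  exact mem_Bd.1 this

/-- Homology is Noetherian over the ring of cohomology operators, at both ends. -/
theorem noeth (j : ℕ) (hj : j ≤ c) : ∀ {X : GrFree A} {T : Crv X S j}, T.Acyc (S.I j) → ∀ {n : ℤ},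
    FinPD A (X.F ⧸ T.cok n) → T.gm.Noeth ∧ T.gm.dual.Noeth := by
  induction j with
  | zero =>
    intro X T hT n h
    obtain ⟨N, hN⟩ := exists_acycAt_of_finPD hT h
    have h0 := gm_eq_zero (hT.maximalIdeal hN)
    exact ⟨GradedOp.noeth_of_forall_eq_zero h0,
      GradedOp.noeth_of_forall_eq_zero (GradedOp.dual_eq_zero h0)⟩
  | succ j ih =>
    intro X T hT n h
    let i : Fin c := ⟨j, hj⟩
    have t := (ConeData.reduce i T).tri (ConeData.rep_reduce i T)
    obtain ⟨h1, h2⟩ := ih (Nat.le_of_succ_le hj) (ConeData.acyc_reduce (i := i) hT)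
      (finPD_cok_reduce (i := i) hT h)
    exact ⟨t.noeth_of_X h1, t.dual.noeth_of_X h2⟩

/-- The two ends of homology grow in the same way. -/
theorem symmetricGrowth (K : Ideal (MvPolynomial (Fin c) (ResidueField A))) :
    ∀ {X : GrFree A} {T : Crv X S c}, T.gm.dual.nilIdeal = K → T.Acyc (S.I c) → T.gm.Noeth →
    T.gm.dual.Noeth → (∀ n, T.gm.dim n = 0) ∨ ∃ m, SymmetricGrowth m T.gm.dim := by
  induction K using WellFoundedGT.induction with
  | ind K ih =>
  rintro X T rfl hT hN hN'
  obtain ⟨e, z, he, hz, hr, hr'⟩ := GradedOp.exists_regular T.Lift lift_X lift_zero Lift.mul Lift.add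
    Lift.sub hN hN'
  by_cases hmem : z ∈ T.gm.dual.nilIdeal
  · obtain ⟨N, h0⟩ := GradedOp.eventually_P_eq_zero_of_mem_nilIdeal hr' hz.homogSMul.dual hmem
    left
    intro n
    rw [GradedOp.dim_eq_zero_iff]
    have hE : ∀ n, -N ≤ n → T.AcycAt n (maximalIdeal A) := fun n hn => by
      refine .of_P_eq_zero fun v => ?_
      have := GradedOp.P_eq_zero_of_dual (h0 (-n) (by omega)) v
      rwa [neg_neg] at this
    exact fun v => gm_eq_zero (hT.maximalIdeal hE) _
  · obtain ⟨x, hx, hc, hrep⟩ := hz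
    have t := (ConeData.ofComm T x hx hc).tri hrep
    refine t.symmetricGrowth he (Lift.homogSMul ⟨x, hx, hc, hrep⟩) hr hr' ?_
    refine ih _ ?_ rfl (ConeData.acyc_ofComm hx hc hT) (t.noeth hN) (t.dual.noeth hN')
    exact lt_of_le_of_ne t.dual.nilIdeal_le fun h => hmem (h ▸ t.dual.mem_nilIdeal)

end Crv

end

section

open IsLocalRing

/-- A regular sequence in the maximal ideal as a `RegSeq`. -/
def RegSeq.ofIsRegular {A : Type} [CommRing A] [IsLocalRing A] {c : ℕ} (f : Fin c → A)
    (hf : ∀ i, f i ∈ maximalIdeal A) (hreg : RingTheory.Sequence.IsRegular A (List.ofFn f)) :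
    RegSeq A c where
  f := f
  mem := hf
  reg i a h := by
    have hspan : Ideal.span (Set.range fun l : Fin c => if l < i then f l else 0) =
        (Ideal.ofList ((List.ofFn f).take i) • ⊤ : Submodule A A) := by
      rw [Ideal.smul_top_eq_map, Algebra.algebraMap_self, Ideal.map_id,
        Submodule.restrictScalars_self]
      apply le_antisymm
      · rw [Ideal.span_le]
        rintro _ ⟨l, rfl⟩
        dsimp only
        split_ifs with hl
        · refine Ideal.subset_span ?_
          rw [Set.mem_ofPred_eq, List.mem_take_iff_getElem]
          exact ⟨l, by simpa using hl, by simp⟩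
        · exact zero_mem _
      · rw [Ideal.ofList, Ideal.span_le]
        intro x hx
        rw [Set.mem_ofPred_eq, List.mem_take_iff_getElem] at hx
        obtain ⟨l, hl, rfl⟩ := hx
        have hl' : l < c ∧ l < i := ⟨by simp at hl; omega, by simp at hl; omega⟩
        refine Ideal.subset_span ⟨⟨l, hl'.1⟩, ?_⟩
        have : (⟨l, hl'.1⟩ : Fin c) < i := hl'.2
        simp [this]
    rw [hspan] at h ⊢
    have := hreg.regular_mod_prev i (by simp)
    rw [List.getElem_ofFn] at this
    rw [← Submodule.Quotient.mk_eq_zero]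
    refine this ?_
    dsimp only
    rw [smul_zero, ← Submodule.Quotient.mk_smul, Submodule.Quotient.mk_eq_zero]
    exact h

lemma finPD_of_resolution {A M : Type} [CommRing A] [AddCommGroup M] [Module A M] {β : ℕ → ℕ}
    (d : ∀ i : ℕ, (Fin (β (i + 1)) → A) →ₗ[A] (Fin (β i) → A)) (ε : (Fin (β 0) → A) →ₗ[A] M)
    (hε : Function.Surjective ε) (h0 : LinearMap.ker ε = LinearMap.range (d 0))
    (hd : ∀ i, LinearMap.ker (d i) = LinearMap.range (d (i + 1))) {n : ℕ}
    (hn : ∀ i, n < i → β i = 0) : FinPD A M := by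
  have hfree (i : ℕ) : FinPD A (Fin (β i) → A) := ⟨1, PDLT.of_projective⟩
  have key (k : ℕ) : ∀ i, n ≤ i + k → FinPD A (LinearMap.range (d i)) := by
    induction k with
    | zero =>
      intro i hi
      have h1 : β (i + 1) = 0 := hn _ (by omega)
      have : IsEmpty (Fin (β (i + 1))) := by rw [h1]; infer_instance
      have : Subsingleton (LinearMap.range (d i)) :=
        (LinearMap.surjective_rangeRestrict (d i)).subsingleton
      exact ⟨1, PDLT.of_projective⟩
    | succ k ih =>
      intro i hi
      refine FinPD.right (f := (LinearMap.range (d (i + 1))).subtype) (g := (d i).rangeRestrict)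
        (Submodule.subtype_injective _) (LinearMap.surjective_rangeRestrict (d i)) ?_
        (ih (i + 1) (by omega)) (hfree (i + 1))
      rw [LinearMap.exact_iff, LinearMap.ker_rangeRestrict, Submodule.range_subtype, hd]
  refine FinPD.right (f := (LinearMap.range (d 0)).subtype) (g := ε)
    (Submodule.subtype_injective _) hε ?_ (key n 0 (by omega)) (hfree 0)
  rw [LinearMap.exact_iff, Submodule.range_subtype, h0]

namespace GrFree

/-- The graded free module with basis `t n` elements in degree `n`. -/
noncomputable def ofRanks (A : Type) [CommRing A] (t : ℤ → ℕ) : GrFree A where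
  ι := Σ n : ℤ, Fin (t n)
  F := (Σ n : ℤ, Fin (t n)) →₀ A
  b := Finsupp.basisSingleOne
  deg := Sigma.fst
  finDeg n := by
    refine (Set.finite_range fun i : Fin (t n) => (⟨n, i⟩ : Σ n : ℤ, Fin (t n))).subset ?_
    rintro ⟨m, i⟩ rfl
    exact ⟨i, rfl⟩

/-- The basis index of the `i`-th basis element in degree `n`. -/
def idx (A : Type) [CommRing A] {t : ℤ → ℕ} (n : ℤ) (i : Fin (t n)) : (ofRanks A t).ι :=
  (⟨n, i⟩ : Σ n : ℤ, Fin (t n))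

variable {A B : Type} [CommRing A] [CommRing B] [Algebra A B] {t : ℤ → ℕ}

lemma exists_idx (a : (ofRanks A t).ι) : ∃ n i, a = idx A n i := ⟨a.1, a.2, rfl⟩

lemma idx_injective (n : ℤ) : Function.Injective (idx A (t := t) n) := fun i l h => by
  cases h
  rfl

lemma deg_idx (n : ℤ) (i : Fin (t n)) : (ofRanks A t).deg (idx A n i) = n := rfl

/-- The component of degree `n`, with coordinates in the algebra `B`. -/
noncomputable def comp (n : ℤ) : (ofRanks A t).F →ₗ[A] (Fin (t n) → B) :=
  LinearMap.pi fun i => (Algebra.linearMap A B) ∘ₗ Finsupp.lapply (idx A n i)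

lemma comp_apply (n : ℤ) (u : (ofRanks A t).F) (i : Fin (t n)) :
    comp (B := B) n u i = algebraMap A B ((ofRanks A t).b.repr u (idx A n i)) :=
  rfl

lemma repr_π_ofRanks (m n : ℤ) (u : (ofRanks A t).F) (i : Fin (t n)) :
    (ofRanks A t).b.repr ((ofRanks A t).π m u) (idx A n i) =
      if n = m then (ofRanks A t).b.repr u (idx A n i) else 0 :=
  (ofRanks A t).repr_π m u _

lemma comp_π (m n : ℤ) (u : (ofRanks A t).F) :
    comp (B := B) n ((ofRanks A t).π m u) = if n = m then comp n u else 0 := by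
  ext i
  rw [comp_apply, repr_π_ofRanks]
  split_ifs
  · rfl
  · rw [map_zero]
    rfl

lemma repr_sum_idx (n : ℤ) (a : Fin (t n) → A) (i : Fin (t n)) :
    (ofRanks A t).b.repr (∑ l, a l • (ofRanks A t).b (idx A n l)) (idx A n i) = a i := by
  rw [map_sum, Finsupp.finsetSum_apply, Finset.sum_eq_single i]
  · rw [map_smul, Finsupp.smul_apply, Module.Basis.repr_self, Finsupp.single_eq_same, smul_eq_mul,
      mul_one]
  · intro l _ hl
    rw [map_smul, Finsupp.smul_apply, Module.Basis.repr_self,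
      Finsupp.single_eq_of_ne ((idx_injective n).ne hl).symm, smul_zero]
  · simp

lemma exists_comp_eq (h : Function.Surjective (algebraMap A B)) (n : ℤ) (v : Fin (t n) → B) :
    ∃ u, (ofRanks A t).π n u = u ∧ comp n u = v := by
  choose a ha using fun i => h (v i)
  refine ⟨(ofRanks A t).π n (∑ i, a i • (ofRanks A t).b (idx A n i)), π_self _ _ _, ?_⟩
  rw [comp_π, if_pos rfl]
  ext i
  rw [comp_apply, repr_sum_idx, ha]

lemma mem_sub_ker_iff {u : (ofRanks A t).F} :
    u ∈ (ofRanks A t).sub (RingHom.ker (algebraMap A B)) ↔ ∀ n, comp (B := B) n u = 0 := by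
  rw [mem_sub]
  constructor
  · intro h n
    ext i
    exact h _
  · rintro h ⟨n, i⟩
    exact congr_fun (h n) i

/-- A complex of free `B`-modules lifts to an endomorphism of degree `-1`. -/
lemma exists_lift (h : Function.Surjective (algebraMap A B))
    (d : ∀ i : ℤ, (Fin (t (i + 1)) → B) →ₗ[B] (Fin (t i) → B)) :
    ∃ D : (ofRanks A t).F →ₗ[A] (ofRanks A t).F, Homog (-1) D ∧
      ∀ n u, comp n (D u) = d n (comp (n + 1) u) := by
  have hex : ∀ a : (ofRanks A t).ι, ∃ w, (ofRanks A t).π ((ofRanks A t).deg a + -1) w = w ∧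
      ∀ n, n + 1 = (ofRanks A t).deg a → comp n w = d n (comp (n + 1) ((ofRanks A t).b a)) := by
    intro a
    obtain ⟨w, hw, hw'⟩ := exists_comp_eq h ((ofRanks A t).deg a + -1)
      (d _ (comp _ ((ofRanks A t).b a)))
    refine ⟨w, hw, fun n hn => ?_⟩
    obtain rfl : n = (ofRanks A t).deg a + -1 := by omega
    exact hw'
  choose w hw hw' using hex
  have hb : ∀ a, (ofRanks A t).b.constr A w ((ofRanks A t).b a) = w a := fun a =>
    (ofRanks A t).b.constr_basis A w a
  refine ⟨(ofRanks A t).b.constr A w, homog_of_basis fun a => by rw [hb, hw], fun n u => ?_⟩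
  have : comp n ∘ₗ (ofRanks A t).b.constr A w = (d n).restrictScalars A ∘ₗ comp (n + 1) := by
    refine (ofRanks A t).b.ext fun a => ?_
    rw [LinearMap.comp_apply, LinearMap.comp_apply, hb, LinearMap.restrictScalars_apply]
    by_cases hn : n + 1 = (ofRanks A t).deg a
    · exact hw' a n hn
    · have h1 : (ofRanks A t).π ((ofRanks A t).deg a) ((ofRanks A t).b a) = (ofRanks A t).b a := by
        rw [π_b, if_pos rfl]
      rw [← hw, ← h1, comp_π, if_neg (by omega), comp_π, if_neg hn, map_zero]
  exact LinearMap.congr_fun this u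

end GrFree

end

section

open IsLocalRing

namespace Crv

variable {A B : Type} [CommRing A] [IsLocalRing A] [CommRing B]
  [Algebra A B] {c : ℕ} {t : ℤ → ℕ} {S : RegSeq A c}

/-- The data expressing that the complex `d` of free `B`-modules is the reduction of `T`. -/
def Lifts (T : Crv (GrFree.ofRanks A t) S c)
    (d : ∀ i : ℤ, (Fin (t (i + 1)) → B) →ₗ[B] (Fin (t i) → B)) : Prop :=
  ∀ n u, GrFree.comp n (T.d u) = d n (GrFree.comp (n + 1) u)

variable {d : ∀ i : ℤ, (Fin (t (i + 1)) → B) →ₗ[B] (Fin (t i) → B)}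

lemma exists_lifts (hsurj : Function.Surjective (algebraMap A B))
    (hker : RingHom.ker (algebraMap A B) = S.I c)
    (hd : ∀ i : ℤ, LinearMap.ker (d i) = LinearMap.range (d (i + 1))) :
    ∃ T : Crv (GrFree.ofRanks A t) S c, T.Lifts d := by
  obtain ⟨D, hD, hDd⟩ := GrFree.exists_lift hsurj d
  obtain ⟨χ, hχ, hl, hsum⟩ := GrFree.Homog.exists_sum_lvl (S := S) (j := c) (hD.comp hD) (by
    intro v
    rw [← hker, GrFree.mem_sub_ker_iff]
    intro n
    rw [LinearMap.comp_apply, hDd, hDd, ← LinearMap.mem_ker, hd]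
    exact ⟨_, rfl⟩)
  exact ⟨⟨D, χ, hD, fun i => (hχ i).of_eq (by norm_num), hsum, hl⟩, hDd⟩

variable {T : Crv (GrFree.ofRanks A t) S c}

lemma Lifts.acyc (hT : T.Lifts d) (hsurj : Function.Surjective (algebraMap A B))
    (hker : RingHom.ker (algebraMap A B) = S.I c)
    (hd : ∀ i : ℤ, LinearMap.ker (d i) = LinearMap.range (d (i + 1))) :
    T.Acyc (S.I c) := by
  refine acyc_iff.2 fun m u hu hdu => ?_
  obtain ⟨n, rfl⟩ : ∃ n, m = n + 1 := ⟨m - 1, (sub_add_cancel _ _).symm⟩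
  rw [← hker, GrFree.mem_sub_ker_iff] at hdu
  have h1 := hdu n
  rw [hT, ← LinearMap.mem_ker, hd] at h1
  obtain ⟨v, hv⟩ := h1
  obtain ⟨w, hw, hwv⟩ := GrFree.exists_comp_eq hsurj _ v
  refine ⟨w, ?_⟩
  rw [← hker, GrFree.mem_sub_ker_iff]
  intro k
  rw [map_sub, hT]
  by_cases hk : k = n + 1
  · subst hk
    rw [hwv, hv, sub_self]
  · rw [← hu, ← hw, GrFree.comp_π, if_neg hk, GrFree.comp_π, if_neg (by omega), map_zero, sub_zero]

lemma Lifts.mem_cok (hT : T.Lifts d) (hsurj : Function.Surjective (algebraMap A B))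
    (hker : RingHom.ker (algebraMap A B) = S.I c)
    {n : ℤ} {u : (GrFree.ofRanks A t).F} :
    u ∈ T.cok n ↔ GrFree.comp n u ∈ LinearMap.range (d n) := by
  rw [Crv.mem_cok]
  constructor
  · rintro ⟨w, hw⟩
    rw [← hker, GrFree.mem_sub_ker_iff] at hw
    have := hw n
    rw [map_sub, GrFree.comp_π, if_pos rfl, hT, sub_eq_zero] at this
    exact ⟨_, this.symm⟩
  · rintro ⟨v, hv⟩
    obtain ⟨w, hw, hwv⟩ := GrFree.exists_comp_eq hsurj _ v
    refine ⟨w, ?_⟩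
    rw [hw, ← hker, GrFree.mem_sub_ker_iff]
    intro k
    rw [map_sub, hT, GrFree.comp_π]
    by_cases hk : k = n
    · subst hk
      rw [if_pos rfl, hwv, hv, sub_self]
    · rw [← hw, if_neg hk, GrFree.comp_π, if_neg (by omega), map_zero, sub_zero]

lemma Lifts.finPD_cok (hT : T.Lifts d) (hsurj : Function.Surjective (algebraMap A B))
    (hker : RingHom.ker (algebraMap A B) = S.I c)
    {M : Type} [AddCommGroup M] [Module A M] [Module B M] [IsScalarTower A B M]
    (hM : FinPD A M) {n : ℤ} (e : ((Fin (t n) → B) ⧸ LinearMap.range (d n)) ≃ₗ[B] M) :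
    FinPD A ((GrFree.ofRanks A t).F ⧸ T.cok n) := by
  let g : (GrFree.ofRanks A t).F →ₗ[A] M :=
    (e.toLinearMap ∘ₗ (LinearMap.range (d n)).mkQ).restrictScalars A ∘ₗ GrFree.comp n
  have hg : Function.Surjective g := by
    intro m
    obtain ⟨v, hv⟩ := Submodule.Quotient.mk_surjective _ (e.symm m)
    obtain ⟨u, -, hu⟩ := GrFree.exists_comp_eq hsurj n v
    refine ⟨u, ?_⟩
    change e (Submodule.Quotient.mk (GrFree.comp n u)) = m
    rw [hu, hv, LinearEquiv.apply_symm_apply]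
  have hgk : LinearMap.ker g = T.cok n := by
    ext u
    rw [LinearMap.mem_ker, hT.mem_cok hsurj hker]
    change e (Submodule.Quotient.mk (GrFree.comp n u)) = 0 ↔ _
    rw [LinearEquiv.map_eq_zero_iff, Submodule.Quotient.mk_eq_zero]
  obtain ⟨p, hp⟩ := hM
  rw [← hgk]
  exact ⟨p, hp.of_equiv (g.quotKerEquivOfSurjective hg).symm⟩

lemma Lifts.dim_eq [IsNoetherianRing A] [IsLocalRing B] (hT : T.Lifts d)
    (hmin : ∀ i : ℤ, LinearMap.range (d i) ≤
    (maximalIdeal B) • (⊤ : Submodule B (Fin (t i) → B))) (n : ℤ) : T.gm.dim n = t n := by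
  have hmem (u) : T.d u ∈ (GrFree.ofRanks A t).sub (maximalIdeal A) := by
    rw [GrFree.mem_sub]
    intro a
    obtain ⟨m, i, rfl⟩ := GrFree.exists_idx a
    have h1 : GrFree.comp m (T.d u) ∈ (maximalIdeal B) • (⊤ : Submodule B (Fin (t m) → B)) :=
      hmin m ⟨_, (hT m u).symm⟩
    have h2 : GrFree.comp m (T.d u) i ∈ maximalIdeal B := by
      have := Submodule.mem_map_of_mem (f := LinearMap.proj (R := B) (φ := fun _ => B) i) h1
      rw [Submodule.map_smul''] at this
      simpa using Submodule.smul_mono le_rfl le_top this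
    by_contra h
    rw [IsLocalRing.notMem_maximalIdeal] at h
    rw [GrFree.comp_apply] at h2
    exact (IsLocalRing.mem_maximalIdeal _).1 h2 (h.map _)
  have hZ (u) : u ∈ T.Z := mem_Z.2 (hmem u)
  have hB {u} (hu : u ∈ T.Bd) : u ∈ (GrFree.ofRanks A t).sub (maximalIdeal A) := by
    obtain ⟨w, hw⟩ := mem_Bd.1 hu
    simpa using add_mem hw (hmem w)
  let v (i : Fin (t n)) : T.E := T.cl ⟨(GrFree.ofRanks A t).b (GrFree.idx A n i), hZ _⟩
  have hsum (a : Fin (t n) → A) : ∑ i, residue A (a i) • v i =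
      T.cl ⟨∑ i, a i • (GrFree.ofRanks A t).b (GrFree.idx A n i), hZ _⟩ := by
    have h1 (i) : residue A (a i) • v i = a i • v i := algebraMap_smul (ResidueField A) (a i) (v i)
    simp only [h1, v, ← map_smul, ← map_sum]
    congr 1
    ext1
    simp
  have hli : LinearIndependent (ResidueField A) v := by
    rw [Fintype.linearIndependent_iff]
    intro g hg i
    choose a ha using fun i => residue_surjective (g i)
    simp only [← ha] at hg
    rw [hsum, cl_eq_zero] at hg
    have := GrFree.mem_sub.1 (hB hg) (GrFree.idx A n i)
    rw [GrFree.repr_sum_idx] at this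
    rw [← ha, residue_eq_zero_iff]
    exact this
  have hspan : LinearMap.range (T.proj n) = Submodule.span (ResidueField A) (Set.range v) := by
    apply le_antisymm
    · rintro _ ⟨x, rfl⟩
      obtain ⟨u, rfl⟩ := T.cl_surjective x
      rw [proj_cl]
      have hu : (GrFree.ofRanks A t).π n u =
          ∑ i, (GrFree.ofRanks A t).b.repr u (GrFree.idx A n i) •
            (GrFree.ofRanks A t).b (GrFree.idx A n i) := by
        have h1 : (GrFree.ofRanks A t).π n (∑ i, (GrFree.ofRanks A t).b.repr u (GrFree.idx A n i) •
            (GrFree.ofRanks A t).b (GrFree.idx A n i)) =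
            ∑ i, (GrFree.ofRanks A t).b.repr u (GrFree.idx A n i) •
            (GrFree.ofRanks A t).b (GrFree.idx A n i) := by
          rw [map_sum]
          refine Finset.sum_congr rfl fun i _ => ?_
          rw [map_smul, GrFree.π_b, GrFree.deg_idx, if_pos rfl]
        rw [← h1]
        refine GrFree.ext_repr fun a => ?_
        obtain ⟨m, i, rfl⟩ := GrFree.exists_idx a
        rw [GrFree.repr_π_ofRanks, GrFree.repr_π_ofRanks]
        split_ifs with h
        · subst h
          rw [GrFree.repr_sum_idx]
        · rfl
      simp only [hu]
      rw [← hsum]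
      exact sum_mem fun i _ => Submodule.smul_mem _ _ (Submodule.subset_span ⟨i, rfl⟩)
    · rw [Submodule.span_le]
      rintro _ ⟨i, rfl⟩
      refine ⟨v i, ?_⟩
      simp only [v]
      rw [proj_cl]
      congr 2
      rw [GrFree.π_b, GrFree.deg_idx, if_pos rfl]
  change Module.finrank (ResidueField A) (LinearMap.range (T.proj n)) = t n
  rw [hspan, finrank_span_eq_card hli, Fintype.card_fin]

end Crv

end

/-- Let `A` be a Noetherian local ring, `f₁, …, f_c ∈ 𝔪_A` an
`A`-regular sequence, `B = A/(f₁, …, f_c)`, and `M` a finitely generated `B`-module,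
maximal Cohen–Macaulay over `B`, admitting a finite free resolution over `A`. Let
`T` be a minimal complete resolution of `M` over `B`, given by ranks `t : ℤ → ℕ` and
differentials `d i : B^{t (i+1)} → B^{t i}`, exact everywhere, minimal, with
`coker (T₁ → T₀) ≅ M`. Then for every `n`, the two ends grow with the same leading
term: `limsup t i / iⁿ = limsup t (−i) / iⁿ` in `[0,∞]`. -/
theorem stmt_10
    (A : Type) [CommRing A] [IsNoetherianRing A] [IsLocalRing A]
    (B : Type) [CommRing B] [IsNoetherianRing B] [IsLocalRing B]
    (φ : A →+* B) (hφ : Function.Surjective φ)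
    (c : ℕ) (f : Fin c → A) (hf : ∀ i, f i ∈ maximalIdeal A)
    (hreg : RingTheory.Sequence.IsRegular A (List.ofFn f))
    (hker : RingHom.ker φ = Ideal.span (Set.range f))
    (M : Type) [AddCommGroup M] [Module B M] [Module.Finite B M]
    [Module A M] (hcompat : ∀ (a : A) (m : M), a • m = φ a • m)
    (hfinresA : ∃ βA : ℕ → ℕ, IsFreeResolutionBetti A M βA ∧ ∃ n, ∀ i, n < i → βA i = 0)
    (hMCM : ∃ rs : List B, (∀ x ∈ rs, x ∈ maximalIdeal B) ∧
      RingTheory.Sequence.IsRegular M rs ∧ (rs.length : WithBot ℕ∞) = ringKrullDim B)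
    (t : ℤ → ℕ)
    (d : ∀ i : ℤ, (Fin (t (i + 1)) → B) →ₗ[B] (Fin (t i) → B))
    (hacyclic : ∀ i : ℤ, LinearMap.ker (d i) = LinearMap.range (d (i + 1)))
    (hmin : ∀ i : ℤ, LinearMap.range (d i) ≤
      (maximalIdeal B) • (⊤ : Submodule B (Fin (t i) → B)))
    (hcoker : Nonempty ((((Fin (t 0) → B) ⧸ LinearMap.range (d 0))) ≃ₗ[B] M))
    (n : ℕ) :
    limsup (fun i : ℕ => (t (i : ℤ) : ENNReal) / (i : ENNReal) ^ n) atTop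
      = limsup (fun i : ℕ => (t (-(i : ℤ)) : ENNReal) / (i : ENNReal) ^ n) atTop := by
  let : Algebra A B := φ.toAlgebra
  have : IsScalarTower A B M := .of_algebraMap_smul fun a m => (hcompat a m).symm
  let S := RegSeq.ofIsRegular f hf hreg
  have hI : RingHom.ker (algebraMap A B) = S.I c := hker.trans S.I_eq_span.symm
  obtain ⟨β, ⟨dA, ε, hε, h0, hdA⟩, N, hN⟩ := hfinresA
  obtain ⟨e⟩ := hcoker
  obtain ⟨T, hT⟩ := Crv.exists_lifts (S := S) hφ hI hacyclic
  have hac := hT.acyc hφ hI hacyclic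
  have hno := Crv.noeth c le_rfl hac
    (hT.finPD_cok hφ hI (finPD_of_resolution dA ε hε h0 hdA hN) e)
  have hdim : T.gm.dim = t := funext (hT.dim_eq hmin)
  rcases Crv.symmetricGrowth _ rfl hac hno.1 hno.2 with hz | ⟨m, hm⟩
  · rw [hdim] at hz
    simp [hz]
  · rw [hdim] at hm
    exact hm.limsup_eq n
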